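/- Fix an integer d ≥ 2. There exist constants C > 0 and Ω > 0 such that for every integer N ≥ 2, the number of polynomials p ∈ P_d(N) whose Galois group lies in the alternating group — i.e. such that Equiv.Perm.sign (galActionHom g) = 1 for every g ∈ Gal(p) — is at most C · N^{d-1} · (log N)^Ω. Equivalently, the probability that a random monic polynomial with coefficients chosen uniformly from [-N, N] has Galois group contained in A_d is at most (log N)^Ω / N up to a constant. -/

import Mathlib

set_option linter.unusedSectionVars false
namespace GAC
open Polynomial
lemma isLocalRing_zmod_pow (p k : ℕ) (hp : p.Prime) (hk : k ≠ 0) : IsLocalRing (ZMod (p ^ k)) := by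
  have := Fact.mk hp
  have : Fact (1 < p ^ k) := ⟨Nat.one_lt_pow hk hp.one_lt⟩
  have : Nontrivial (ZMod (p ^ k)) := ZMod.nontrivial _
  exact IsLocalRing.of_surjective' (PadicInt.toZModPow (p := p) k) (ZMod.ringHom_surjective _)
lemma idem_trace (p k d : ℕ) (hp : p.Prime) (hk : d < p ^ k)
    (X : Matrix (Fin d) (Fin d) (ZMod (p ^ k))) (hX : X * X = X) (h0 : X ≠ 0) :
    X.trace ≠ 0 := by
  have hk0 : k ≠ 0 := by
    rintro rfl
    have : d = 0 := by simpa using hk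
    subst this
    exact h0 (Subsingleton.elim _ _)
  have := isLocalRing_zmod_pow p k hp hk0
  set f := Matrix.toLin' X with hf
  have hid : IsIdempotentElem f := by
    rw [IsIdempotentElem, hf, Module.End.mul_eq_comp, ← Matrix.toLin'_mul, hX]
  have hc : IsCompl (LinearMap.range f) (LinearMap.ker f) := LinearMap.IsIdempotentElem.isCompl hid
  have : Module.Projective (ZMod (p ^ k)) (LinearMap.range f) := by
    refine Module.Projective.of_split (LinearMap.range f).subtype f.rangeRestrict ?_
    ext ⟨x, y, rfl⟩
    have := LinearMap.congr_fun hid y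
    simpa using congrFun this _
  have : Module.Projective (ZMod (p ^ k)) (LinearMap.ker f) := by
    refine Module.Projective.of_split (LinearMap.ker f).subtype
      ((1 - f).codRestrict (LinearMap.ker f) ?_) ?_
    · intro y
      have := LinearMap.congr_fun hid y
      simp at this
      simp [this]
    · ext ⟨x, hx⟩
      have : f x = 0 := hx
      simp [this]
  have : NeZero (p ^ k) := ⟨(Nat.pow_pos hp.pos).ne'⟩
  have : Module.Finite (ZMod (p ^ k)) (LinearMap.ker f) := Module.Finite.of_finite
  have : Module.Free (ZMod (p ^ k)) (LinearMap.range f) := Module.free_of_flat_of_isLocalRing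
  have : Module.Free (ZMod (p ^ k)) (LinearMap.ker f) := Module.free_of_flat_of_isLocalRing
  have htr : LinearMap.trace _ _ f = (Module.finrank (ZMod (p ^ k)) (LinearMap.range f) : ZMod (p ^ k)) :=
    (LinearMap.IsIdempotentElem.isProj_range f hid).trace
  rw [hf, Matrix.trace_toLin'_eq, ← hf] at htr
  rw [htr, Ne, ZMod.natCast_eq_zero_iff]
  have h1 : Module.finrank (ZMod (p ^ k)) (LinearMap.range f) ≤ d := by
    simpa using Submodule.finrank_le (LinearMap.range f)
  have h2 : Module.finrank (ZMod (p ^ k)) (LinearMap.range f) ≠ 0 := by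
    intro h
    rw [Module.finrank_eq_zero_iff_of_free, Submodule.subsingleton_iff_eq_bot,
      LinearMap.range_eq_bot] at h
    exact h0 (by simpa [hf] using h)
  exact fun h => absurd (Nat.le_of_dvd (Nat.pos_of_ne_zero h2) h) (by omega)
lemma mem_span_iff_mat {S : Type*} [CommRing S] (d n : ℕ) (b : Module.Basis (Fin d) ℤ S) (z : S) :
    z ∈ Ideal.span {(n : S)} ↔
      (Algebra.leftMulMatrix b z).map (Int.castRingHom (ZMod n)) = 0 := by
  constructor
  · intro hz
    obtain ⟨w, rfl⟩ := Ideal.mem_span_singleton.mp hz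
    rw [← nsmul_eq_mul, map_nsmul]
    ext i j
    rw [Matrix.map_apply, Matrix.smul_apply, map_nsmul]
    simp only [nsmul_eq_mul, CharP.cast_eq_zero, zero_mul, Matrix.zero_apply]
  · intro hz
    have hdiv : ∀ i j, (n : ℤ) ∣ Algebra.leftMulMatrix b z i j := by
      intro i j
      have := congrFun (congrFun hz i) j
      exact (ZMod.intCast_zmod_eq_zero_iff_dvd _ _).mp this
    have h2 : ∀ j, (n : ℤ) ∣ b.repr z j := by
      intro j
      have hz1 : z = z * ∑ l, b.repr 1 l • b l := by rw [b.sum_repr]; simp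
      rw [hz1, Finset.mul_sum, map_sum, Finsupp.finsetSum_apply]
      refine Finset.dvd_sum fun l _ => ?_
      rw [mul_smul_comm, map_smul, Finsupp.smul_apply, smul_eq_mul,
        ← Algebra.leftMulMatrix_eq_repr_mul]
      exact (hdiv j l).mul_left _
    rw [← b.sum_repr z]
    refine Ideal.sum_mem _ fun j _ => ?_
    obtain ⟨c, hc⟩ := h2 j
    rw [hc, zsmul_eq_mul]
    push_cast
    rw [mul_assoc]
    exact Ideal.mul_mem_right _ _ (Ideal.mem_span_singleton_self _)
lemma idem_trace_ring {S : Type*} [CommRing S] (p k d : ℕ) (hp : p.Prime) (hk : d < p ^ k)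
    (b : Module.Basis (Fin d) ℤ S) (P Q : Ideal S) (a x : S) (ha : a ∈ P) (hx : x ∈ Q)
    (hax : a + x = 1) (hP : P ≠ ⊤) (hmul : P * Q = Ideal.span {((p ^ k : ℕ) : S)}) :
    ¬ ((p ^ k : ℕ) : ℤ) ∣ Algebra.trace ℤ S x := by
  have hxx : x * x - x ∈ P * Q := by
    have : x * x - x = (-a) * x := by rw [eq_sub_of_add_eq hax]; ring
    rw [this]; exact Ideal.mul_mem_mul (P.neg_mem ha) hx
  have hxn : x ∉ P * Q := fun h => hP (by
    rw [Ideal.eq_top_iff_one, ← hax]; exact P.add_mem ha (Ideal.mul_le_left h))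
  rw [hmul] at hxx hxn
  rw [mem_span_iff_mat d _ b] at hxx hxn
  rw [map_sub, map_mul] at hxx
  set M := Algebra.leftMulMatrix b x with hM
  let φ := Int.castRingHom (ZMod (p ^ k))
  have h3 : (M * M - M).map φ = M.map φ * M.map φ - M.map φ := by
    ext i j; simp [Matrix.mul_apply]
  have ht := idem_trace p k d hp hk (M.map φ) (sub_eq_zero.mp (h3 ▸ hxx)) hxn
  rw [Algebra.trace_eq_matrix_trace b]
  intro hdvd
  apply ht
  have : (M.map φ).trace = φ M.trace := by simp [Matrix.trace]
  rw [this]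
  exact (ZMod.intCast_zmod_eq_zero_iff_dvd _ _).mpr hdvd
open NumberField in
lemma not_dvd_different (K : Type*) [Field K] [NumberField K] (p k : ℕ) (hp : p.Prime)
    (hk : Module.finrank ℚ K < p ^ k) (P Q : Ideal (𝓞 K)) (hPQ : IsCoprime P Q) (hP : P ≠ ⊤)
    (hmul : P * Q = Ideal.span {((p ^ k : ℕ) : 𝓞 K)}) : ¬ P ∣ differentIdeal ℤ (𝓞 K) := by
  obtain ⟨a, ha, x, hx, hax⟩ := Submodule.mem_sup.mp ((Ideal.isCoprime_iff_sup_eq.mp hPQ).symm ▸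
    (Submodule.mem_top : (1 : 𝓞 K) ∈ (⊤ : Ideal (𝓞 K))))
  refine not_dvd_differentIdeal_of_intTrace_not_mem ℤ (p := Ideal.span {((p ^ k : ℕ) : ℤ)}) P Q
    ?_ x hx ?_
  · rw [hmul, Ideal.map_span]; simp
  rw [Algebra.intTrace_eq_trace, Ideal.mem_span_singleton]
  let b : Module.Basis (Fin (Module.finrank ℚ K)) ℤ (𝓞 K) := (RingOfIntegers.basis K).reindex
    (Fintype.equivFinOfCardEq (by
      rw [← Module.finrank_eq_card_basis (RingOfIntegers.basis K), RingOfIntegers.rank]))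
  exact idem_trace_ring p k _ hp hk b P Q a x ha hx hax hP hmul
end GAC
namespace GAC
open Polynomial NumberField UniqueFactorizationMonoid
lemma exists_res_poly {S : Type*} [CommRing S] (p : ℕ) (hp : p.Prime) (P : Ideal S) [P.IsMaximal]
    [Finite (S ⧸ P)] (hpP : (p : S) ∈ P) (a : S) (F : ℕ) (hF : Nat.card (S ⧸ P) = p ^ F) :
    ∃ r : (ZMod p)[X], r.Monic ∧ r.natDegree ≤ F ∧
      ∀ R : ℤ[X], r ∣ R.map (Int.castRingHom (ZMod p)) → aeval a R ∈ P := by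
  have := Fact.mk hp
  have hch : CharP (S ⧸ P) p := by
    have : Nontrivial (S ⧸ P) := Ideal.Quotient.nontrivial_iff.mpr (Ideal.IsPrime.ne_top inferInstance)
    refine (CharP.charP_iff_prime_eq_zero hp).mpr ?_
    have := Ideal.Quotient.eq_zero_iff_mem.mpr hpP
    simpa using this
  let _ := Ideal.Quotient.field P
  let _ : Algebra (ZMod p) (S ⧸ P) := ZMod.algebra _ p
  have : Module.Finite (ZMod p) (S ⧸ P) := Module.Finite.of_finite
  refine ⟨minpoly (ZMod p) (Ideal.Quotient.mk P a), minpoly.monic (Algebra.IsIntegral.isIntegral _),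
    (minpoly.natDegree_le _).trans ?_, ?_⟩
  · have h := Module.natCard_eq_pow_finrank (K := ZMod p) (V := S ⧸ P)
    rw [hF, Nat.card_zmod] at h
    exact (Nat.pow_right_injective hp.two_le h).ge
  · intro R hR
    rw [← Ideal.Quotient.eq_zero_iff_mem]
    have h1 : aeval (Ideal.Quotient.mk P a) (R.map (Int.castRingHom (ZMod p))) = 0 := by
      obtain ⟨c, hc⟩ := hR
      rw [hc, map_mul, minpoly.aeval, zero_mul]
    rw [aeval_def, eval₂_map] at h1
    rw [aeval_def, hom_eval₂]
    rw [← h1]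
    congr 1
    exact RingHom.ext_int _ _
lemma dvd_pow_of_pow_mem {S : Type*} [CommRing S] [IsDomain S] [CharZero S]
    [Algebra.IsIntegral ℤ S] (p : ℕ) (a : S) (R : ℤ[X]) (M : ℕ)
    (h : (aeval a R) ^ M ∈ Ideal.span {(p : S)}) :
    ∃ s : ℕ, (minpoly ℤ a).map (Int.castRingHom (ZMod p)) ∣
      (R.map (Int.castRingHom (ZMod p))) ^ s := by
  obtain ⟨δ, hδ⟩ := Ideal.mem_span_singleton.mp h
  have hint := Algebra.IsIntegral.isIntegral (R := ℤ) δ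
  set g := minpoly ℤ δ
  have h1 : aeval ((p : S) * δ) (scaleRoots g (p : ℤ)) = 0 := by
    have := scaleRoots_aeval_eq_zero (r := (p : ℤ)) (minpoly.aeval ℤ δ)
    simpa using this
  have h2 : minpoly ℤ a ∣ (scaleRoots g (p : ℤ)).comp (R ^ M) := by
    refine minpoly.isIntegrallyClosed_dvd (Algebra.IsIntegral.isIntegral _) ?_
    rw [aeval_comp, map_pow, hδ, h1]
  refine ⟨M * g.natDegree, ?_⟩
  have h3 := Polynomial.map_dvd (Int.castRingHom (ZMod p)) h2
  have h4 : (scaleRoots g (p : ℤ)).map (Int.castRingHom (ZMod p)) = X ^ g.natDegree := by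
    ext i
    rw [coeff_map, coeff_scaleRoots, coeff_X_pow]
    split_ifs with hi
    · subst hi; simp [(minpoly.monic hint).leadingCoeff, g]
    · rcases lt_or_gt_of_ne hi with hi | hi
      · have : g.natDegree - i ≠ 0 := by omega
        simp [this]
      · simp [coeff_eq_zero_of_natDegree_lt hi]
  rwa [Polynomial.map_comp, h4, X_pow_comp, Polynomial.map_pow, ← pow_mul] at h3
lemma factorization_absNorm {S : Type*} [CommRing S] [IsDedekindDomain S] [Module.Free ℤ S]
    [Module.Finite ℤ S] [CharZero S] (I : Ideal S) (hI : I ≠ ⊥) (p : ℕ) :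
    (Ideal.absNorm I).factorization p =
      ((normalizedFactors I).map (fun P => (Ideal.absNorm P).factorization p)).sum := by
  have h : ∀ s : Multiset (Ideal S), (∀ P ∈ s, P ≠ ⊥) → (Ideal.absNorm s.prod).factorization p =
      (s.map (fun P => (Ideal.absNorm P).factorization p)).sum := by
    intro s
    induction s using Multiset.induction with
    | empty => intro _; simp
    | cons a s ih =>
      intro hs
      have h1 : Ideal.absNorm a ≠ 0 := by
        rw [Ne, Ideal.absNorm_eq_zero_iff]; exact hs a (by simp)
      have h2 : Ideal.absNorm s.prod ≠ 0 := by
        rw [Ne, Ideal.absNorm_eq_zero_iff]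
        exact Multiset.prod_ne_zero (fun h => hs ⊥ (by simp [show (⊥ : Ideal S) ∈ s from h]) rfl)
      rw [Multiset.prod_cons, map_mul, Nat.factorization_mul h1 h2, Finsupp.add_apply,
        ih (fun P hP => hs P (by simp [hP]))]
      simp
  conv_lhs => rw [← associated_iff_eq.mp (prod_normalizedFactors hI)]
  exact h _ fun P hP => (prime_of_normalized_factor P hP).ne_zero
variable (K : Type*) [Field K] [NumberField K]
lemma local_disc (p k : ℕ) (hp : p.Prime) (hk : Module.finrank ℚ K < p ^ k) (a : 𝓞 K) :
    ∃ R : (ZMod p)[X], R.Monic ∧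
      R.natDegree + (discr K).natAbs.factorization p ≤ k * Module.finrank ℚ K ∧
      ∃ M : ℕ, (minpoly ℤ a).map (Int.castRingHom (ZMod p)) ∣ R ^ M := by
  classical
  set I : Ideal (𝓞 K) := Ideal.span {(p : 𝓞 K)} with hI
  have hp0 : (p : 𝓞 K) ≠ 0 := by exact_mod_cast hp.ne_zero
  have hI0 : I ≠ ⊥ := by rw [hI, Ne, Ideal.span_singleton_eq_bot]; exact hp0
  have hkpos : k ≠ 0 := by
    rintro rfl
    have := Module.finrank_pos (R := ℚ) (M := K)
    simp at hk; omega
  set s := (normalizedFactors I).toFinset with hs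
  have hsmem : ∀ P : Ideal (𝓞 K), P ∈ s ↔ P.IsPrime ∧ (p : 𝓞 K) ∈ P := by
    intro P
    rw [hs, Multiset.mem_toFinset, Ideal.mem_normalizedFactors_iff hI0, hI,
      Ideal.span_singleton_le_iff_mem]
  have hne : ∀ P ∈ s, P ≠ ⊥ := fun P hP h => hp0 (by
    have := ((hsmem P).mp hP).2; rw [h] at this; simpa using this)
  have hmax : ∀ P ∈ s, P.IsMaximal := fun P hP =>
    Ring.DimensionLEOne.maximalOfPrime (hne P hP) ((hsmem P).mp hP).1
  have hnI : Ideal.absNorm I = p ^ Module.finrank ℚ K := by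
    rw [hI, Ideal.absNorm_span_natCast, RingOfIntegers.rank]
  have hnP : ∀ P ∈ s, ∃ F, Ideal.absNorm P = p ^ F := by
    intro P hP
    have : P ∣ I := dvd_of_mem_normalizedFactors (Multiset.mem_toFinset.mp hP)
    have := map_dvd Ideal.absNorm this
    rw [hnI] at this
    obtain ⟨F, -, hF⟩ := (Nat.dvd_prime_pow hp).mp this
    exact ⟨F, hF⟩
  choose! F hF using hnP
  have hFfac : ∀ P ∈ s, (Ideal.absNorm P).factorization p = F P := by
    intro P hP; rw [hF P hP, Nat.Prime.factorization_pow hp]; simp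
  have hef : ∑ P ∈ s, (normalizedFactors I).count P * F P = Module.finrank ℚ K := by
    have := factorization_absNorm I hI0 p
    rw [hnI, Nat.Prime.factorization_pow hp, Finset.sum_multiset_map_count] at this
    simp only [Finsupp.single_eq_same, smul_eq_mul] at this
    rw [this]
    exact Finset.sum_congr rfl fun P hP => by rw [hFfac P hP]
  set D := differentIdeal ℤ (𝓞 K) with hD
  have hD0 : D ≠ ⊥ := differentIdeal_ne_bot
  have hdisc : (discr K).natAbs.factorization p = ∑ P ∈ s, (normalizedFactors D).count P * F P := by
    rw [← absNorm_differentIdeal (K := K) (𝒪 := 𝓞 K), factorization_absNorm D hD0 p,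
      Finset.sum_multiset_map_count]
    rw [Finset.sum_congr_of_eq_on_inter (s₂ := s) (g := fun P => (normalizedFactors D).count P * F P)]
    · intro P hP hPs
      have hPp := (Ideal.mem_normalizedFactors_iff hD0).mp (Multiset.mem_toFinset.mp hP)
      have : ¬ p ∣ Ideal.absNorm P := by
        intro h
        apply hPs
        rw [hsmem]
        refine ⟨hPp.1, ?_⟩
        have hPb : P ≠ ⊥ := fun h => hPs (by
          have := dvd_of_mem_normalizedFactors (Multiset.mem_toFinset.mp hP)
          rw [h] at this; exact absurd (zero_dvd_iff.mp this) hD0)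
        have hPm : P.IsMaximal := Ring.DimensionLEOne.maximalOfPrime hPb hPp.1
        have : Finite (𝓞 K ⧸ P) := Ideal.finiteQuotientOfFreeOfNeBot P hPb
        have := Fact.mk hp
        rw [Ideal.absNorm_apply, Submodule.cardQuot_apply] at h
        obtain ⟨x, hx⟩ := exists_prime_addOrderOf_dvd_card' p h
        have h5 : p • x = 0 := by rw [← hx]; exact addOrderOf_nsmul_eq_zero x
        have h6 : x ≠ 0 := by
          rintro rfl
          rw [addOrderOf_zero] at hx
          exact hp.one_lt.ne hx
        let _ := Ideal.Quotient.field P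
        rw [nsmul_eq_mul] at h5
        have h7 := (mul_eq_zero.mp h5).resolve_right h6
        rw [← Ideal.Quotient.eq_zero_iff_mem]
        simpa using h7
      simp [Nat.factorization_eq_zero_of_not_dvd this]
    · intro P hP hPs
      simp only [Multiset.mem_toFinset] at hPs
      simp [Multiset.count_eq_zero_of_notMem hPs]
    · intro P hP hPs
      rw [hFfac P hPs, smul_eq_mul]
  have hcnt : ∀ P ∈ s, (normalizedFactors D).count P + 1 ≤ k * (normalizedFactors I).count P := by
    intro P hP
    by_contra! hcon
    set e := (normalizedFactors I).count P with he
    have hPp : Prime P := Ideal.prime_of_isPrime (hne P hP) ((hsmem P).mp hP).1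
    have h1 : P ^ (k * e) ∣ D := by
      rw [dvd_iff_normalizedFactors_le_normalizedFactors (pow_ne_zero _ (hne P hP)) hD0,
        normalizedFactors_pow, normalizedFactors_irreducible hPp.irreducible, normalize_eq,
        Multiset.nsmul_singleton, ← Multiset.le_count_iff_replicate_le]
      omega
    have hmult : P ^ e ∣ I ∧ ¬ P ^ (e + 1) ∣ I := by
      have h3 := emultiplicity_eq_count_normalizedFactors hPp.irreducible hI0
      rw [normalize_eq, ← he, emultiplicity_eq_coe] at h3
      exact h3
    obtain ⟨⟨Q, hQ⟩, h4⟩ := hmult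
    have hPQ : ¬ P ∣ Q := fun h => h4 (by rw [hQ, pow_succ]; exact mul_dvd_mul_left _ h)
    have he0 : e ≠ 0 := by
      rw [he, Ne, Multiset.count_eq_zero, not_not, ← Multiset.mem_toFinset]; exact hP
    have hcop : IsCoprime (P ^ e) Q := by
      refine IsCoprime.pow_left ?_
      have := hmax P hP
      exact (Ideal.isCoprime_iff_sup_eq.mpr ((this.out.2 _ (left_lt_sup.mpr (fun h => hPQ (Ideal.dvd_iff_le.mpr h))))))
    refine not_dvd_different K p k hp hk (P ^ (k * e)) (Q ^ k) ?_ ?_ ?_ h1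
    · rw [mul_comm, pow_mul]; exact hcop.pow
    · intro h
      have := Ideal.pow_le_self (I := P) (Nat.mul_ne_zero hkpos he0)
      rw [h] at this
      exact (hmax P hP).ne_top (top_le_iff.mp this)
    · rw [mul_comm k e, pow_mul, ← mul_pow, ← hQ, hI, Ideal.span_singleton_pow]; simp
  have hres : ∀ P ∈ s, ∃ r : (ZMod p)[X], r.Monic ∧ r.natDegree ≤ F P ∧
      ∀ R : ℤ[X], r ∣ R.map (Int.castRingHom (ZMod p)) → aeval a R ∈ P := by
    intro P hP
    have := hmax P hP
    have : Finite (𝓞 K ⧸ P) := Ideal.finiteQuotientOfFreeOfNeBot P (hne P hP)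
    refine exists_res_poly p hp P ((hsmem P).mp hP).2 a (F P) ?_
    rw [← hF P hP, Ideal.absNorm_apply, Submodule.cardQuot_apply]
  choose! r hr1 hr2 hr3 using hres
  refine ⟨∏ P ∈ s, r P, monic_prod_of_monic _ _ hr1, ?_, ?_⟩
  · rw [natDegree_prod_of_monic _ _ hr1, hdisc, ← hef, Finset.mul_sum, ← Finset.sum_add_distrib]
    refine Finset.sum_le_sum fun P hP => ?_
    calc _ ≤ F P + (normalizedFactors D).count P * F P := by gcongr; exact hr2 P hP
      _ = ((normalizedFactors D).count P + 1) * F P := by ring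
      _ ≤ k * (normalizedFactors I).count P * F P := by gcongr; exact hcnt P hP
      _ = _ := by ring
  · obtain ⟨R, hR⟩ := map_surjective (Int.castRingHom (ZMod p)) (ZMod.ringHom_surjective _)
      (∏ P ∈ s, r P)
    have hrad : aeval a R ∈ I.radical := by
      rw [Ideal.radical_eq_sInf, Submodule.mem_sInf]
      rintro J ⟨hJ, hJp⟩
      have hJs : J ∈ s := (hsmem J).mpr ⟨hJp, hJ (Ideal.mem_span_singleton_self _)⟩
      exact hr3 J hJs R (hR ▸ Finset.dvd_prod_of_mem r hJs)
    obtain ⟨M, hM⟩ := hrad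
    rw [← hR]
    exact dvd_pow_of_pow_mem p a R M hM
end GAC
namespace GAC
open Polynomial NumberField
variable {K : Type*} [Field K] [NumberField K]
lemma packing (T U : InfinitePlace K → ℝ) (hU : ∀ w, 0 < U w) (hUT : ∀ w, U w ≤ T w) (F : ℝ)
    (s : Finset K) (hF0 : 0 ≤ F)
    (hF : ∀ t ⊆ s, (∀ a ∈ t, ∀ b ∈ t, ∀ w : InfinitePlace K, w (a - b) < 2 * U w) →
      (t.card : ℝ) ≤ F) (hs : ∀ a ∈ s, ∀ w : InfinitePlace K, w a ≤ T w) :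
    (s.card : ℝ) ≤ F * ∏ w, (4 * T w / U w) ^ w.mult := by
  classical
  let I : InfinitePlace K → Finset ℤ := fun w => Finset.Icc ⌊-(T w / U w)⌋ ⌊T w / U w⌋
  let J : InfinitePlace K → Finset (ℤ × ℤ) := fun w =>
    if w.IsReal then I w ×ˢ {0} else I w ×ˢ I w
  let c : K → InfinitePlace K → ℤ × ℤ := fun a w =>
    (⌊(w.embedding a).re / U w⌋, ⌊(w.embedding a).im / U w⌋)
  have hI : ∀ w, ((I w).card : ℝ) ≤ 4 * T w / U w := by
    intro w
    have h1 : 1 ≤ T w / U w := (one_le_div (hU w)).mpr (hUT w)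
    have h2 := Int.floor_le (T w / U w)
    have h3 := Int.lt_floor_add_one (-(T w / U w))
    have h4 : ⌊-(T w / U w)⌋ ≤ ⌊T w / U w⌋ := Int.floor_mono (by linarith)
    have h5 : ((I w).card : ℤ) = ⌊T w / U w⌋ + 1 - ⌊-(T w / U w)⌋ := by
      rw [Int.card_Icc, Int.toNat_of_nonneg (by omega)]
    have h6 : ((I w).card : ℝ) = ⌊T w / U w⌋ + 1 - ⌊-(T w / U w)⌋ := by exact_mod_cast h5
    rw [h6, mul_div_assoc]; linarith
  have hmem : ∀ w, ∀ x : ℝ, |x| ≤ T w → ⌊x / U w⌋ ∈ I w := by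
    intro w x hx
    have := abs_le.mp hx
    have hU := hU w
    refine Finset.mem_Icc.mpr ⟨Int.floor_mono ?_, Int.floor_mono ?_⟩
    · rw [← neg_div]; gcongr; exact this.1
    · gcongr; exact this.2
  have himg : s.image c ⊆ Fintype.piFinset J := by
    intro f hf
    obtain ⟨a, ha, rfl⟩ := Finset.mem_image.mp hf
    rw [Fintype.mem_piFinset]
    intro w
    have h1 : ‖w.embedding a‖ ≤ T w := by rw [InfinitePlace.norm_embedding_eq]; exact hs a ha w
    have hre := hmem w _ ((Complex.abs_re_le_norm _).trans h1)
    have him := hmem w _ ((Complex.abs_im_le_norm _).trans h1)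
    by_cases hw : w.IsReal
    · simp only [J, hw, if_true, c, Finset.mem_product, Finset.mem_singleton]
      refine ⟨hre, ?_⟩
      have : (w.embedding a).im = 0 := by
        rw [← Complex.conj_eq_iff_im]
        exact RingHom.congr_fun (InfinitePlace.isReal_iff.mp hw) a
      simp [this]
    · simp only [J, hw, if_false, c, Finset.mem_product]
      exact ⟨hre, him⟩
  have hfib : ∀ a ∈ s.image c, (s.filter (fun x => c x = a)).card ≤ ⌊F⌋₊ := by
    intro f _
    refine Nat.le_floor (hF _ (Finset.filter_subset _ _) ?_)
    intro a ha b hb w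
    have h1 : c a = c b := (Finset.mem_filter.mp ha).2.trans (Finset.mem_filter.mp hb).2.symm
    have h2 := congrFun h1 w
    simp only [c, Prod.mk.injEq] at h2
    have key : ∀ x y : ℝ, ⌊x / U w⌋ = ⌊y / U w⌋ → |x - y| < U w := by
      intro x y h
      have := Int.abs_sub_lt_one_of_floor_eq_floor h
      rwa [← sub_div, abs_div, abs_of_pos (hU w), div_lt_one (hU w)] at this
    have hre := key _ _ h2.1
    have him := key _ _ h2.2
    rw [← InfinitePlace.norm_embedding_eq, map_sub]
    refine (Complex.norm_le_abs_re_add_abs_im _).trans_lt ?_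
    rw [Complex.sub_re, Complex.sub_im]; linarith
  have h1 := Finset.card_le_mul_card_image s _ hfib
  have h2 : ((s.image c).card : ℝ) ≤ ∏ w, (4 * T w / U w) ^ w.mult := by
    calc ((s.image c).card : ℝ) ≤ (Fintype.piFinset J).card := by
          exact_mod_cast Finset.card_le_card himg
      _ = ∏ w, ((J w).card : ℝ) := by rw [Fintype.card_piFinset]; push_cast; rfl
      _ ≤ _ := by
        refine Finset.prod_le_prod (fun _ _ => by positivity) fun w _ => ?_
        by_cases hw : w.IsReal
        · simp only [J, hw, if_true, InfinitePlace.mult, pow_one, Finset.card_product,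
            Finset.card_singleton, mul_one]
          exact hI w
        · simp only [J, hw, if_false, InfinitePlace.mult, Finset.card_product]
          push_cast
          rw [pow_two]
          exact mul_le_mul (hI w) (hI w) (by positivity) ((Nat.cast_nonneg _).trans (hI w))
  calc (s.card : ℝ) ≤ ⌊F⌋₊ * (s.image c).card := by exact_mod_cast h1
    _ ≤ _ := by
      gcongr
      exact Nat.floor_le hF0
lemma eq_of_all_lt_one {a b : K} (ha : IsIntegral ℤ a) (hb : IsIntegral ℤ b)
    (h : ∀ w : InfinitePlace K, w (a - b) < 1) : a = b := by
  by_contra hab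
  have h0 : a - b ≠ 0 := sub_ne_zero.mpr hab
  obtain ⟨w⟩ : Nonempty (InfinitePlace K) := inferInstance
  have h1 : (1 : ℝ) ≤ |Algebra.norm ℚ (a - b)| := by
    obtain ⟨n, hn⟩ := IsIntegrallyClosed.isIntegral_iff.mp (Algebra.isIntegral_norm ℚ (ha.sub hb))
    have h2 : n ≠ 0 := by
      rintro rfl
      apply (Algebra.norm_ne_zero_iff (R := ℚ)).mpr h0
      rw [← hn]; simp
    rw [← hn]
    have : 1 ≤ |n| := Int.one_le_abs h2
    simp only [eq_intCast, Rat.cast_intCast, Rat.cast_abs]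
    exact_mod_cast this
  have := InfinitePlace.prod_eq_abs_norm (a - b)
  have h3 : ∏ w : InfinitePlace K, w (a - b) ^ w.mult < 1 := by
    have hlt : ∏ w : InfinitePlace K, w (a - b) ^ w.mult < ∏ w : InfinitePlace K, (1 : ℝ) := by
      refine Finset.prod_lt_prod_of_nonempty (fun w _ => ?_) (fun w _ => ?_) Finset.univ_nonempty
      · exact pow_pos (InfinitePlace.pos_iff.mpr h0) _
      · exact pow_lt_one₀ (apply_nonneg _ _) (h w) InfinitePlace.mult_ne_zero
    simpa using hlt
  linarith
lemma prod_const_mult (c : ℝ) : ∏ w : InfinitePlace K, c ^ w.mult = c ^ Module.finrank ℚ K := by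
  rw [Finset.prod_pow_eq_pow_sum, InfinitePlace.sum_mult_eq]
lemma packing1 (T : InfinitePlace K → ℝ) (hT : ∀ w, 1 ≤ T w) (s : Finset K)
    (hi : ∀ a ∈ s, IsIntegral ℤ a) (hs : ∀ a ∈ s, ∀ w : InfinitePlace K, w a ≤ T w) :
    (s.card : ℝ) ≤ 8 ^ Module.finrank ℚ K * ∏ w, T w ^ w.mult := by
  have := packing T (fun _ => 1 / 2) (fun _ => by norm_num) (fun w => by linarith [hT w]) 1 s
    zero_le_one ?_ hs
  · refine this.trans (le_of_eq ?_)
    rw [one_mul, ← prod_const_mult, ← Finset.prod_mul_distrib]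
    refine Finset.prod_congr rfl fun w _ => ?_
    rw [← mul_pow]; congr 1; ring
  · intro t ht h
    have : t.card ≤ 1 := Finset.card_le_one.mpr fun a ha b hb =>
      eq_of_all_lt_one (hi a (ht ha)) (hi b (ht hb)) (fun w => by simpa using h a ha b hb w)
    exact_mod_cast this
noncomputable def ht (a : K) : ℝ := ∏ w : InfinitePlace K, max 1 (w a) ^ w.mult
lemma one_le_fac (a : K) (w : InfinitePlace K) : 1 ≤ max 1 (w a) ^ w.mult :=
  one_le_pow₀ (le_max_left _ _)
lemma le_ht (a : K) (w : InfinitePlace K) : max 1 (w a) ≤ ht a := by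
  classical
  refine (le_self_pow₀ (le_max_left _ _) (InfinitePlace.mult_ne_zero (w := w))).trans ?_
  unfold ht
  rw [← Finset.mul_prod_erase _ _ (Finset.mem_univ w)]
  refine le_mul_of_one_le_right (zero_le_one.trans (one_le_fac a w)) ?_
  exact Finset.one_le_prod fun i _ => one_le_fac a i
lemma one_le_ht (a : K) : 1 ≤ ht a := Finset.one_le_prod fun i _ => one_le_fac a i
lemma card_places_le : Fintype.card (InfinitePlace K) ≤ Module.finrank ℚ K := by
  rw [← InfinitePlace.sum_mult_eq (K := K), Fintype.card_eq_sum_ones]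
  exact Finset.sum_le_sum fun w _ => InfinitePlace.mult_pos
lemma ht_count_of_boxes (Y A : ℝ) (hA : 0 ≤ A) (s : Finset K) (hs : ∀ a ∈ s, ht a ≤ Y)
    (hbox : ∀ T : InfinitePlace K → ℝ, (∀ w, 1 ≤ T w) →
      ∏ w, T w ^ w.mult ≤ 2 ^ Module.finrank ℚ K * Y →
      ∀ t ⊆ s, (∀ a ∈ t, ∀ w : InfinitePlace K, w a ≤ T w) → (t.card : ℝ) ≤ A) :
    (s.card : ℝ) ≤ A * ((Nat.log 2 ⌊Y⌋₊ : ℝ) + 1) ^ Module.finrank ℚ K := by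
  classical
  let c : K → InfinitePlace K → ℕ := fun a w => Nat.log 2 ⌊max 1 (w a)⌋₊
  have hc : ∀ a : K, ∀ w : InfinitePlace K, (2 : ℝ) ^ c a w ≤ max 1 (w a) ∧
      max 1 (w a) ≤ 2 ^ (c a w + 1) := by
    intro a w
    have h0 : (0 : ℝ) ≤ max 1 (w a) := zero_le_one.trans (le_max_left _ _)
    have h1 : ⌊max 1 (w a)⌋₊ ≠ 0 := by
      rw [Ne, Nat.floor_eq_zero, not_lt]; exact le_max_left _ _
    constructor
    · have := Nat.pow_log_le_self 2 h1
      calc (2 : ℝ) ^ c a w = ((2 ^ c a w : ℕ) : ℝ) := by push_cast; rfl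
        _ ≤ (⌊max 1 (w a)⌋₊ : ℝ) := by exact_mod_cast this
        _ ≤ _ := Nat.floor_le h0
    · have := Nat.lt_pow_succ_log_self (b := 2) (by norm_num) ⌊max 1 (w a)⌋₊
      have h2 := Nat.lt_of_floor_lt this
      push_cast at h2
      exact h2.le
  have himg : s.image c ⊆ Fintype.piFinset (fun _ => Finset.range (Nat.log 2 ⌊Y⌋₊ + 1)) := by
    intro f hf
    obtain ⟨a, ha, rfl⟩ := Finset.mem_image.mp hf
    rw [Fintype.mem_piFinset]
    intro w
    rw [Finset.mem_range, Nat.lt_succ_iff]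
    exact Nat.log_mono_right (Nat.floor_mono ((le_ht a w).trans (hs a ha)))
  have hfib : ∀ f ∈ s.image c, (s.filter (fun x => c x = f)).card ≤ ⌊A⌋₊ := by
    intro f hf
    obtain ⟨a, ha, rfl⟩ := Finset.mem_image.mp hf
    refine Nat.le_floor (hbox (fun w => 2 ^ (c a w + 1)) (fun w => one_le_pow₀ (by norm_num)) ?_ _
      (Finset.filter_subset _ _) ?_)
    · refine le_trans ?_ (mul_le_mul_of_nonneg_left (hs a ha) (by positivity))
      rw [ht, ← prod_const_mult, ← Finset.prod_mul_distrib]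
      refine Finset.prod_le_prod (fun w _ => by positivity) fun w _ => ?_
      rw [← mul_pow]
      gcongr
      rw [pow_succ, mul_comm]
      have := (hc a w).1
      gcongr
    · intro b hb w
      have h1 := congrFun (Finset.mem_filter.mp hb).2 w
      rw [← h1]
      exact (le_max_right _ _).trans (hc b w).2
  have h1 := Finset.card_le_mul_card_image s _ hfib
  have h2 := Finset.card_le_card himg
  rw [Fintype.card_piFinset] at h2
  simp only [Finset.card_range, Finset.prod_const, Finset.card_univ] at h2
  calc (s.card : ℝ) ≤ ⌊A⌋₊ * (s.image c).card := by exact_mod_cast h1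
    _ ≤ A * ((Nat.log 2 ⌊Y⌋₊ : ℝ) + 1) ^ Fintype.card (InfinitePlace K) := by
      gcongr
      · exact Nat.floor_le hA
      · exact_mod_cast h2
    _ ≤ _ := by
      gcongr
      · linarith [(Nat.cast_nonneg (Nat.log 2 ⌊Y⌋₊) : (0:ℝ) ≤ _)]
      · exact card_places_le
lemma ht_count (Y : ℝ) (hY : 0 ≤ Y) (s : Finset K) (hi : ∀ a ∈ s, IsIntegral ℤ a)
    (hs : ∀ a ∈ s, ht a ≤ Y) :
    (s.card : ℝ) ≤ 16 ^ Module.finrank ℚ K * Y *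
      ((Nat.log 2 ⌊Y⌋₊ : ℝ) + 1) ^ Module.finrank ℚ K := by
  refine ht_count_of_boxes Y _ (by positivity) s hs ?_
  intro T hT hTY t hts ht
  refine (packing1 T hT t (fun a ha => hi a (hts ha)) ht).trans ?_
  calc _ ≤ (8 : ℝ) ^ Module.finrank ℚ K * (2 ^ Module.finrank ℚ K * Y) := by gcongr
    _ = _ := by rw [← mul_assoc, ← mul_pow]; norm_num
end GAC
namespace GAC
open Polynomial NumberField
variable {K : Type*} [Field K] [NumberField K]
lemma card_int_translates (L : ℝ) (hL : 1 ≤ L) (t : Finset K)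
    (h : ∀ a ∈ t, ∀ b ∈ t, ∃ n : ℤ, a - b = n ∧ |(n : ℝ)| ≤ L) : (t.card : ℝ) ≤ 3 * L := by
  classical
  rcases t.eq_empty_or_nonempty with rfl | ⟨a0, h0⟩
  · simp; linarith
  have hsub : t ⊆ (Finset.Icc (-⌊L⌋) ⌊L⌋).image (fun n : ℤ => a0 + (n : K)) := by
    intro a ha
    obtain ⟨n, hn, hnL⟩ := h a ha a0 h0
    have := abs_le.mp hnL
    refine Finset.mem_image.mpr ⟨n, Finset.mem_Icc.mpr ⟨?_, Int.le_floor.mpr this.2⟩, ?_⟩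
    · rw [neg_le]; refine Int.le_floor.mpr ?_; push_cast; linarith
    · rw [← hn]; ring
  have h1 := (Finset.card_le_card hsub).trans Finset.card_image_le
  rw [Int.card_Icc] at h1
  have h2 : 0 ≤ ⌊L⌋ := Int.floor_nonneg.mpr (by linarith)
  have h3 : (t.card : ℤ) ≤ ⌊L⌋ + 1 - -⌊L⌋ := by omega
  have h4 : (t.card : ℝ) ≤ ⌊L⌋ + 1 - -⌊L⌋ := by exact_mod_cast h3
  have := Int.floor_le L
  linarith
lemma packing2 (T : InfinitePlace K → ℝ) (hT : ∀ w, 1 ≤ T w) (X Y : ℝ) (hX : 1 ≤ X) (hXY : X ≤ Y)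
    (hTY : ∏ w, T w ^ w.mult ≤ Y)
    (hβ : ∀ b : K, IsIntegral ℤ b → ht b ≤ X → ∃ n : ℤ, b = n) (s : Finset K)
    (hi : ∀ a ∈ s, IsIntegral ℤ a) (hs : ∀ a ∈ s, ∀ w : InfinitePlace K, w a ≤ T w) :
    (s.card : ℝ) ≤ 3 * 8 ^ Module.finrank ℚ K * Y * X ^ ((1 : ℝ) / Module.finrank ℚ K - 1) := by
  set d := Module.finrank ℚ K with hd
  have hdpos : 0 < d := Module.finrank_pos
  have hY : 1 ≤ Y := hX.trans hXY
  set σ := Real.log X / Real.log Y with hσ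
  have hσ0 : 0 ≤ σ := div_nonneg (Real.log_nonneg hX) (Real.log_nonneg hY)
  have hσ1 : σ ≤ 1 := div_le_one_of_le₀ (Real.log_le_log (by linarith) hXY) (Real.log_nonneg hY)
  have hYX : Y ^ σ = X := by
    rcases hY.eq_or_lt with h | h
    · have : X = 1 := le_antisymm (h ▸ hXY) hX
      simp [← h, this]
    · rw [Real.rpow_def_of_pos (by linarith), hσ, mul_div_cancel₀ _ (Real.log_pos h).ne',
        Real.exp_log (by linarith)]
  have hT0 : ∀ w, 0 ≤ T w := fun w => zero_le_one.trans (hT w)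
  have hTs : ∀ w, 1 ≤ T w ^ σ := fun w => Real.one_le_rpow (hT w) hσ0
  have hpow : ∀ τ : ℝ, ∏ w, (T w ^ τ) ^ w.mult = (∏ w, T w ^ w.mult) ^ τ := by
    intro τ
    rw [← Real.finsetProd_rpow _ _ (fun w _ => pow_nonneg (hT0 w) _)]
    refine Finset.prod_congr rfl fun w _ => ?_
    rw [← Real.rpow_natCast, ← Real.rpow_mul (hT0 w), mul_comm, Real.rpow_mul (hT0 w),
      Real.rpow_natCast]
  have hP1 : 1 ≤ ∏ w, T w ^ w.mult := Finset.one_le_prod fun w _ => one_le_pow₀ (hT w)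
  obtain ⟨w0, -, hw0⟩ := Finset.exists_min_image Finset.univ T
    (Finset.univ_nonempty (α := InfinitePlace K))
  have hmin : T w0 ^ σ ≤ X ^ ((1 : ℝ) / d) := by
    have h1 : T w0 ^ d ≤ Y := by
      rw [hd, ← prod_const_mult]
      refine le_trans (Finset.prod_le_prod (fun w _ => pow_nonneg (hT0 _) _) fun w _ => ?_) hTY
      have := hT0 w0
      have := hw0 w (Finset.mem_univ _)
      gcongr
    have h2 : T w0 = (T w0 ^ d) ^ ((1 : ℝ) / d) := by
      rw [← Real.rpow_natCast, ← Real.rpow_mul (hT0 w0), mul_one_div_cancel (by positivity),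
        Real.rpow_one]
    rw [h2, ← hYX, ← Real.rpow_mul (by positivity [hT0 w0]), ← Real.rpow_mul (by linarith), mul_comm]
    exact Real.rpow_le_rpow (pow_nonneg (hT0 _) _) h1 (by positivity)
  have hL : 1 ≤ X ^ ((1 : ℝ) / d) := Real.one_le_rpow hX (by positivity)
  have := packing T (fun w => T w ^ σ / 2) (fun w => by linarith [hTs w]) (fun w => by
    have : T w ^ σ ≤ T w ^ (1 : ℝ) := Real.rpow_le_rpow_of_exponent_le (hT w) hσ1
    rw [Real.rpow_one] at this
    linarith [hTs w]) (3 * X ^ ((1 : ℝ) / d)) s (by positivity) ?_ hs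
  · refine this.trans ?_
    have h1 : ∏ w, (4 * T w / (T w ^ σ / 2)) ^ w.mult = 8 ^ d * (∏ w, T w ^ w.mult) ^ (1 - σ) := by
      rw [← hpow, hd, ← prod_const_mult, ← Finset.prod_mul_distrib]
      refine Finset.prod_congr rfl fun w _ => ?_
      rw [← mul_pow, Real.rpow_sub (by linarith [hT w]), Real.rpow_one]
      congr 1; field_simp; ring
    rw [h1]
    have h2 : (∏ w, T w ^ w.mult) ^ (1 - σ) ≤ Y / X := by
      calc _ ≤ Y ^ (1 - σ) := Real.rpow_le_rpow (by linarith) hTY (by linarith)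
        _ = _ := by rw [Real.rpow_sub (by linarith), Real.rpow_one, hYX]
    calc _ ≤ 3 * X ^ ((1 : ℝ) / d) * (8 ^ d * (Y / X)) := by gcongr
      _ = _ := by rw [Real.rpow_sub (by linarith), Real.rpow_one]; ring
  · intro t ht hdiff
    refine card_int_translates _ hL t fun a ha b hb => ?_
    have hlt : ∀ w : InfinitePlace K, w (a - b) < T w ^ σ := fun w => by
      have := hdiff a ha b hb w
      linarith
    obtain ⟨n, hn⟩ := hβ (a - b) ((hi a (ht ha)).sub (hi b (ht hb))) (by
      rw [← hYX]
      refine le_trans ?_ (Real.rpow_le_rpow (by linarith) hTY hσ0)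
      rw [← hpow]
      refine Finset.prod_le_prod (fun w _ => by positivity) fun w _ => ?_
      have := max_le (hTs w) (hlt w).le
      gcongr)
    refine ⟨n, hn, ?_⟩
    have := hlt w0
    rw [hn, ← InfinitePlace.norm_embedding_eq] at this
    simp only [map_intCast, Complex.norm_intCast] at this
    exact this.le.trans hmin
lemma ht_count2 (X Y : ℝ) (hX : 1 ≤ X) (hXY : X ≤ 2 ^ Module.finrank ℚ K * Y)
    (hβ : ∀ b : K, IsIntegral ℤ b → ht b ≤ X → ∃ n : ℤ, b = n) (s : Finset K)
    (hi : ∀ a ∈ s, IsIntegral ℤ a) (hs : ∀ a ∈ s, ht a ≤ Y) :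
    (s.card : ℝ) ≤ 3 * 16 ^ Module.finrank ℚ K * Y * X ^ ((1 : ℝ) / Module.finrank ℚ K - 1) *
      ((Nat.log 2 ⌊Y⌋₊ : ℝ) + 1) ^ Module.finrank ℚ K := by
  have hY0 : 0 ≤ Y := by
    have : 0 ≤ 2 ^ Module.finrank ℚ K * Y := by linarith
    exact nonneg_of_mul_nonneg_right this (by positivity)
  refine ht_count_of_boxes Y _ (by positivity) s hs ?_
  intro T hT hTY t hts ht
  refine (packing2 T hT X _ hX hXY hTY hβ t (fun a ha => hi a (hts ha)) ht).trans (le_of_eq ?_)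
  rw [show (16 : ℝ) = 8 * 2 by norm_num, mul_pow]; ring
end GAC
namespace GAC
open Polynomial NumberField
variable {K : Type*} [Field K] [NumberField K]
noncomputable def MM (f : ℤ[X]) : ℝ := (f.map (Int.castRingHom ℂ)).mahlerMeasure
lemma minpolyZ_map (a : K) (ha : IsIntegral ℤ a) :
    (minpoly ℤ a).map (Int.castRingHom ℚ) = minpoly ℚ a :=
  (minpoly.isIntegrallyClosed_eq_field_fractions' ℚ ha).symm
lemma natDegree_minpolyZ (a : K) (ha : IsIntegral ℤ a) :
    (minpoly ℤ a).natDegree = (minpoly ℚ a).natDegree := by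
  rw [← minpolyZ_map a ha, (minpoly.monic ha).natDegree_map]
lemma embedding_inj (a : K) (ha : IsIntegral ℤ a)
    (hd : (minpoly ℤ a).natDegree = Module.finrank ℚ K) :
    Function.Injective (fun φ : K →+* ℂ => φ a) := by
  rw [natDegree_minpolyZ a ha] at hd
  have h1 := (Field.primitive_element_iff_minpoly_natDegree_eq ℚ a).mpr hd
  have h2 := (Field.primitive_element_iff_algHom_eq_of_eval' ℚ ℂ
    (fun _ => IsAlgClosed.splits _) a).mp h1
  intro φ ψ h
  exact (RingHom.equivRatAlgHom K ℂ).injective (h2 (by simpa [RingHom.equivRatAlgHom_apply] using h))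
lemma minpoly_eq_prod (a : K) (ha : IsIntegral ℤ a)
    (hd : (minpoly ℤ a).natDegree = Module.finrank ℚ K) :
    (minpoly ℤ a).map (Int.castRingHom ℂ) = ∏ φ : K →+* ℂ, (X - C (φ a)) := by
  classical
  have hm : ((minpoly ℤ a).map (Int.castRingHom ℂ)).Monic := (minpoly.monic ha).map _
  refine eq_of_monic_of_dvd_of_natDegree_le (monic_prod_of_monic _ _ fun _ _ => monic_X_sub_C _)
    hm ?_ ?_
  · refine Finset.prod_dvd_of_coprime (fun φ _ ψ _ h => ?_) fun φ _ => ?_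
    · exact isCoprime_X_sub_C_of_isUnit_sub
        (sub_ne_zero.mpr fun h' => h (embedding_inj a ha hd h')).isUnit
    · rw [dvd_iff_isRoot, IsRoot, eval_map, ← RingHom.eq_intCast' (φ.comp (algebraMap ℤ K)),
        ← hom_eval₂, ← aeval_def, minpoly.aeval, map_zero]
  · rw [(minpoly.monic ha).natDegree_map, hd, natDegree_prod_of_monic _ _ fun _ _ => monic_X_sub_C _]
    simp [Embeddings.card]
lemma prod_places (g : InfinitePlace K → ℝ) :
    ∏ φ : K →+* ℂ, g (InfinitePlace.mk φ) = ∏ w : InfinitePlace K, g w ^ w.mult := by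
  classical
  rw [← Finset.prod_fiberwise Finset.univ InfinitePlace.mk]
  refine Finset.prod_congr rfl fun w _ => ?_
  rw [Finset.prod_congr rfl (g := fun _ => g w) (by
    intro φ hφ; rw [(Finset.mem_filter.mp hφ).2]), Finset.prod_const, InfinitePlace.card_filter_mk_eq]
lemma mahler_prod {ι : Type*} (s : Finset ι) (g : ι → ℂ) :
    (∏ i ∈ s, (X - C (g i))).mahlerMeasure = ∏ i ∈ s, max 1 ‖g i‖ := by
  classical
  induction s using Finset.induction_on with
  | empty => simp
  | insert i s hi ih => rw [Finset.prod_insert hi, mahlerMeasure_mul, ih, mahlerMeasure_X_sub_C,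
      Finset.prod_insert hi]
lemma ht_eq (a : K) : ht a = ∏ φ : K →+* ℂ, max 1 ‖φ a‖ := by
  rw [ht, ← prod_places (fun w => max 1 (w a))]
  rfl
lemma MM_minpoly (a : K) (ha : IsIntegral ℤ a)
    (hd : (minpoly ℤ a).natDegree = Module.finrank ℚ K) : MM (minpoly ℤ a) = ht a := by
  rw [MM, minpoly_eq_prod a ha hd, mahler_prod, ht_eq]
lemma MM_le (f : ℤ[X]) (d N : ℕ) (hm : f.Monic) (hd : f.natDegree = d) (hN : 1 ≤ N)
    (hc : ∀ i < d, |f.coeff i| ≤ (N : ℤ)) : MM f ≤ (d + 1) * N := by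
  refine (mahlerMeasure_le_sum_norm_coeff _).trans ?_
  rw [sum_over_range _ (fun _ => norm_zero), hm.natDegree_map, hd]
  calc _ ≤ ∑ i ∈ Finset.range (d + 1), (N : ℝ) := by
        refine Finset.sum_le_sum fun i hi => ?_
        rw [coeff_map, eq_intCast, Complex.norm_intCast]
        rcases (Finset.mem_range_succ_iff.mp hi).lt_or_eq with h | h
        · exact_mod_cast hc i h
        · rw [h, ← hd, hm.coeff_natDegree]; simpa using hN
    _ = _ := by simp
lemma coeff_le_MM (f : ℤ[X]) (i : ℕ) : |(f.coeff i : ℝ)| ≤ 2 ^ f.natDegree * MM f := by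
  have h := norm_coeff_le_choose_mul_mahlerMeasure i (f.map (Int.castRingHom ℂ))
  rw [coeff_map, eq_intCast, Complex.norm_intCast] at h
  refine h.trans ?_
  have h1 : 0 ≤ MM f := mahlerMeasure_nonneg _
  have h2 : (f.map (Int.castRingHom ℂ)).natDegree = f.natDegree :=
    natDegree_map_eq_of_injective Int.cast_injective f
  rw [h2]
  refine mul_le_mul_of_nonneg_right ?_ h1
  exact_mod_cast Nat.choose_le_two_pow _ _
lemma one_le_MM (f : ℤ[X]) (hm : f.Monic) : 1 ≤ MM f := by
  have := leadingCoeff_le_mahlerMeasure (f.map (Int.castRingHom ℂ))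
  rwa [(hm.map _).leadingCoeff, norm_one] at this
lemma MM_mul (f g : ℤ[X]) : MM (f * g) = MM f * MM g := by
  rw [MM, Polynomial.map_mul, mahlerMeasure_mul]; rfl
lemma coeff_le_of_house (b : K) (hb : IsIntegral ℤ b) (B : ℝ)
    (h : ∀ w : InfinitePlace K, w b ≤ B) (i : ℕ) :
    |((minpoly ℤ b).coeff i : ℝ)| ≤ B ^ ((minpoly ℤ b).natDegree - i) * 2 ^ (minpoly ℤ b).natDegree := by
  have h1 := coeff_le_of_roots_le (f := algebraMap ℚ ℂ) i (minpoly.monic hb.tower_top)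
    (IsAlgClosed.splits ((minpoly ℚ b).map (algebraMap ℚ ℂ))) (B := B) (fun z hz => by
      have hz' : z ∈ (minpoly ℚ b).rootSet ℂ := by
        rw [mem_rootSet']
        exact ⟨(mem_roots'.mp hz).1, by simpa [aeval_def, IsRoot, eval_map] using (mem_roots'.mp hz).2⟩
      rw [← Embeddings.range_eval_eq_rootSet_minpoly K ℂ b] at hz'
      obtain ⟨φ, rfl⟩ := hz'
      exact h (InfinitePlace.mk φ))
  rw [← minpolyZ_map b hb, coeff_map, coeff_map, (minpoly.monic hb).natDegree_map] at h1
  simp only [eq_intCast, map_intCast, Complex.norm_intCast] at h1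
  refine h1.trans ?_
  have hB : 0 ≤ B := (apply_nonneg _ _).trans (h (Classical.arbitrary _))
  gcongr
  exact_mod_cast Nat.choose_le_two_pow _ _
end GAC
namespace GAC
open Polynomial NumberField
def PB (e : ℝ) (g : ℕ → ℝ) : Prop :=
  ∃ C : ℝ, 0 ≤ C ∧ ∃ k : ℕ, ∀ N : ℕ, 2 ≤ N → g N ≤ C * (N : ℝ) ^ e * (1 + Real.log N) ^ k
lemma log_nn (N : ℕ) : 0 ≤ Real.log N := Real.log_natCast_nonneg N
lemma PB.mono {e : ℝ} {g h : ℕ → ℝ} (hh : PB e h) (H : ∀ N, 2 ≤ N → g N ≤ h N) : PB e g := by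
  obtain ⟨C, hC, k, h⟩ := hh
  exact ⟨C, hC, k, fun N hN => (H N hN).trans (h N hN)⟩
lemma PB.mono_exp {e e' : ℝ} {g : ℕ → ℝ} (hg : PB e g) (h : e ≤ e') : PB e' g := by
  obtain ⟨C, hC, k, hk⟩ := hg
  refine ⟨C, hC, k, fun N hN => (hk N hN).trans ?_⟩
  have := log_nn N
  have h1 : (1 : ℝ) ≤ N := by exact_mod_cast (by omega : 1 ≤ N)
  gcongr
lemma PB.add {e : ℝ} {g h : ℕ → ℝ} (hg : PB e g) (hh : PB e h) : PB e (fun N => g N + h N) := by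
  obtain ⟨C, hC, k, hk⟩ := hg
  obtain ⟨C', hC', k', hk'⟩ := hh
  refine ⟨C + C', by linarith, k + k', fun N hN => ?_⟩
  have h0 := log_nn N
  have h1 := hk N hN
  have h2 := hk' N hN
  have e1 : (1 + Real.log N) ^ k ≤ (1 + Real.log N) ^ (k + k') :=
    pow_le_pow_right₀ (by linarith) (by omega)
  have e2 : (1 + Real.log N) ^ k' ≤ (1 + Real.log N) ^ (k + k') :=
    pow_le_pow_right₀ (by linarith) (by omega)
  calc g N + h N ≤ C * (N : ℝ) ^ e * (1 + Real.log N) ^ k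
        + C' * (N : ℝ) ^ e * (1 + Real.log N) ^ k' := add_le_add h1 h2
    _ ≤ C * (N : ℝ) ^ e * (1 + Real.log N) ^ (k + k')
        + C' * (N : ℝ) ^ e * (1 + Real.log N) ^ (k + k') := by gcongr
    _ = _ := by ring
lemma PB.mul {e e' : ℝ} {g h : ℕ → ℝ} (hg : PB e g) (hh : PB e' h) (h0 : ∀ N, 0 ≤ h N) :
    PB (e + e') (fun N => g N * h N) := by
  obtain ⟨C, hC, k, hk⟩ := hg
  obtain ⟨C', hC', k', hk'⟩ := hh
  refine ⟨C * C', by positivity, k + k', fun N hN => ?_⟩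
  have := log_nn N
  calc g N * h N ≤ (C * (N : ℝ) ^ e * (1 + Real.log N) ^ k) *
        (C' * (N : ℝ) ^ e' * (1 + Real.log N) ^ k') := by
        refine mul_le_mul (hk N hN) (hk' N hN) (h0 N) (by positivity)
    _ = _ := by rw [Real.rpow_add (by positivity), pow_add]; ring
lemma PB.const (c : ℝ) (hc : 0 ≤ c) : PB 0 (fun _ => c) :=
  ⟨c, hc, 0, fun N _ => by simp⟩
lemma PB.cmul {e : ℝ} {g : ℕ → ℝ} (c : ℝ) (hc : 0 ≤ c) (hg : PB e g) :
    PB e (fun N => c * g N) := by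
  obtain ⟨C, hC, k, hk⟩ := hg
  refine ⟨c * C, by positivity, k, fun N hN => ?_⟩
  have := mul_le_mul_of_nonneg_left (hk N hN) hc
  simpa [mul_assoc] using this
lemma PB.rpow (e : ℝ) : PB e (fun N => (N : ℝ) ^ e) :=
  ⟨1, zero_le_one, 0, fun N _ => by simp⟩
lemma PB.npow (e : ℕ) : PB e (fun N => (N : ℝ) ^ e) :=
  ⟨1, zero_le_one, 0, fun N _ => by simp⟩
lemma PB.pow {e : ℝ} {g : ℕ → ℝ} (hg : PB e g) (h0 : ∀ N, 0 ≤ g N) (n : ℕ) :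
    PB (n * e) (fun N => g N ^ n) := by
  induction n with
  | zero => simpa using PB.const 1 zero_le_one
  | succ n ih =>
    have := ih.mul hg h0
    simp only [← pow_succ] at this
    convert this using 1
    push_cast; ring
lemma PB.log1 : PB 0 (fun N => 1 + Real.log N) :=
  ⟨1, zero_le_one, 1, fun N _ => by simp⟩
lemma natlog_le (c : ℝ) (N : ℕ) (hc : 1 ≤ c) (hN : 1 ≤ N) :
    (Nat.log 2 ⌊c * N⌋₊ : ℝ) + 1 ≤ (2 * c + 1) * (1 + Real.log N) := by
  have hN' : (1 : ℝ) ≤ N := by exact_mod_cast hN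
  have h1 : (1 : ℝ) ≤ c * N := one_le_mul_of_one_le_of_one_le hc hN'
  have h0 : ⌊c * N⌋₊ ≠ 0 := by
    rw [Ne, Nat.floor_eq_zero, not_lt]; exact h1
  have h2 : (2 : ℝ) ^ Nat.log 2 ⌊c * N⌋₊ ≤ c * N := by
    calc _ = ((2 ^ Nat.log 2 ⌊c * N⌋₊ : ℕ) : ℝ) := by push_cast; rfl
      _ ≤ (⌊c * N⌋₊ : ℝ) := by exact_mod_cast Nat.pow_log_le_self 2 h0
      _ ≤ _ := Nat.floor_le (by linarith)
  have h3 := Real.log_le_log (by positivity) h2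
  rw [Real.log_pow, Real.log_mul (by linarith) (by linarith)] at h3
  have h4 : Real.log c ≤ c - 1 := Real.log_le_sub_one_of_pos (by linarith)
  have h5 := Real.log_two_gt_d9
  have h6 := log_nn N
  have h7 : (0 : ℝ) ≤ Nat.log 2 ⌊c * N⌋₊ := Nat.cast_nonneg _
  nlinarith
lemma PB.natlog (c : ℝ) (hc : 1 ≤ c) : PB 0 (fun N => (Nat.log 2 ⌊c * N⌋₊ : ℝ) + 1) :=
  (PB.log1.cmul (2 * c + 1) (by linarith)).mono fun N hN => natlog_le c N hc (by omega)
lemma PB.sum {ι : Type*} {e : ℝ} (s : Finset ι) (g : ι → ℕ → ℝ) (h : ∀ i ∈ s, PB e (g i)) :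
    PB e (fun N => ∑ i ∈ s, g i N) := by
  classical
  induction s using Finset.induction_on with
  | empty => exact ⟨0, le_rfl, 0, by simp⟩
  | insert i s hi ih =>
    simp only [Finset.sum_insert hi]
    exact (h i (by simp)).add (ih fun j hj => h j (by simp [hj]))
noncomputable def poly {R : Type*} [CommRing R] (d : ℕ) (v : Fin d → R) : R[X] :=
  X ^ d + ∑ i : Fin d, C (v i) * X ^ (i : ℕ)
section poly
variable {R : Type*} [CommRing R] (d : ℕ) (v : Fin d → R)
lemma poly_aux : (∑ i : Fin d, C (v i) * X ^ (i : ℕ)).degree < (d : WithBot ℕ) := by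
  refine (degree_sum_le _ _).trans_lt ((Finset.sup_lt_iff (WithBot.bot_lt_coe d)).mpr ?_)
  intro i _
  exact (degree_C_mul_X_pow_le _ _).trans_lt (WithBot.coe_lt_coe.mpr i.2)
lemma poly_monic : (poly d v).Monic := monic_X_pow_add (poly_aux d v)
lemma poly_natDegree [Nontrivial R] : (poly d v).natDegree = d := by
  refine natDegree_eq_of_degree_eq_some ?_
  rw [poly, degree_add_eq_left_of_degree_lt] <;> rw [degree_X_pow]
  exact poly_aux d v
lemma poly_coeff (i : Fin d) : (poly d v).coeff i = v i := by
  have : ∀ x : Fin d, ((i : ℕ) = (x : ℕ)) = (i = x) := fun x => by simp [Fin.ext_iff]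
  simp only [poly, coeff_add, coeff_X_pow, finsetSum_coeff, coeff_C_mul, i.2.ne, if_false, this]
  simp
lemma poly_coeff' (f : R[X]) (hm : f.Monic) (hd : f.natDegree = d) :
    poly d (fun i => f.coeff i) = f := by
  conv_rhs => rw [hm.as_sum, hd]
  rw [poly, Finset.sum_range]
lemma poly_inj : Function.Injective (poly (R := R) d) := fun v w h => by
  ext i; rw [← poly_coeff d v i, h, poly_coeff]
lemma poly_map {S : Type*} [CommRing S] (φ : R →+* S) :
    (poly d v).map φ = poly d (fun i => φ (v i)) := by
  simp [poly, Polynomial.map_sum]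
end poly
noncomputable def box (d N : ℕ) : Finset (Fin d → ℤ) := Fintype.piFinset fun _ => Finset.Icc (-(N : ℤ)) N
lemma mem_box {d N : ℕ} {v : Fin d → ℤ} : v ∈ box d N ↔ ∀ i, |v i| ≤ N := by
  simp [box, abs_le]
lemma card_box (d N : ℕ) : (box d N).card = (2 * N + 1) ^ d := by
  simp only [box, Fintype.card_piFinset, Int.card_Icc, Finset.prod_const, Finset.card_univ,
    Fintype.card_fin]
  congr 1; omega
lemma MM_poly_le {d N : ℕ} (hN : 1 ≤ N) {v : Fin d → ℤ} (hv : v ∈ box d N) :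
    MM (poly d v) ≤ (d + 1) * N :=
  MM_le _ d N (poly_monic d v) (poly_natDegree d v) hN fun i hi => by
    have := poly_coeff d v ⟨i, hi⟩
    rw [this]; exact mem_box.mp hv _
def RedP (d : ℕ) (v : Fin d → ℤ) : Prop :=
  ∃ k : ℕ, 1 ≤ k ∧ k < d ∧ ∃ g h : ℤ[X], g.Monic ∧ h.Monic ∧ g.natDegree = k ∧
    h.natDegree = d - k ∧ poly d v = g * h
open Classical in
lemma red_count (d : ℕ) :
    PB ((d : ℝ) - 1) (fun N => (((box d N).filter (RedP d)).card : ℝ)) := by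
  set c : ℝ := d + 1 with hc
  have hc1 : 1 ≤ c := by rw [hc]; linarith [(Nat.cast_nonneg d : (0:ℝ) ≤ d)]
  set A : ℝ := d * (6 * 2 ^ d) ^ d * c ^ d with hA
  have hc0 : 0 ≤ c := by linarith
  rcases Nat.eq_zero_or_pos d with hd0 | hdpos
  · subst hd0
    refine ⟨0, le_rfl, 0, fun N hN => ?_⟩
    have : (box 0 N).filter (RedP 0) = ∅ := by
      refine Finset.filter_eq_empty_iff.mpr ?_
      rintro v - ⟨k, h1, h2, -⟩
      omega
    simp [this]
  have hmain : PB ((d : ℝ) - 1) (fun N => A * ((N : ℝ) ^ (d - 1) * ((Nat.log 2 ⌊c * N⌋₊ : ℝ) + 1))) := by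
    have := ((PB.npow (d - 1)).mul (PB.natlog c hc1) (fun N => by positivity)).cmul A (by positivity)
    rw [Nat.cast_sub hdpos, add_zero] at this
    simpa using this
  refine hmain.mono fun N hN => ?_
  have hN1 : (1 : ℝ) ≤ N := by exact_mod_cast (by omega : 1 ≤ N)
  let S : ℕ × ℕ → Finset (Fin d → ℤ) := fun kt =>
    ((box kt.1 (2 ^ (d + kt.2 + 1))) ×ˢ (box (d - kt.1) ⌊2 ^ d * (c * N / 2 ^ kt.2)⌋₊)).image
      (fun gh => fun i => (poly _ gh.1 * poly _ gh.2).coeff i)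
  let I : Finset (ℕ × ℕ) := (Finset.Ico 1 d) ×ˢ (Finset.range (Nat.log 2 ⌊c * N⌋₊ + 1))
  have hsub : (box d N).filter (RedP d) ⊆ I.biUnion S := by
    intro v hv
    obtain ⟨hvb, k, hk1, hkd, g, h, hg, hh, hgk, hhk, hgh⟩ := Finset.mem_filter.mp hv
    have hM : MM g * MM h ≤ c * N := by
      rw [← MM_mul, ← hgh]; exact MM_poly_le (by omega) hvb
    have hg1 := one_le_MM g hg
    have hh1 := one_le_MM h hh
    set t := Nat.log 2 ⌊MM g⌋₊ with ht
    have ht1 : (2 : ℝ) ^ t ≤ MM g := by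
      have h1 : ⌊MM g⌋₊ ≠ 0 := by rw [Ne, Nat.floor_eq_zero, not_lt]; exact hg1
      calc _ = ((2 ^ t : ℕ) : ℝ) := by push_cast; rfl
        _ ≤ (⌊MM g⌋₊ : ℝ) := by exact_mod_cast Nat.pow_log_le_self 2 h1
        _ ≤ _ := Nat.floor_le (by linarith)
    have ht2 : MM g ≤ 2 ^ (t + 1) := by
      have := Nat.lt_of_floor_lt (Nat.lt_pow_succ_log_self (b := 2) (by norm_num) ⌊MM g⌋₊)
      push_cast at this
      exact this.le
    have hgN : MM g ≤ c * N := (le_mul_of_one_le_right (by linarith) hh1).trans hM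
    refine Finset.mem_biUnion.mpr ⟨(k, t), ?_, ?_⟩
    · simp only [I, Finset.mem_product, Finset.mem_Ico, Finset.mem_range, Nat.lt_succ_iff]
      exact ⟨⟨hk1, hkd⟩, Nat.log_mono_right (Nat.floor_mono hgN)⟩
    · refine Finset.mem_image.mpr ⟨(fun i => g.coeff i, fun i => h.coeff i), ?_, ?_⟩
      · rw [Finset.mem_product, mem_box, mem_box]
        constructor
        · intro i
          have h1 : |(g.coeff i : ℝ)| ≤ 2 ^ (d + t + 1) := by
            calc _ ≤ 2 ^ g.natDegree * MM g := coeff_le_MM g i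
              _ ≤ 2 ^ d * 2 ^ (t + 1) := by
                  gcongr
                  · norm_num
                  · omega
              _ = _ := by rw [← pow_add]; rfl
          exact_mod_cast h1
        · intro i
          have h1 : |(h.coeff i : ℝ)| ≤ 2 ^ d * (c * N / 2 ^ t) := by
            calc _ ≤ 2 ^ h.natDegree * MM h := coeff_le_MM h i
              _ ≤ 2 ^ d * (c * N / 2 ^ t) := by
                  gcongr
                  · norm_num
                  · omega
                  · rw [le_div_iff₀ (by positivity), mul_comm]
                    exact (mul_le_mul_of_nonneg_right ht1 (by linarith)).trans hM
          have h2 : ((|h.coeff i|.toNat : ℕ) : ℝ) ≤ 2 ^ d * (c * N / 2 ^ t) := by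
            rw [← Int.cast_abs] at h1
            rw [← Int.cast_natCast, Int.toNat_of_nonneg (abs_nonneg _)]
            exact h1
          have h3 := Nat.le_floor h2
          dsimp only
          omega
      · ext i
        dsimp only
        rw [poly_coeff' k g hg hgk, poly_coeff' (d - k) h hh hhk, ← hgh, poly_coeff]
  have hS : ∀ kt ∈ I, ((S kt).card : ℝ) ≤ (6 * 2 ^ d) ^ d * c ^ d * (N : ℝ) ^ (d - 1) := by
    rintro ⟨k, t⟩ hkt
    simp only [I, Finset.mem_product, Finset.mem_Ico, Finset.mem_range, Nat.lt_succ_iff] at hkt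
    obtain ⟨⟨hk1, hkd⟩, htl⟩ := hkt
    have hT1 : (1 : ℝ) ≤ 2 ^ t := one_le_pow₀ (by norm_num)
    have hcN : 1 ≤ c * N := one_le_mul_of_one_le_of_one_le hc1 hN1
    have hT2 : (2 : ℝ) ^ t ≤ c * N := by
      have h1 : ⌊c * N⌋₊ ≠ 0 := by rw [Ne, Nat.floor_eq_zero, not_lt]; exact hcN
      calc (2 : ℝ) ^ t ≤ 2 ^ Nat.log 2 ⌊c * N⌋₊ := by gcongr; norm_num
        _ = ((2 ^ Nat.log 2 ⌊c * N⌋₊ : ℕ) : ℝ) := by push_cast; rfl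
        _ ≤ (⌊c * N⌋₊ : ℝ) := by exact_mod_cast Nat.pow_log_le_self 2 h1
        _ ≤ _ := Nat.floor_le (by linarith)
    have hU1 : 1 ≤ c * N / 2 ^ t := (one_le_div (by positivity)).mpr hT2
    have h2d : (1 : ℝ) ≤ 2 ^ d := one_le_pow₀ (by norm_num)
    have h1 : ((S (k, t)).card : ℝ) ≤ (2 * 2 ^ (d + t + 1) + 1) ^ k *
        (2 * ⌊2 ^ d * (c * N / 2 ^ t)⌋₊ + 1) ^ (d - k) := by
      have : (S (k, t)).card ≤ _ := Finset.card_image_le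
      rw [Finset.card_product, card_box, card_box] at this
      exact_mod_cast this
    have h3 : (2 : ℝ) * 2 ^ (d + t + 1) + 1 ≤ 6 * 2 ^ d * 2 ^ t := by
      rw [pow_succ, pow_add]
      have : (1 : ℝ) ≤ 2 ^ d * 2 ^ t := one_le_mul_of_one_le_of_one_le h2d hT1
      linarith
    have h4 : (2 : ℝ) * ⌊2 ^ d * (c * N / 2 ^ t)⌋₊ + 1 ≤ 6 * 2 ^ d * (c * N / 2 ^ t) := by
      have := Nat.floor_le (show 0 ≤ 2 ^ d * (c * N / 2 ^ t) by positivity)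
      have : (1 : ℝ) ≤ 2 ^ d * (c * N / 2 ^ t) := one_le_mul_of_one_le_of_one_le h2d hU1
      linarith
    calc ((S (k, t)).card : ℝ) ≤ _ := h1
      _ ≤ (6 * 2 ^ d * 2 ^ t) ^ k * (6 * 2 ^ d * (c * N / 2 ^ t)) ^ (d - k) := by gcongr
      _ = (6 * 2 ^ d) ^ (k + (d - k)) * ((2 ^ t) ^ k * (c * N / 2 ^ t) ^ (d - k)) := by
          rw [pow_add, mul_pow, mul_pow (6 * 2 ^ d : ℝ)]; ring
      _ ≤ (6 * 2 ^ d) ^ (k + (d - k)) * ((2 ^ t) ^ (d - 1) * (c * N / 2 ^ t) ^ (d - 1)) := by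
          gcongr <;> omega
      _ = (6 * 2 ^ d) ^ d * (c ^ (d - 1) * (N : ℝ) ^ (d - 1)) := by
          rw [← mul_pow, ← mul_pow]
          congr 2
          · omega
          · field_simp
      _ ≤ _ := by
          rw [mul_assoc]
          have : c ^ (d - 1) ≤ c ^ d := pow_le_pow_right₀ hc1 (by omega)
          gcongr
  calc (((box d N).filter (RedP d)).card : ℝ) ≤ ((I.biUnion S).card : ℝ) := by
        exact_mod_cast Finset.card_le_card hsub
    _ ≤ ∑ kt ∈ I, ((S kt).card : ℝ) := by exact_mod_cast Finset.card_biUnion_le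
    _ ≤ I.card • ((6 * 2 ^ d) ^ d * c ^ d * (N : ℝ) ^ (d - 1)) := Finset.sum_le_card_nsmul _ _ _ hS
    _ ≤ _ := by
      have hI : (I.card : ℝ) ≤ d * ((Nat.log 2 ⌊c * N⌋₊ : ℝ) + 1) := by
        simp only [I, Finset.card_product, Nat.card_Ico, Finset.card_range]
        push_cast
        gcongr
        exact_mod_cast Nat.sub_le _ _
      rw [nsmul_eq_mul]
      calc _ ≤ d * ((Nat.log 2 ⌊c * N⌋₊ : ℝ) + 1) * ((6 * 2 ^ d) ^ d * c ^ d * (N : ℝ) ^ (d - 1)) := by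
            gcongr
        _ = _ := by rw [hA]; ring
end GAC
namespace GAC
open Polynomial NumberField
variable {L K : Type*} [Field L] [NumberField L] [Field K] [NumberField K] [Algebra L K]
section
variable (a : K) (ha : IsIntegral ℤ a) (hd : (minpoly ℤ a).natDegree = Module.finrank ℚ K)
include ha hd
lemma rel_degree : (minpoly L a).natDegree = Module.finrank L K := by
  rw [natDegree_minpolyZ a ha] at hd
  have h1 := (Field.primitive_element_iff_minpoly_natDegree_eq ℚ a).mpr hd
  refine (Field.primitive_element_iff_minpoly_natDegree_eq L a).mp ?_
  rw [eq_top_iff]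
  intro x _
  have hx : x ∈ IntermediateField.adjoin ℚ {a} := h1 ▸ IntermediateField.mem_top
  have hle : IntermediateField.adjoin ℚ {a} ≤
      (IntermediateField.adjoin L {a}).restrictScalars ℚ := by
    rw [IntermediateField.adjoin_simple_le_iff]
    exact IntermediateField.mem_adjoin_simple_self L a
  exact hle hx
lemma rel_prod : (minpoly ℤ a).map (Int.castRingHom ℂ) = ∏ σ : L →+* ℂ, (minpoly L a).map σ := by
  classical
  have hm : ∀ σ : L →+* ℂ, ((minpoly L a).map σ).Monic := fun σ =>
    (minpoly.monic (Algebra.IsIntegral.isIntegral a)).map _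
  rw [minpoly_eq_prod a ha hd]
  symm
  refine eq_of_monic_of_dvd_of_natDegree_le (monic_prod_of_monic _ _ fun _ _ => monic_X_sub_C _)
    (monic_prod_of_monic _ _ fun σ _ => hm σ) ?_ ?_
  · refine Finset.prod_dvd_of_coprime (fun φ _ ψ _ h => ?_) fun φ _ => ?_
    · exact isCoprime_X_sub_C_of_isUnit_sub
        (sub_ne_zero.mpr fun h' => h (embedding_inj a ha hd h')).isUnit
    · refine dvd_trans ?_ (Finset.dvd_prod_of_mem _ (Finset.mem_univ (φ.comp (algebraMap L K))))
      rw [dvd_iff_isRoot, IsRoot, eval_map, ← hom_eval₂, ← aeval_def, minpoly.aeval, map_zero]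
  · rw [natDegree_prod_of_monic _ _ fun σ _ => hm σ,
      natDegree_prod_of_monic _ _ fun _ _ => monic_X_sub_C _]
    simp only [natDegree_X_sub_C, Finset.sum_const, Finset.card_univ, Embeddings.card, smul_eq_mul,
      (minpoly.monic (Algebra.IsIntegral.isIntegral a)).natDegree_map, rel_degree a ha hd]
    rw [Module.finrank_mul_finrank, mul_one]
omit hd in
lemma rel_integral (i : ℕ) : IsIntegral ℤ ((minpoly L a).coeff i) := by
  have h : minpoly L a ∣ (minpoly ℤ a).map (algebraMap ℤ L) := by
    refine minpoly.dvd _ _ ?_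
    rw [aeval_map_algebraMap, minpoly.aeval]
  have := integralClosure.mem_lifts_of_monic_of_dvd_map L (minpoly.monic ha)
    (minpoly.monic (Algebra.IsIntegral.isIntegral (R := L) a)) h
  rw [lifts_iff_coeff_lifts] at this
  obtain ⟨x, hx⟩ := this i
  rw [← hx]; exact x.2
lemma rel_MM : MM (minpoly ℤ a) = ∏ σ : L →+* ℂ, ((minpoly L a).map σ).mahlerMeasure := by
  classical
  rw [MM, rel_prod (L := L) a ha hd]
  generalize (Finset.univ : Finset (L →+* ℂ)) = s
  induction s using Finset.induction_on with
  | empty => simp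
  | insert i s hi ih => rw [Finset.prod_insert hi, mahlerMeasure_mul, ih, Finset.prod_insert hi]
lemma rel_ht_le (x : L) (A : ℝ) (hA : 1 ≤ A)
    (h : ∀ σ : L →+* ℂ, ‖σ x‖ ≤ A * ((minpoly L a).map σ).mahlerMeasure) :
    ht x ≤ A ^ Module.finrank ℚ K * MM (minpoly ℤ a) := by
  have h1 : ∀ σ : L →+* ℂ, 1 ≤ ((minpoly L a).map σ).mahlerMeasure := fun σ => by
    have := leadingCoeff_le_mahlerMeasure ((minpoly L a).map σ)
    rwa [((minpoly.monic (Algebra.IsIntegral.isIntegral a)).map _).leadingCoeff, norm_one] at this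
  rw [ht_eq, rel_MM (L := L) a ha hd]
  calc _ ≤ ∏ σ : L →+* ℂ, A * ((minpoly L a).map σ).mahlerMeasure :=
        Finset.prod_le_prod (fun σ _ => by positivity) fun σ _ =>
          max_le (one_le_mul_of_one_le_of_one_le hA (h1 σ)) (h σ)
    _ = A ^ Module.finrank ℚ L * ∏ σ : L →+* ℂ, ((minpoly L a).map σ).mahlerMeasure := by
        rw [Finset.prod_mul_distrib, Finset.prod_const, Finset.card_univ, Embeddings.card]
    _ ≤ _ := by
        have h2 : Module.finrank ℚ L ≤ Module.finrank ℚ K := by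
          rw [← Module.finrank_mul_finrank ℚ L K]
          exact Nat.le_mul_of_pos_right _ Module.finrank_pos
        have h3 : 0 ≤ ∏ σ : L →+* ℂ, ((minpoly L a).map σ).mahlerMeasure :=
          Finset.prod_nonneg fun σ _ => mahlerMeasure_nonneg _
        gcongr
lemma rel_coeff_le (σ : L →+* ℂ) (i : ℕ) : ‖σ ((minpoly L a).coeff i)‖ ≤
    2 ^ Module.finrank ℚ K * ((minpoly L a).map σ).mahlerMeasure := by
  have := norm_coeff_le_choose_mul_mahlerMeasure i ((minpoly L a).map σ)
  rw [coeff_map] at this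
  refine this.trans (mul_le_mul_of_nonneg_right ?_ (mahlerMeasure_nonneg _))
  rw [(minpoly.monic (Algebra.IsIntegral.isIntegral a)).natDegree_map, rel_degree a ha hd]
  calc _ ≤ ((2 ^ Module.finrank L K : ℕ) : ℝ) := by exact_mod_cast Nat.choose_le_two_pow _ _
    _ = 2 ^ Module.finrank L K := by push_cast; rfl
    _ ≤ _ := by
      refine pow_le_pow_right₀ (by norm_num) ?_
      rw [← Module.finrank_mul_finrank ℚ L K]
      exact Nat.le_mul_of_pos_left _ Module.finrank_pos
lemma rel_eval_le (σ : L →+* ℂ) (c : ℕ) : ‖σ ((minpoly L a).eval (c : L))‖ ≤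
    ((Module.finrank ℚ K + 1) * 2 ^ Module.finrank ℚ K * (c + 1) ^ Module.finrank ℚ K) *
      ((minpoly L a).map σ).mahlerMeasure := by
  have hle : Module.finrank L K ≤ Module.finrank ℚ K := by
    rw [← Module.finrank_mul_finrank ℚ L K]
    exact Nat.le_mul_of_pos_left _ Module.finrank_pos
  rw [eval_eq_sum_range, rel_degree a ha hd, map_sum]
  refine (norm_sum_le _ _).trans ?_
  have hM := mahlerMeasure_nonneg ((minpoly L a).map σ)
  calc _ ≤ ∑ i ∈ Finset.range (Module.finrank L K + 1), (2 ^ Module.finrank ℚ K *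
        (c + 1 : ℝ) ^ Module.finrank ℚ K) * ((minpoly L a).map σ).mahlerMeasure := by
        refine Finset.sum_le_sum fun i hi => ?_
        rw [map_mul, norm_mul, map_pow, map_natCast, norm_pow, Complex.norm_natCast]
        have h1 := rel_coeff_le (L := L) a ha hd σ i
        have h2 : (c : ℝ) ^ i ≤ (c + 1 : ℝ) ^ Module.finrank ℚ K := by
          calc (c : ℝ) ^ i ≤ (c + 1 : ℝ) ^ i := by gcongr; linarith
            _ ≤ _ := pow_le_pow_right₀ (by linarith [(Nat.cast_nonneg c : (0:ℝ) ≤ c)])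
              ((Finset.mem_range_succ_iff.mp hi).trans hle)
        calc _ ≤ (2 ^ Module.finrank ℚ K * ((minpoly L a).map σ).mahlerMeasure) *
              (c + 1 : ℝ) ^ Module.finrank ℚ K := by gcongr
          _ = _ := by ring
    _ ≤ _ := by
        rw [Finset.sum_const, Finset.card_range, nsmul_eq_mul]
        push_cast
        have : (Module.finrank L K : ℝ) ≤ Module.finrank ℚ K := by exact_mod_cast hle
        rw [mul_assoc (_ + 1 : ℝ), mul_assoc (_ + 1 : ℝ)]
        exact mul_le_mul_of_nonneg_right (by linarith) (by positivity)
lemma rel_gen : ∃ c : ℕ, c ≤ Module.finrank ℚ K ^ 3 ∧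
    (minpoly ℤ ((minpoly L a).eval (c : L))).natDegree = Module.finrank ℚ L := by
  classical
  set d := Module.finrank ℚ K with hdd
  have hmul : Module.finrank ℚ L * Module.finrank L K = d := Module.finrank_mul_finrank ℚ L K
  have hLpos : 0 < Module.finrank ℚ L := Module.finrank_pos
  have hRpos : 0 < Module.finrank L K := Module.finrank_pos
  have hle : Module.finrank L K ≤ d := by rw [← hmul]; exact Nat.le_mul_of_pos_left _ hLpos
  have hle' : Module.finrank ℚ L ≤ d := by rw [← hmul]; exact Nat.le_mul_of_pos_right _ hRpos
  have hne : ∀ σ τ : L →+* ℂ, σ ≠ τ → (minpoly L a).map σ - (minpoly L a).map τ ≠ 0 := by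
    intro σ τ h h0
    have hsq : Squarefree ((minpoly ℤ a).map (Int.castRingHom ℂ)) := by
      have h1 : (minpoly ℚ a).Separable := (minpoly.irreducible (Algebra.IsIntegral.isIntegral a)).separable
      have h2 := (h1.map (f := algebraMap ℚ ℂ)).squarefree
      rw [← minpolyZ_map a ha, Polynomial.map_map] at h2
      rwa [RingHom.ext_int ((algebraMap ℚ ℂ).comp (Int.castRingHom ℚ)) (Int.castRingHom ℂ)] at h2
    rw [rel_prod (L := L) a ha hd] at hsq
    have h3 : (minpoly L a).map σ * (minpoly L a).map σ ∣ ∏ σ : L →+* ℂ, (minpoly L a).map σ := by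
      rw [← Finset.mul_prod_erase _ _ (Finset.mem_univ σ)]
      refine mul_dvd_mul_left _ ?_
      nth_rewrite 1 [sub_eq_zero.mp h0]
      exact Finset.dvd_prod_of_mem _ (Finset.mem_erase.mpr ⟨h.symm, Finset.mem_univ _⟩)
    have h4 := natDegree_eq_zero_of_isUnit (hsq _ h3)
    rw [(minpoly.monic (Algebra.IsIntegral.isIntegral a)).natDegree_map, rel_degree a ha hd] at h4
    omega
  let bad : Finset ℂ := (Finset.univ : Finset ((L →+* ℂ) × (L →+* ℂ))).biUnion
    fun p => ((minpoly L a).map p.1 - (minpoly L a).map p.2).roots.toFinset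
  have hbad : bad.card ≤ d ^ 3 := by
    refine (Finset.card_biUnion_le_card_mul _ _ d fun p _ => ?_).trans ?_
    · refine (Multiset.toFinset_card_le _).trans ((card_roots' _).trans ?_)
      refine (natDegree_sub_le _ _).trans ?_
      rw [(minpoly.monic (Algebra.IsIntegral.isIntegral a)).natDegree_map,
        (minpoly.monic (Algebra.IsIntegral.isIntegral a)).natDegree_map, rel_degree a ha hd, max_self]
      exact hle
    · rw [Finset.card_univ, Fintype.card_prod, Embeddings.card, pow_succ, pow_two]
      gcongr
  obtain ⟨z, hz, hzb⟩ := Finset.exists_mem_notMem_of_card_lt_card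
    (s := bad) (t := (Finset.range (d ^ 3 + 1)).image (fun n : ℕ => (n : ℂ))) (by
      rw [Finset.card_image_of_injective _ Nat.cast_injective, Finset.card_range]; omega)
  obtain ⟨c, hc, rfl⟩ := Finset.mem_image.mp hz
  refine ⟨c, Finset.mem_range_succ_iff.mp hc, ?_⟩
  have hint : IsIntegral ℤ ((minpoly L a).eval (c : L)) := by
    rw [eval_eq_sum_range]
    exact IsIntegral.sum _ fun i _ => (rel_integral (L := L) a ha i).mul
      ((map_natCast (algebraMap ℤ L) c ▸ isIntegral_algebraMap).pow _)
  rw [natDegree_minpolyZ _ hint]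
  refine (Field.primitive_element_iff_minpoly_natDegree_eq ℚ _).mp
    ((Field.primitive_element_iff_algHom_eq_of_eval' ℚ ℂ (fun _ => IsAlgClosed.splits _) _).mpr ?_)
  intro φ ψ h
  by_contra hφψ
  apply hzb
  refine Finset.mem_biUnion.mpr ⟨((φ : L →+* ℂ), (ψ : L →+* ℂ)), Finset.mem_univ _, ?_⟩
  rw [Multiset.mem_toFinset, mem_roots (hne _ _ fun h' => hφψ (AlgHom.coe_ringHom_injective h')),
    IsRoot, eval_sub, sub_eq_zero]
  have key : ∀ χ : L →ₐ[ℚ] ℂ, ((minpoly L a).map (χ : L →+* ℂ)).eval (c : ℂ) =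
      χ ((minpoly L a).eval (c : L)) := by
    intro χ
    have := eval_natCast_map (χ : L →+* ℂ) (minpoly L a) c
    simpa only [map_natCast, RingHom.coe_coe] using this
  rw [key, key]; exact h
end
end GAC
namespace GAC
open Polynomial NumberField
lemma exists_pb {L : Type*} [Field L] [NumberField L] (a : L) (ha : IsIntegral ℤ a)
    (h1 : (minpoly ℤ a).natDegree = Module.finrank ℚ L) : ∃ pb : PowerBasis ℚ L, pb.gen = a := by
  rw [natDegree_minpolyZ _ ha] at h1
  have t1 := (Field.primitive_element_iff_minpoly_natDegree_eq ℚ a).mpr h1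
  have hi : IsIntegral ℚ a := Algebra.IsIntegral.isIntegral a
  refine ⟨PowerBasis.ofAdjoinEqTop hi ?_, PowerBasis.ofAdjoinEqTop_gen _ _⟩
  rw [← IntermediateField.adjoin_simple_toSubalgebra_of_isAlgebraic hi.isAlgebraic, t1]
  rfl
lemma gen_equiv {L L' : Type*} [Field L] [NumberField L] [Field L'] [NumberField L'] (a : L) (a' : L')
    (ha : IsIntegral ℤ a) (ha' : IsIntegral ℤ a')
    (h1 : (minpoly ℤ a).natDegree = Module.finrank ℚ L) (h2 : (minpoly ℤ a').natDegree = Module.finrank ℚ L')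
    (h : minpoly ℤ a = minpoly ℤ a') : ∃ e : L ≃ₐ[ℚ] L', e a = a' := by
  obtain ⟨pb, rfl⟩ := exists_pb a ha h1
  obtain ⟨pb', rfl⟩ := exists_pb a' ha' h2
  have h3 : minpoly ℚ pb.gen = minpoly ℚ pb'.gen := by
    rw [← minpolyZ_map _ ha, ← minpolyZ_map _ ha', h]
  exact ⟨pb.equivOfMinpoly pb' h3, pb.equivOfMinpoly_gen pb' h3⟩
variable {L : Type*} [Field L] [NumberField L]
def Rep (L : Type*) [Field L] [NumberField L] (θ : L) (c e d : ℕ) (Y : ℝ) (v : Fin d → ℤ) : Prop :=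
  ∃ g : L[X], g.Monic ∧ g.natDegree = e ∧ (∀ i, IsIntegral ℤ (g.coeff i) ∧ ht (g.coeff i) ≤ Y) ∧
    g.eval (c : L) = θ ∧ (poly d v).map (Int.castRingHom ℂ) = ∏ σ : L →+* ℂ, g.map σ
lemma ht_equiv {L' : Type*} [Field L'] [NumberField L'] (e : L ≃+* L') (x : L) : ht (e x) = ht x := by
  rw [ht_eq, ht_eq]
  let E : (L' →+* ℂ) ≃ (L →+* ℂ) := ⟨fun φ => φ.comp e, fun φ => φ.comp e.symm,
    fun φ => by ext; simp, fun φ => by ext; simp⟩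
  exact Fintype.prod_equiv E _ _ fun φ => rfl
lemma Rep.map {L' : Type*} [Field L'] [NumberField L'] (E : L ≃+* L') {θ : L} {c e d : ℕ} {Y : ℝ}
    {v : Fin d → ℤ} (h : Rep L θ c e d Y v) : Rep L' (E θ) c e d Y v := by
  obtain ⟨g, h1, h2, h3, h4, h5⟩ := h
  refine ⟨g.map (E : L →+* L'), h1.map _, by rw [h1.natDegree_map, h2], fun i => ?_, ?_, ?_⟩
  · rw [coeff_map]
    exact ⟨(h3 i).1.map (E : L →+* L').toIntAlgHom, (ht_equiv E _).trans_le (h3 i).2⟩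
  · rw [eval_natCast_map, h4]; rfl
  · rw [h5]
    let F : (L →+* ℂ) ≃ (L' →+* ℂ) := ⟨fun φ => φ.comp E.symm, fun φ => φ.comp E,
      fun φ => by ext; simp, fun φ => by ext; simp⟩
    refine Fintype.prod_equiv F _ _ fun φ => ?_
    rw [Polynomial.map_map]
    congr 1; ext; simp [F]
lemma Rep.count (θ : L) (c e d : ℕ) (Y : ℝ) (hY : 0 ≤ Y) (S : Finset (Fin d → ℤ))
    (hS : ∀ v ∈ S, Rep L θ c e d Y v) : (S.card : ℝ) ≤
      (16 ^ Module.finrank ℚ L * Y * ((Nat.log 2 ⌊Y⌋₊ : ℝ) + 1) ^ Module.finrank ℚ L) ^ (e - 1) := by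
  classical
  choose! g h1 h2 h3 h4 h5 using hS
  let T : Finset L := S.biUnion fun v => (Finset.range e).image fun i => (g v).coeff i
  have hT : ∀ x ∈ T, IsIntegral ℤ x ∧ ht x ≤ Y := by
    intro x hx
    obtain ⟨v, hv, hx⟩ := Finset.mem_biUnion.mp hx
    obtain ⟨i, -, rfl⟩ := Finset.mem_image.mp hx
    exact h3 v hv i
  have hc := ht_count Y hY T (fun x hx => (hT x hx).1) fun x hx => (hT x hx).2
  have hle : S.card ≤ T.card ^ (e - 1) := by
    have : (Fintype.piFinset fun _ : Fin (e - 1) => T).card = T.card ^ (e - 1) := by simp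
    rw [← this]
    refine Finset.card_le_card_of_injOn (fun v (i : Fin (e - 1)) => (g v).coeff (i + 1)) ?_ ?_
    · intro v hv
      simp only [Finset.mem_coe, Fintype.mem_piFinset]
      intro i
      exact Finset.mem_biUnion.mpr ⟨v, hv, Finset.mem_image.mpr ⟨i + 1, by simp; omega, rfl⟩⟩
    · intro v hv w hw hvw
      have hco : ∀ i, i ≠ 0 → (g v).coeff i = (g w).coeff i := by
        intro i hi
        rcases lt_trichotomy i e with h | h | h
        · have := congrFun hvw ⟨i - 1, by omega⟩
          simpa [Nat.sub_add_cancel (Nat.one_le_iff_ne_zero.mpr hi)] using this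
        · have e1 := (h1 v hv).coeff_natDegree
          have e2 := (h1 w hw).coeff_natDegree
          rw [h2 v hv] at e1; rw [h2 w hw] at e2
          rw [h, e1, e2]
        · rw [coeff_eq_zero_of_natDegree_lt (by rw [h2 v hv]; exact h),
            coeff_eq_zero_of_natDegree_lt (by rw [h2 w hw]; exact h)]
      have hsub : g v - g w = C ((g v - g w).coeff 0) := by
        ext i
        rw [coeff_C]
        split_ifs with hi
        · rw [hi]
        · rw [coeff_sub, hco i hi, sub_self]
      have hz : (g v - g w).coeff 0 = 0 := by
        have := congrArg (eval (c : L)) hsub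
        rw [eval_sub, h4 v hv, h4 w hw, sub_self, eval_C] at this
        exact this.symm
      rw [hz, C_0, sub_eq_zero] at hsub
      have h6 := (h5 v hv).trans ((hsub ▸ rfl : _ = _).trans (h5 w hw).symm)
      exact poly_inj d (map_injective _ (RingHom.injective_int _) h6)
  calc (S.card : ℝ) ≤ (T.card : ℝ) ^ (e - 1) := by exact_mod_cast hle
    _ ≤ _ := by gcongr
end GAC
namespace GAC
open Polynomial NumberField
def ImpP (d : ℕ) (v : Fin d → ℤ) : Prop :=
  ∃ (K L : Type) (_ : Field K) (_ : NumberField K) (_ : Field L) (_ : NumberField L) (_ : Algebra L K)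
    (a : K), IsIntegral ℤ a ∧ minpoly ℤ a = poly d v ∧ Module.finrank ℚ K = d ∧
      2 ≤ Module.finrank ℚ L ∧ 2 ≤ Module.finrank L K
def Fib (d m c : ℕ) (u : Fin m → ℤ) (Y : ℝ) (v : Fin d → ℤ) : Prop :=
  ∃ (L : Type) (_ : Field L) (_ : NumberField L) (θ : L), IsIntegral ℤ θ ∧ minpoly ℤ θ = poly m u ∧
    Module.finrank ℚ L = m ∧ Rep L θ c (d / m) d Y v
def c1 (d : ℕ) : ℕ := ((d + 1) * 2 ^ d * (d ^ 3 + 1) ^ d) ^ d * (d + 1)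
lemma Fib.count (d m c : ℕ) (u : Fin m → ℤ) (Y : ℝ) (hY : 0 ≤ Y) (S : Finset (Fin d → ℤ))
    (hS : ∀ v ∈ S, Fib d m c u Y v) : (S.card : ℝ) ≤
      (16 ^ m * Y * ((Nat.log 2 ⌊Y⌋₊ : ℝ) + 1) ^ m) ^ (d / m - 1) := by
  rcases S.eq_empty_or_nonempty with rfl | ⟨v0, hv0⟩
  · simp; positivity
  obtain ⟨L, _, _, θ, h1, h2, h3, -⟩ := hS v0 hv0
  have hn : (minpoly ℤ θ).natDegree = Module.finrank ℚ L := by rw [h2, poly_natDegree, h3]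
  have := Rep.count θ c (d / m) d Y hY S (fun v hv => by
    obtain ⟨L', _, _, θ', h1', h2', h3', h4'⟩ := hS v hv
    obtain ⟨e, rfl⟩ := gen_equiv θ' θ h1' h1 (by rw [h2', poly_natDegree, h3']) hn (h2'.trans h2.symm)
    exact h4'.map e.toRingEquiv)
  rwa [h3] at this
lemma imp_fib (d N : ℕ) (hN : 1 ≤ N) (v : Fin d → ℤ) (hv : v ∈ box d N) (h : ImpP d v) :
    ∃ m, 2 ≤ m ∧ 2 ≤ d / m ∧ m * (d / m) = d ∧ ∃ c ≤ d ^ 3, ∃ u ∈ box m (2 ^ d * c1 d * N),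
      Fib d m c u (c1 d * N : ℝ) v := by
  obtain ⟨K, L, _, _, _, _, _, a, ha, hm, hf, h2, h3⟩ := h
  have hd : (minpoly ℤ a).natDegree = Module.finrank ℚ K := by rw [hm, poly_natDegree, hf]
  have hmul := Module.finrank_mul_finrank ℚ L K
  rw [hf] at hmul
  have hdiv : d / Module.finrank ℚ L = Module.finrank L K := by
    rw [← hmul]; exact Nat.mul_div_cancel_left _ (by omega)
  have hle : Module.finrank ℚ L ≤ d := by rw [← hmul]; exact Nat.le_mul_of_pos_right _ (by omega)
  obtain ⟨c, hc, hgen⟩ := rel_gen (L := L) a ha hd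
  rw [hf] at hc
  have hMM : MM (minpoly ℤ a) ≤ (d + 1) * N := by rw [hm]; exact MM_poly_le hN hv
  set A : ℝ := ((d + 1) * 2 ^ d * (d ^ 3 + 1) ^ d) with hA
  have hp : ∀ k : ℕ, (0:ℝ) ≤ k := fun k => Nat.cast_nonneg k
  have hA1 : (2:ℝ) ^ d ≤ A := by
    have e1 : (1:ℝ) ≤ d + 1 := by linarith [hp d]
    have e2 : (1:ℝ) ≤ (d ^ 3 + 1) ^ d := one_le_pow₀ (by linarith [pow_nonneg (hp d) 3])
    rw [hA]
    nlinarith [pow_pos (show (0:ℝ) < 2 by norm_num) d, mul_le_mul e1 e2 zero_le_one (by linarith [hp d])]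
  have hA0 : 1 ≤ A := (one_le_pow₀ (by norm_num)).trans hA1
  have hY : ∀ x : L, (∀ σ : L →+* ℂ, ‖σ x‖ ≤ A * ((minpoly L a).map σ).mahlerMeasure) →
      ht x ≤ c1 d * N := by
    intro x hx
    refine (rel_ht_le (L := L) a ha hd x A hA0 hx).trans ?_
    rw [hf]
    calc _ ≤ A ^ d * ((d + 1) * N) := by gcongr
      _ = _ := by rw [hA, c1]; push_cast; ring
  have hMn : ∀ σ : L →+* ℂ, 0 ≤ ((minpoly L a).map σ).mahlerMeasure := fun σ => mahlerMeasure_nonneg _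
  set θ : L := (minpoly L a).eval (c : L) with hθ
  have hint : IsIntegral ℤ θ := by
    rw [hθ, eval_eq_sum_range]
    exact IsIntegral.sum _ fun i _ => (rel_integral (L := L) a ha i).mul
      ((map_natCast (algebraMap ℤ L) c ▸ isIntegral_algebraMap).pow _)
  have hhtθ : ht θ ≤ c1 d * N := hY _ fun σ => by
    refine (rel_eval_le (L := L) a ha hd σ c).trans ?_
    rw [hf]
    have : (c : ℝ) ≤ d ^ 3 := by exact_mod_cast hc
    have := hMn σ
    rw [hA]
    gcongr
  refine ⟨Module.finrank ℚ L, h2, by rw [hdiv]; exact h3, by rw [hdiv]; exact hmul, c, hc,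
    fun i => (minpoly ℤ θ).coeff i, ?_, L, inferInstance, inferInstance, θ, hint, ?_, rfl, minpoly L a, ?_, ?_, ?_, rfl, ?_⟩
  · rw [mem_box]
    intro i
    have h4 := coeff_le_MM (minpoly ℤ θ) i
    rw [MM_minpoly θ hint hgen, hgen] at h4
    have h5 : |((minpoly ℤ θ).coeff i : ℝ)| ≤ 2 ^ d * (c1 d * N) := by
      refine h4.trans ?_
      have : (0:ℝ) ≤ ht θ := by linarith [one_le_ht θ]
      gcongr
      norm_num
    rw [← mul_assoc] at h5
    exact_mod_cast h5
  · exact (poly_coeff' _ _ (minpoly.monic hint) hgen).symm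
  · exact minpoly.monic (Algebra.IsIntegral.isIntegral a)
  · rw [rel_degree a ha hd, hdiv]
  · intro i
    refine ⟨rel_integral a ha i, hY _ fun σ => (rel_coeff_le (L := L) a ha hd σ i).trans ?_⟩
    rw [hf]
    exact mul_le_mul_of_nonneg_right hA1 (hMn σ)
  · rw [← hm]; exact rel_prod a ha hd
open Classical in
lemma imp_count (d : ℕ) :
    PB ((d : ℝ) - 1) (fun N => (((box d N).filter (ImpP d)).card : ℝ)) := by
  have hc1 : (1:ℝ) ≤ c1 d := by
    have : 0 < c1 d := by unfold c1; positivity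
    exact_mod_cast this
  let M : Finset ℕ := (Finset.range (d + 1)).filter fun m => 2 ≤ m ∧ 2 ≤ d / m ∧ m * (d / m) = d
  let F : ℕ → ℕ → ℝ := fun m N => (d ^ 3 + 1) * ((2 * (2 ^ d * c1 d * N) + 1) ^ m *
    (16 ^ m * (c1 d * N) * ((Nat.log 2 ⌊(c1 d * N : ℝ)⌋₊ : ℝ) + 1) ^ m) ^ (d / m - 1))
  refine PB.mono (h := fun N => ∑ m ∈ M, F m N) ?_ ?_
  · refine PB.sum _ _ fun m hm => ?_
    obtain ⟨-, h2, h3, h4⟩ := Finset.mem_filter.mp hm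
    refine PB.cmul _ (by positivity) ?_
    have p1 : PB 1 (fun N : ℕ => (2 * (2 ^ d * c1 d * N) + 1 : ℝ)) :=
      ((PB.npow 1).cmul (2 * (2 ^ d * c1 d) + 1) (by positivity)).mono (fun N hN => by
        have : (1:ℝ) ≤ N := by exact_mod_cast (by omega : 1 ≤ N)
        rw [pow_one]; nlinarith) |>.mono_exp (by simp)
    have p2 : PB 1 (fun N : ℕ => (16 ^ m * (c1 d * N) *
        ((Nat.log 2 ⌊(c1 d * N : ℝ)⌋₊ : ℝ) + 1) ^ m : ℝ)) := by
      have q1 : PB 1 (fun N : ℕ => (16 ^ m * (c1 d * N) : ℝ)) :=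
        ((PB.npow 1).cmul (16 ^ m * c1 d) (by positivity)).mono (fun N hN => by
          rw [pow_one]; exact le_of_eq (by ring)) |>.mono_exp (by simp)
      have := q1.mul ((PB.natlog (c1 d) hc1).pow (fun N => by positivity) m) (fun N => by positivity)
      simpa using this
    refine ((p1.pow (fun N => by positivity) m).mul (p2.pow (fun N => by positivity) (d / m - 1))
      (fun N => by positivity)).mono_exp ?_
    have h5 : m + (d / m - 1) + 1 ≤ d := by
      generalize d / m = e at *
      obtain ⟨m, rfl⟩ := Nat.exists_eq_add_of_le h2
      obtain ⟨e, rfl⟩ := Nat.exists_eq_add_of_le h3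
      rw [← h4]; ring_nf; omega
    have : ((m + (d / m - 1) + 1 : ℕ) : ℝ) ≤ d := by exact_mod_cast h5
    push_cast at this
    linarith
  · intro N hN
    have hsub : (box d N).filter (ImpP d) ⊆ M.biUnion fun m => (Finset.range (d ^ 3 + 1)).biUnion
        fun c => (box m (2 ^ d * c1 d * N)).biUnion fun u =>
          (box d N).filter (Fib d m c u (c1 d * N : ℝ)) := by
      intro v hv
      obtain ⟨hv, hi⟩ := Finset.mem_filter.mp hv
      obtain ⟨m, h1, h2, h3, c, hc, u, hu, hF⟩ := imp_fib d N (by omega) v hv hi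
      have hmd : m ≤ d := by rw [← h3]; exact Nat.le_mul_of_pos_right _ (by omega)
      simp only [Finset.mem_biUnion]
      exact ⟨m, Finset.mem_filter.mpr ⟨Finset.mem_range_succ_iff.mpr hmd, h1, h2, h3⟩, c,
        Finset.mem_range_succ_iff.mpr hc, u, hu, Finset.mem_filter.mpr ⟨hv, hF⟩⟩
    have := (Finset.card_le_card hsub).trans (Finset.card_biUnion_le.trans (Finset.sum_le_sum fun m _ =>
      Finset.card_biUnion_le.trans (Finset.sum_le_sum fun c _ => Finset.card_biUnion_le)))
    have h' : (((box d N).filter (ImpP d)).card : ℝ) ≤ ∑ m ∈ M, ∑ c ∈ Finset.range (d ^ 3 + 1),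
        ∑ u ∈ box m (2 ^ d * c1 d * N), (((box d N).filter (Fib d m c u (c1 d * N : ℝ))).card : ℝ) := by
      exact_mod_cast this
    refine h'.trans (Finset.sum_le_sum fun m _ => ?_)
    calc _ ≤ ∑ c ∈ Finset.range (d ^ 3 + 1), ∑ u ∈ box m (2 ^ d * c1 d * N),
          (16 ^ m * (c1 d * N) * ((Nat.log 2 ⌊(c1 d * N : ℝ)⌋₊ : ℝ) + 1) ^ m) ^ (d / m - 1) :=
          Finset.sum_le_sum fun c _ => Finset.sum_le_sum fun u _ =>
            Fib.count d m c u _ (by positivity) _ fun v hv => (Finset.mem_filter.mp hv).2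
      _ = F m N := by
          simp only [Finset.sum_const, Finset.card_range, card_box, nsmul_eq_mul, F]
          push_cast
          ring
end GAC
namespace GAC
open Polynomial NumberField
section sign
open Polynomial.Gal
attribute [local instance] Polynomial.Gal.splits_ℚ_ℂ
open scoped Classical
lemma sq_of_sign {F : Type*} [Field F] [CharZero F] [Algebra F ℂ] (f : F[X]) (hf : Irreducible f)
    [Fact ((f.map (algebraMap F ℂ)).Splits)]
    (h : ∀ g : f.Gal, Equiv.Perm.sign (galActionHom f ℂ g) = 1) {K : Type*} [Field K] [Algebra F K]
    (pb : PowerBasis F K) (hpb : minpoly F pb.gen = f) : ∃ q : F, Algebra.discr F pb.basis = q ^ 2 := by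
  have := pb.finite
  have hcard : Fintype.card (K →ₐ[F] ℂ) = pb.dim := by rw [AlgHom.card, pb.finrank]
  let e : Fin pb.dim ≃ (K →ₐ[F] ℂ) := (Fintype.equivFinOfCardEq hcard).symm
  have hroot : ∀ i, e i pb.gen ∈ f.rootSet ℂ := fun i => by
    rw [mem_rootSet]
    refine ⟨hf.ne_zero, ?_⟩
    rw [← hpb, aeval_algHom_apply, minpoly.aeval, map_zero]
  let w0 : Fin pb.dim → f.rootSet ℂ := fun i => ⟨e i pb.gen, hroot i⟩
  have hw0 : Function.Bijective w0 := by
    rw [Fintype.bijective_iff_injective_and_card]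
    refine ⟨fun i j hij => e.injective (pb.algHom_ext (congrArg Subtype.val hij)), ?_⟩
    rw [card_rootSet_eq_natDegree hf.separable (IsAlgClosed.splits _), ← hpb, pb.natDegree_minpoly,
      Fintype.card_fin]
  let w := Equiv.ofBijective w0 hw0
  let r : Fin pb.dim → f.SplittingField := fun i => ((rootsEquivRoots f ℂ).symm (w i) : f.SplittingField)
  have hr : ∀ i, algebraMap f.SplittingField ℂ (r i) = e i pb.gen := by
    intro i
    have : ((rootsEquivRoots f ℂ) ((rootsEquivRoots f ℂ).symm (w i)) : ℂ) = e i pb.gen := by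
      rw [Equiv.apply_symm_apply]; rfl
    exact this
  set D := (Matrix.vandermonde r).det with hD
  have hfix : ∀ g : f.Gal, g D = D := by
    intro g
    let σ := w.symm.permCongr (galActionHom f ℂ g)
    have hσ : Equiv.Perm.sign σ = 1 := by rw [Equiv.Perm.sign_permCongr]; exact h g
    have hg : ∀ i, g (r i) = r (σ i) := by
      intro i
      have : w (σ i) = g • (w i) := by
        simp [σ, Equiv.permCongr_apply]
        rfl
      simp only [r, this, smul_def, Equiv.symm_apply_apply]
      rfl
    have h1 : g D = (Matrix.vandermonde (fun i => r (σ i))).det := by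
      refine (AlgEquiv.map_det g _).trans ?_
      congr 1
      ext i j
      rw [Matrix.vandermonde_apply, ← hg]
      exact map_pow g (r i) j
    rw [h1]
    have h2 := Matrix.det_permute σ (Matrix.vandermonde r)
    rw [hσ] at h2
    rw [Units.val_one, Int.cast_one, one_mul] at h2
    exact h2
  have hgal : IsGalois F f.SplittingField := IsGalois.of_separable_splitting_field hf.separable
  obtain ⟨q, hq⟩ := IntermediateField.mem_bot.mp ((IsGalois.mem_bot_iff_fixed D).mpr hfix)
  refine ⟨q, (algebraMap F ℂ).injective ?_⟩
  rw [Algebra.discr_powerBasis_eq_prod F ℂ pb e, map_pow, IsScalarTower.algebraMap_apply F f.SplittingField ℂ q,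
    hq, hD, Matrix.det_vandermonde, map_prod]
  simp only [map_prod, map_sub, hr, ← Finset.prod_pow]
end sign
variable {K : Type*} [Field K] [NumberField K]
lemma discr_pb (pb : PowerBasis ℚ K) : ∃ q : ℚ, Algebra.discr ℚ pb.basis = q ^ 2 * (discr K : ℚ) ∧ q ≠ 0 := by
  classical
  let b := (integralBasis K).reindex ((integralBasis K).indexEquiv pb.basis)
  have hb : Algebra.discr ℚ b = discr K := by
    rw [coe_discr, Module.Basis.coe_reindex, Algebra.discr_reindex]
  refine ⟨(b.toMatrix pb.basis).det, ?_, ?_⟩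
  · rw [← hb, ← Algebra.discr_of_matrix_vecMul, Module.Basis.toMatrix_map_vecMul]
  · intro h0
    have := Algebra.discr_of_matrix_vecMul (b : _ → K) (b.toMatrix pb.basis)
    rw [Module.Basis.toMatrix_map_vecMul, h0] at this
    exact Algebra.discr_not_zero_of_basis ℚ pb.basis (by simpa using this)
lemma discr_sq_of (pb : PowerBasis ℚ K) (h : ∃ q : ℚ, Algebra.discr ℚ pb.basis = q ^ 2) :
    IsSquare (discr K) := by
  obtain ⟨q, hq, hq0⟩ := discr_pb pb
  obtain ⟨r, hr⟩ := h
  rw [← Rat.isSquare_intCast_iff]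
  exact ⟨r / q, by field_simp; rw [mul_comm, ← hq, hr]⟩
lemma discr_pb_sq (pb : PowerBasis ℚ K) (h : IsSquare (discr K)) : ∃ q : ℚ, Algebra.discr ℚ pb.basis = q ^ 2 := by
  obtain ⟨q, hq, hq0⟩ := discr_pb pb
  obtain ⟨y, hy⟩ := h
  exact ⟨q * y, by rw [hq, hy]; push_cast; ring⟩
def SqP (d : ℕ) (v : Fin d → ℤ) (K : Type) [Field K] [NumberField K] (a : K) : Prop :=
  IsIntegral ℤ a ∧ minpoly ℤ a = poly d v ∧ Module.finrank ℚ K = d ∧ IsSquare (discr K)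
lemma irr_of_not_red (d : ℕ) (hd : 1 ≤ d) (v : Fin d → ℤ) (h : ¬ RedP d v) : Irreducible (poly d v) := by
  by_contra hi
  rw [Monic.irreducible_iff_natDegree' (poly_monic d v)] at hi
  have h1 : poly d v ≠ 1 := fun h1 => by
    have := poly_natDegree d v
    rw [h1, natDegree_one] at this; omega
  simp only [not_forall, h1, ne_eq, not_false_eq_true, true_and] at hi
  simp only [not_not] at hi
  obtain ⟨f, g, hf, hg, hfg, hk⟩ := hi
  rw [poly_natDegree, Finset.mem_Ioc] at hk
  have hdeg : f.natDegree + g.natDegree = d := by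
    rw [← hf.natDegree_mul hg, hfg, poly_natDegree]
  exact h ⟨f.natDegree, by omega, by omega, f, g, hf, hg, rfl, by omega, hfg.symm⟩
section sign
open Polynomial.Gal
attribute [local instance] Polynomial.Gal.splits_ℚ_ℂ
open scoped Classical
lemma sq_reduction (d : ℕ) (hd : 1 ≤ d) (v : Fin d → ℤ) (h : ¬ RedP d v)
    (hs : ∀ g : ((poly d v).map (Int.castRingHom ℚ)).Gal,
      Equiv.Perm.sign (galActionHom ((poly d v).map (Int.castRingHom ℚ)) ℂ g) = 1) :
    ∃ (K : Type) (_ : Field K) (_ : NumberField K) (a : K), SqP d v K a := by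
  have hirr := irr_of_not_red d hd v h
  have hirrQ : Irreducible ((poly d v).map (Int.castRingHom ℚ)) :=
    (Monic.irreducible_iff_irreducible_map_fraction_map (K := ℚ) (poly_monic d v)).mp hirr
  set f := (poly d v).map (Int.castRingHom ℚ) with hf
  have hfm : f.Monic := (poly_monic d v).map _
  have hfd : f.natDegree = d := by rw [hf, (poly_monic d v).natDegree_map, poly_natDegree]
  have : Fact (Irreducible f) := ⟨hirrQ⟩
  let pb := AdjoinRoot.powerBasis hirrQ.ne_zero
  have hfin : Module.finrank ℚ (AdjoinRoot f) = d := by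
    rw [pb.finrank, AdjoinRoot.powerBasis_dim, hfd]
  have : FiniteDimensional ℚ (AdjoinRoot f) := pb.finite
  have : NumberField (AdjoinRoot f) := ⟨⟩
  have hr : aeval (AdjoinRoot.root f) f = 0 := by
    rw [aeval_def, Subsingleton.elim (algebraMap ℚ (AdjoinRoot f)) (AdjoinRoot.of f), AdjoinRoot.eval₂_root]
  have hmin : minpoly ℚ pb.gen = f := by
    rw [AdjoinRoot.powerBasis_gen]
    exact (minpoly.eq_of_irreducible_of_monic hirrQ hr hfm).symm
  have hr' : aeval (AdjoinRoot.root f) (poly d v) = 0 := by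
    have h2 : aeval (AdjoinRoot.root f) ((poly d v).map (algebraMap ℤ ℚ)) = 0 := hr
    rwa [aeval_map_algebraMap] at h2
  have hint : IsIntegral ℤ (AdjoinRoot.root f) := ⟨poly d v, poly_monic d v, hr'⟩
  refine ⟨AdjoinRoot f, inferInstance, inferInstance, AdjoinRoot.root f, hint, ?_, hfin, ?_⟩
  · refine map_injective (Int.castRingHom ℚ) (RingHom.injective_int _) ?_
    rw [minpolyZ_map _ hint, ← hf]
    exact hmin
  · exact discr_sq_of pb (sq_of_sign f hirrQ hs pb hmin)
end sign
end GAC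
namespace GAC
open Polynomial NumberField
section
variable {F : Type*} [Field F] [DecidableEq F]
lemma card_nf_le (R : F[X]) (hR : R ≠ 0) : (UniqueFactorizationMonoid.normalizedFactors R).card ≤ R.natDegree := by
  classical
  have h1 : (UniqueFactorizationMonoid.normalizedFactors R).prod.natDegree = R.natDegree :=
    natDegree_eq_of_degree_eq
      (degree_eq_degree_of_associated (UniqueFactorizationMonoid.prod_normalizedFactors hR))
  rw [← h1, natDegree_multiset_prod _ fun h0 => UniqueFactorizationMonoid.zero_notMem_normalizedFactors _ h0]
  have h2 : ∀ x ∈ (UniqueFactorizationMonoid.normalizedFactors R).map natDegree, 1 ≤ x := by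
    intro x hx
    obtain ⟨q, hq, rfl⟩ := Multiset.mem_map.mp hx
    exact (UniqueFactorizationMonoid.irreducible_of_normalized_factor q hq).natDegree_pos
  have := Multiset.card_nsmul_le_sum h2
  simpa using this
lemma dvd_pow_count (d : ℕ) (R : F[X]) (hR : R ≠ 0) (hRd : R.natDegree ≤ d) (S : Finset (Fin d → F))
    (hS : ∀ u ∈ S, ∃ M, poly d u ∣ R ^ M) : S.card ≤ (d + 1) ^ d := by
  classical
  let T := (UniqueFactorizationMonoid.normalizedFactors R).toFinset
  have hT : T.card ≤ d := (Multiset.toFinset_card_le _).trans ((card_nf_le R hR).trans hRd)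
  have hne : ∀ u : Fin d → F, poly d u ≠ 0 := fun u => (poly_monic d u).ne_zero
  have hsup : ∀ u ∈ S, ∀ q ∈ UniqueFactorizationMonoid.normalizedFactors (poly d u), q ∈ T := by
    intro u hu q hq
    obtain ⟨M, hM⟩ := hS u hu
    have hirr := UniqueFactorizationMonoid.irreducible_of_normalized_factor q hq
    have hd : q ∣ R := hirr.prime.dvd_of_dvd_pow
      ((UniqueFactorizationMonoid.dvd_of_mem_normalizedFactors hq).trans hM)
    rw [Multiset.mem_toFinset, UniqueFactorizationMonoid.mem_normalizedFactors_iff' hR]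
    exact ⟨hirr, UniqueFactorizationMonoid.normalize_normalized_factor q hq, hd⟩
  have : (Fintype.piFinset fun _ : T => Finset.range (d + 1)).card = (d + 1) ^ T.card := by simp
  refine le_trans ?_ (Nat.pow_le_pow_right (Nat.succ_pos d) hT)
  rw [← this]
  refine Finset.card_le_card_of_injOn
    (fun u q => (UniqueFactorizationMonoid.normalizedFactors (poly d u)).count q.1) ?_ ?_
  · intro u hu
    simp only [Finset.mem_coe, Fintype.mem_piFinset, Finset.mem_range]
    intro q
    refine Nat.lt_succ_of_le ((Multiset.count_le_card _ _).trans ((card_nf_le _ (hne u)).trans ?_))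
    rw [poly_natDegree]
  · intro u hu w hw h
    have h1 : UniqueFactorizationMonoid.normalizedFactors (poly d u) =
        UniqueFactorizationMonoid.normalizedFactors (poly d w) := by
      ext q
      by_cases hq : q ∈ T
      · exact congrFun h ⟨q, hq⟩
      · rw [Multiset.count_eq_zero_of_notMem fun h' => hq (hsup u hu q h'),
          Multiset.count_eq_zero_of_notMem fun h' => hq (hsup w hw q h')]
    have h2 := (UniqueFactorizationMonoid.prod_normalizedFactors (hne u)).symm.trans
      (h1 ▸ UniqueFactorizationMonoid.prod_normalizedFactors (hne w))
    exact poly_inj d (eq_of_monic_of_associated (poly_monic d u) (poly_monic d w) h2)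
end
noncomputable def SS (d k p : ℕ) : Set (Fin d → ZMod p) :=
  {u | ∃ R : (ZMod p)[X], R.Monic ∧ R.natDegree + k ≤ d ∧ ∃ M, poly d u ∣ R ^ M}
lemma SS_count (d k p : ℕ) (hk : k ≤ d) (hp : p.Prime) : Set.ncard (SS d k p) ≤ (d + 1) ^ d * p ^ (d - k) := by
  classical
  have : Fact p.Prime := ⟨hp⟩
  rw [Set.ncard_eq_toFinset_card']
  let T : Finset (Fin d → ZMod p) := (SS d k p).toFinset
  have hsub : T ⊆ (Finset.univ : Finset (Fin (d - k) → ZMod p)).biUnion fun r =>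
      Finset.univ.filter fun u => ∃ M, poly d u ∣ (poly (d - k) r) ^ M := by
    intro u hu
    obtain ⟨R, hR, hd, M, hM⟩ := Set.mem_toFinset.mp hu
    have hm : (R * X ^ (d - k - R.natDegree)).Monic := hR.mul (monic_X_pow _)
    have hn : (R * X ^ (d - k - R.natDegree)).natDegree = d - k := by
      rw [hR.natDegree_mul (monic_X_pow _), natDegree_X_pow]; omega
    refine Finset.mem_biUnion.mpr ⟨fun i => (R * X ^ (d - k - R.natDegree)).coeff i, Finset.mem_univ _,
      Finset.mem_filter.mpr ⟨Finset.mem_univ _, M, ?_⟩⟩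
    rw [poly_coeff' _ _ hm hn, mul_pow]
    exact Dvd.dvd.mul_right hM _
  refine (Finset.card_le_card hsub).trans ((Finset.card_biUnion_le_card_mul _ _ ((d + 1) ^ d) ?_).trans ?_)
  · intro r _
    exact dvd_pow_count d (poly (d - k) r) (poly_monic _ _).ne_zero (by rw [poly_natDegree]; omega) _
      fun u hu => (Finset.mem_filter.mp hu).2
  · simp [ZMod.card, mul_comm]
lemma card_modEq_le (N C : ℕ) (hC : 0 < C) (a : ℤ) :
    ((Finset.Icc (-(N : ℤ)) N).filter (fun x : ℤ => (x : ZMod C) = a)).card ≤ 2 * N / C + 1 := by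
  have hC' : (0 : ℤ) < C := by exact_mod_cast hC
  rw [← Finset.card_range (2 * N / C + 1)]
  refine Finset.card_le_card_of_injOn (fun x => ((x + N) / C).toNat) ?_ ?_
  · intro x hx
    obtain ⟨hx, -⟩ := Finset.mem_filter.mp hx
    rw [Finset.mem_Icc] at hx
    simp only [Finset.coe_range, Set.mem_Iio]
    have h1 : (x + N) / (C : ℤ) ≤ (2 * N : ℤ) / C := Int.ediv_le_ediv hC' (by omega)
    have h2 : (0 : ℤ) ≤ (2 * N : ℤ) / C := Int.ediv_nonneg (by omega) (by omega)
    zify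
    omega
  · intro x hx y hy hxy
    obtain ⟨hx, hxa⟩ := Finset.mem_filter.mp hx
    obtain ⟨hy, hya⟩ := Finset.mem_filter.mp hy
    rw [Finset.mem_Icc] at hx hy
    have h1 : 0 ≤ (x + N) / (C : ℤ) := Int.ediv_nonneg (by omega) (by omega)
    have h2 : 0 ≤ (y + N) / (C : ℤ) := Int.ediv_nonneg (by omega) (by omega)
    have h3 : (x + N) / (C : ℤ) = (y + N) / C := by
      have : ((x + N) / (C : ℤ)).toNat = ((y + N) / (C : ℤ)).toNat := hxy
      omega
    have h4 := (ZMod.intCast_eq_intCast_iff_dvd_sub y x C).mp (hya.trans hxa.symm)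
    obtain ⟨k, hk⟩ := h4
    have h5 : x + N = y + N + C * k := by linarith
    rw [h5, Int.add_mul_ediv_left _ _ hC'.ne'] at h3
    have : k = 0 := by omega
    rw [this] at hk; linarith
lemma box_sieve {ι : Type*} [Fintype ι] [DecidableEq ι] (N C : ℕ) (hC : Squarefree C)
    (Z : ∀ p : ℕ, Finset (ι → ZMod p)) (S : Finset (ι → ℤ)) (hS : ∀ v ∈ S, ∀ i, |v i| ≤ N)
    (hZ : ∀ v ∈ S, ∀ p ∈ C.primeFactors, (fun i => (v i : ZMod p)) ∈ Z p) :
    S.card ≤ (2 * N / C + 1) ^ Fintype.card ι * ∏ p ∈ C.primeFactors, (Z p).card := by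
  classical
  have hC0 : 0 < C := Nat.pos_of_ne_zero hC.ne_zero
  let φ : (ι → ℤ) → (∀ p : C.primeFactors, ι → ZMod p.1) := fun v p i => (v i : ZMod p.1)
  have him : (S.image φ).card ≤ ∏ p ∈ C.primeFactors, (Z p).card := by
    have : (Fintype.piFinset fun p : C.primeFactors => Z p.1).card = ∏ p ∈ C.primeFactors, (Z p).card := by
      rw [Fintype.card_piFinset, Finset.prod_coe_sort C.primeFactors fun p => (Z p).card]
    rw [← this]
    refine Finset.card_le_card fun x hx => ?_
    obtain ⟨v, hv, rfl⟩ := Finset.mem_image.mp hx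
    exact Fintype.mem_piFinset.mpr fun p => hZ v hv p.1 p.2
  refine (Finset.card_le_mul_card_image S ((2 * N / C + 1) ^ Fintype.card ι) ?_).trans
    (Nat.mul_le_mul_left _ him)
  intro x hx
  obtain ⟨w, hw, rfl⟩ := Finset.mem_image.mp hx
  have : (S.filter fun v => φ v = φ w) ⊆ Fintype.piFinset fun i =>
      (Finset.Icc (-(N : ℤ)) N).filter (fun x : ℤ => (x : ZMod C) = w i) := by
    intro v hv
    obtain ⟨hv, he⟩ := Finset.mem_filter.mp hv
    refine Fintype.mem_piFinset.mpr fun i => Finset.mem_filter.mpr ⟨?_, ?_⟩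
    · have := abs_le.mp (hS v hv i); simp [this]
    · rw [← sub_eq_zero, ← Int.cast_sub, ZMod.intCast_zmod_eq_zero_iff_dvd]
      have h1 : ∀ p ∈ C.primeFactors, (p : ℤ) ∣ v i - w i := by
        intro p hp
        rw [← ZMod.intCast_zmod_eq_zero_iff_dvd, Int.cast_sub, sub_eq_zero]
        exact congrFun (congrFun he ⟨p, hp⟩) i
      have h2 : C ∣ (v i - w i).natAbs := by
        rw [← Nat.prod_primeFactors_of_squarefree hC]
        exact Finset.prod_primes_dvd _ (fun p hp => (Nat.prime_of_mem_primeFactors hp).prime)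
          fun p hp => Int.natCast_dvd.mp (h1 p hp)
      exact Int.natCast_dvd.mpr h2
  refine (Finset.card_le_card this).trans ?_
  rw [Fintype.card_piFinset]
  refine (Finset.prod_le_pow_card _ _ _ fun i _ => card_modEq_le N C hC0 (w i)).trans ?_
  simp
end GAC
namespace GAC
open Polynomial NumberField
def tau (n : ℕ) : ℕ := n.divisors.card
lemma tau_mul_le (a b : ℕ) : tau (a * b) ≤ tau a * tau b := by
  unfold tau
  rw [Nat.divisors_mul]
  exact Finset.card_mul_le
lemma tau_pow_le (a k : ℕ) : tau (a ^ k) ≤ tau a ^ k := by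
  induction k with
  | zero => simp [tau]
  | succ k ih =>
    rw [pow_succ, pow_succ]
    exact (tau_mul_le _ _).trans (Nat.mul_le_mul_right _ ih)
lemma tau_sum (k X : ℕ) : ∑ n ∈ Finset.Icc 1 X, (tau n : ℝ) ^ k / n ≤ (1 + Real.log X) ^ (2 ^ k) := by
  induction k with
  | zero =>
    have := harmonic_le_one_add_log X
    rw [harmonic_eq_sum_Icc] at this
    push_cast at this
    simpa using this
  | succ k ih =>
    have hpos : 0 ≤ ∑ n ∈ Finset.Icc 1 X, (tau n : ℝ) ^ k / n := Finset.sum_nonneg fun _ _ => by positivity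
    calc _ ≤ (∑ n ∈ Finset.Icc 1 X, (tau n : ℝ) ^ k / n) ^ 2 := ?_
      _ ≤ ((1 + Real.log X) ^ (2 ^ k)) ^ 2 := by gcongr
      _ = _ := by rw [← pow_mul, pow_succ]
    let f : ℕ → ℝ := fun n => (tau n : ℝ) ^ k / n
    let P := ((Finset.Icc 1 X) ×ˢ (Finset.Icc 1 X)).filter fun x => x.1 * x.2 ≤ X
    have h1 : (∑ n ∈ Finset.Icc 1 X, f n) ^ 2 = ∑ x ∈ (Finset.Icc 1 X) ×ˢ (Finset.Icc 1 X), f x.1 * f x.2 := by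
      rw [sq, Finset.sum_mul_sum, Finset.sum_product]
    have hf : ∀ n, 0 ≤ f n := fun n => by positivity
    rw [h1]
    refine le_trans ?_ (Finset.sum_le_sum_of_subset_of_nonneg (Finset.filter_subset _ _)
      (fun x _ _ => mul_nonneg (hf _) (hf _)) : ∑ x ∈ P, f x.1 * f x.2 ≤ _)
    rw [← Finset.sum_fiberwise_of_maps_to (t := Finset.Icc 1 X) (g := fun x : ℕ × ℕ => x.1 * x.2)]
    · refine Finset.sum_le_sum fun n hn => ?_
      rw [Finset.mem_Icc] at hn
      have h2 : P.filter (fun x => x.1 * x.2 = n) = n.divisorsAntidiagonal := by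
        ext ⟨a, b⟩
        simp only [P, Finset.mem_filter, Finset.mem_product, Finset.mem_Icc, Nat.mem_divisorsAntidiagonal]
        constructor
        · rintro ⟨_, h⟩; exact ⟨h, by omega⟩
        · rintro ⟨h, h0⟩
          have ha : a ≠ 0 := by rintro rfl; simp at h; omega
          have hb : b ≠ 0 := by rintro rfl; simp at h; omega
          have h3 : a ≤ n := Nat.le_of_dvd (by omega) ⟨b, h.symm⟩
          have h4 : b ≤ n := Nat.le_of_dvd (by omega) ⟨a, by rw [← h, mul_comm]⟩
          refine ⟨⟨⟨⟨by omega, by omega⟩, by omega, by omega⟩, by omega⟩, h⟩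
      rw [h2]
      have h5 : (tau n : ℝ) ^ (k + 1) / n = ∑ x ∈ n.divisorsAntidiagonal, (tau n : ℝ) ^ k / n := by
        rw [Finset.sum_const, nsmul_eq_mul]
        have : n.divisorsAntidiagonal.card = tau n := by
          rw [tau, ← Nat.map_div_right_divisors, Finset.card_map]
        rw [this, pow_succ]; ring
      rw [h5]
      refine Finset.sum_le_sum fun x hx => ?_
      obtain ⟨hx, -⟩ := Nat.mem_divisorsAntidiagonal.mp hx
      have h6 : (tau n : ℝ) ≤ tau x.1 * tau x.2 := by rw [← hx]; exact_mod_cast tau_mul_le _ _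
      have h7 : (n : ℝ) = x.1 * x.2 := by rw [← hx]; push_cast; rfl
      simp only [f]
      rw [div_mul_div_comm, ← mul_pow, ← h7]
      gcongr
    · intro x hx
      simp only [P, Finset.mem_filter, Finset.mem_product, Finset.mem_Icc] at hx
      rw [Finset.mem_Icc]
      exact ⟨Nat.mul_pos hx.1.1.1 hx.1.2.1, hx.2⟩
lemma tau_sum' (k X : ℕ) : ∑ n ∈ Finset.Icc 1 X, (tau n : ℝ) ^ k ≤ X * (1 + Real.log X) ^ (2 ^ k) := by
  refine le_trans ?_ (mul_le_mul_of_nonneg_left (tau_sum k X) (Nat.cast_nonneg X))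
  rw [Finset.mul_sum]
  refine Finset.sum_le_sum fun n hn => ?_
  rw [Finset.mem_Icc] at hn
  have h1 : (0 : ℝ) < n := by exact_mod_cast hn.1
  rw [mul_div_assoc', le_div_iff₀ h1, mul_comm]
  have : (n : ℝ) ≤ X := by exact_mod_cast hn.2
  gcongr
lemma two_pow_omega (n : ℕ) (hn : n ≠ 0) : 2 ^ n.primeFactors.card ≤ tau n := by
  rw [tau, Nat.card_divisors hn]
  refine Finset.pow_card_le_prod _ _ _ fun p hp => ?_
  have := (Nat.prime_of_mem_primeFactors hp).factorization_pos_of_dvd hn (Nat.dvd_of_mem_primeFactors hp)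
  omega
lemma omega_sum (c : ℕ) : PB 0 (fun N => ∑ n ∈ Finset.Icc 1 N, (c : ℝ) ^ n.primeFactors.card / n) := by
  refine ⟨1, zero_le_one, 2 ^ c, fun N hN => ?_⟩
  simp only [Real.rpow_zero, mul_one, one_mul]
  refine (Finset.sum_le_sum fun n hn => ?_).trans (tau_sum c N)
  rw [Finset.mem_Icc] at hn
  gcongr
  have h1 : c ≤ 2 ^ c := Nat.lt_two_pow_self.le
  calc (c : ℝ) ^ n.primeFactors.card ≤ ((2 : ℝ) ^ c) ^ n.primeFactors.card := by
        gcongr; exact_mod_cast h1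
    _ = ((2 : ℝ) ^ n.primeFactors.card) ^ c := by rw [← pow_mul, ← pow_mul, mul_comm]
    _ ≤ _ := by gcongr; exact_mod_cast two_pow_omega n (by omega)
lemma landreau (q B : ℕ) (s : Finset ℕ) (hq : q * (B + 1) ≤ s.card) :
    ∃ t ⊆ s, t.card = q ∧ (∏ i ∈ t, i) ^ (B + 1) ≤ ∏ i ∈ s, i ∨ 0 ∈ s := by
  by_cases h0 : 0 ∈ s
  · exact ⟨∅, by simp, Or.inr h0⟩
  induction B generalizing s with
  | zero =>
    obtain ⟨t, ht, hc⟩ := Finset.exists_subset_card_eq (show q ≤ s.card by omega)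
    refine ⟨t, ht, Or.inl ⟨hc, ?_⟩⟩
    simp only [zero_add, pow_one]
    exact Finset.prod_le_prod_of_subset_of_one_le' ht fun i hi _ => Nat.pos_of_ne_zero fun h => h0 (h ▸ hi)
  | succ B ih =>
    have hq' : q * (B + 1) + q ≤ s.card := by linarith
    obtain ⟨t, ht, hc⟩ := Finset.exists_subset_card_eq (show q ≤ s.card by omega)
    obtain ⟨t', ht', h⟩ := ih (s \ t) (by rw [Finset.card_sdiff_of_subset ht]; omega)
      (fun h => h0 (Finset.sdiff_subset h))
    obtain ⟨hc', h⟩ := h.resolve_right (fun h => h0 (Finset.sdiff_subset h))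
    have hs : (∏ i ∈ s \ t, i) * ∏ i ∈ t, i = ∏ i ∈ s, i := Finset.prod_sdiff ht
    rcases le_total (∏ i ∈ t, i) (∏ i ∈ t', i) with hle | hle
    · refine ⟨t, ht, Or.inl ⟨hc, ?_⟩⟩
      rw [pow_succ, ← hs]
      exact Nat.mul_le_mul_right _ ((Nat.pow_le_pow_left hle _).trans h)
    · refine ⟨t', ht'.trans Finset.sdiff_subset, Or.inl ⟨hc', ?_⟩⟩
      rw [pow_succ, ← hs]
      exact Nat.mul_le_mul h hle
lemma landreau' (c B n : ℕ) (hc : 1 ≤ c) (hn : Squarefree n) :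
    ∃ e, e ∣ n ∧ e ^ (B + 1) ≤ n ∧ c ^ n.primeFactors.card ≤ c ^ (B + 1) * (c ^ (B + 1)) ^ e.primeFactors.card := by
  obtain ⟨t, ht, h⟩ := landreau (n.primeFactors.card / (B + 1)) B n.primeFactors (Nat.div_mul_le_self _ _)
  obtain ⟨h1, h2⟩ := h.resolve_right (by simp)
  rw [Nat.prod_primeFactors_of_squarefree hn] at h2
  refine ⟨∏ i ∈ t, i, ?_, h2, ?_⟩
  · conv_rhs => rw [← Nat.prod_primeFactors_of_squarefree hn]
    exact Finset.prod_dvd_prod_of_subset _ _ _ ht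
  · rw [Nat.primeFactors_prod fun p hp => Nat.prime_of_mem_primeFactors (ht hp), h1, ← pow_mul, ← pow_add]
    refine Nat.pow_le_pow_right hc ?_
    have := Nat.div_add_mod n.primeFactors.card (B + 1)
    have := Nat.mod_lt n.primeFactors.card (Nat.succ_pos B)
    simp only [Nat.succ_eq_add_one] at *
    omega
end GAC
namespace GAC
open Polynomial NumberField
def RamP (d : ℕ) (v : Fin d → ℤ) (C : ℕ) (κ : ℕ →₀ ℕ) : Prop :=
  Squarefree C ∧ κ ∈ C.primeFactors.finsupp (fun _ => Finset.Icc 2 d) ∧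
    ∀ p ∈ C.primeFactors, d < p ∧ (fun i => (v i : ZMod p)) ∈ SS d (κ p) p
lemma extract (d : ℕ) (hd : 2 ≤ d) (v : Fin d → ℤ) (K : Type) [Field K] [NumberField K] (a : K)
    (h : SqP d v K a) : ∃ C κ, RamP d v C κ ∧
      (discr K).natAbs ≤ (d + 1) ^ (d * d * (d + 1)) * ∏ p ∈ C.primeFactors, p ^ κ p := by
  obtain ⟨ha, hm, hK, hsq⟩ := h
  let a' : 𝓞 K := ⟨a, ha⟩
  have hm' : minpoly ℤ a' = poly d v := by
    rw [← hm]
    exact (minpoly.algebraMap_eq RingOfIntegers.coe_injective a').symm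
  set D := (discr K).natAbs with hD
  have hD0 : D ≠ 0 := by simpa [D] using discr_ne_zero K
  have heven : ∀ p, Even (D.factorization p) := by
    intro p
    obtain ⟨y, hy⟩ := hsq
    have : D = y.natAbs ^ 2 := by rw [hD, hy, Int.natAbs_mul, sq]
    rw [this, Nat.factorization_pow]
    simp
  let κ := D.factorization.filter (fun p => d < p)
  let C := ∏ p ∈ κ.support, p
  have hpr : ∀ p ∈ κ.support, p.Prime := by
    intro p hp
    simp only [κ, Finsupp.support_filter, Finset.mem_filter, Nat.support_factorization] at hp
    exact Nat.prime_of_mem_primeFactors hp.1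
  have hCp : C.primeFactors = κ.support := Nat.primeFactors_prod hpr
  have hdp : ∀ p ∈ κ.support, d < p := by
    intro p hp
    simp only [κ, Finsupp.support_filter, Finset.mem_filter] at hp
    exact hp.2
  have hκ : ∀ p ∈ κ.support, κ p = D.factorization p := fun p hp => Finsupp.filter_apply_pos _ _ (hdp p hp)
  have hloc : ∀ p ∈ κ.support, κ p ≤ d ∧ (fun i => (v i : ZMod p)) ∈ SS d (κ p) p := by
    intro p hp
    obtain ⟨R, hR, hRd, hM⟩ := local_disc K p 1 (hpr p hp) (by rw [hK, pow_one]; exact hdp p hp) a'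
    rw [← hD, ← hκ p hp, hK, one_mul] at hRd
    rw [hm', poly_map] at hM
    exact ⟨by omega, R, hR, hRd, hM⟩
  refine ⟨C, κ, ⟨?_, ?_, ?_⟩, ?_⟩
  · refine Finset.squarefree_prod_of_pairwise_isCoprime (fun p hp q hq hpq => ?_)
      fun p hp => (hpr p hp).prime.squarefree
    exact Nat.coprime_iff_isRelPrime.mp ((Nat.coprime_primes (hpr p hp) (hpr q hq)).mpr hpq)
  · rw [Finset.mem_finsupp_iff, hCp]
    refine ⟨le_rfl, fun p hp => Finset.mem_Icc.mpr ⟨?_, (hloc p hp).1⟩⟩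
    have h1 := heven p
    rw [← hκ p hp] at h1
    have h2 := Finsupp.mem_support_iff.mp hp
    obtain ⟨r, hr⟩ := h1
    omega
  · rw [hCp]
    exact fun p hp => ⟨hdp p hp, (hloc p hp).2⟩
  · rw [hCp]
    have h1 := Nat.prod_factorization_pow_eq_self hD0
    have h2 : ∏ p ∈ κ.support, p ^ κ p = ∏ p ∈ D.primeFactors.filter (fun p => d < p), p ^ D.factorization p := by
      refine Finset.prod_congr ?_ fun p hp => by rw [hκ p hp]
      simp [κ, Finsupp.support_filter]
    rw [Finsupp.prod, Nat.support_factorization, ← Finset.prod_filter_mul_prod_filter_not _ (fun p => d < p)] at h1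
    rw [h2]
    refine h1.symm.le.trans ?_
    rw [mul_comm]
    refine Nat.mul_le_mul_right _ ?_
    calc ∏ p ∈ D.primeFactors.filter (fun p => ¬ d < p), p ^ D.factorization p
        ≤ ∏ p ∈ D.primeFactors.filter (fun p => ¬ d < p), (d + 1) ^ (d * d) := by
          refine Finset.prod_le_prod' fun p hp => ?_
          rw [Finset.mem_filter] at hp
          have hpp := Nat.prime_of_mem_primeFactors hp.1
          obtain ⟨R, hR, hRd, -⟩ := local_disc K p d hpp (by
            rw [hK]; exact Nat.lt_pow_self hpp.one_lt) a'
          rw [← hD, hK] at hRd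
          exact (Nat.pow_le_pow_left (by omega) _).trans (Nat.pow_le_pow_right (by omega) (by omega))
      _ = ((d + 1) ^ (d * d)) ^ (D.primeFactors.filter (fun p => ¬ d < p)).card := by simp
      _ ≤ ((d + 1) ^ (d * d)) ^ (d + 1) := by
          refine Nat.pow_le_pow_right (by positivity) ?_
          rw [← Finset.card_range (d + 1)]
          refine Finset.card_le_card fun p hp => ?_
          rw [Finset.mem_filter] at hp
          rw [Finset.mem_range]; omega
      _ = _ := by rw [← pow_mul]
open Classical in
noncomputable def toF {α : Type*} (s : Set α) : Finset α := if h : s.Finite then h.toFinset else ∅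
lemma mem_toF {α : Type*} {s : Set α} (h : s.Finite) {x : α} : x ∈ toF s ↔ x ∈ s := by simp [toF, h]
lemma card_toF {α : Type*} (s : Set α) : (toF s).card = s.ncard := by
  by_cases h : s.Finite
  · rw [toF, dif_pos h, Set.ncard_eq_toFinset_card s h]
  · rw [toF, dif_neg h, Set.Infinite.ncard h]; rfl
def C1P (d N : ℕ) (v : Fin d → ℤ) : Prop :=
  ∃ C κ, RamP d v C κ ∧ C ≤ N ∧ N ^ 2 < ∏ p ∈ C.primeFactors, p ^ κ p
lemma ram_count (d N C : ℕ) (κ : ℕ →₀ ℕ) (hC : Squarefree C) (hCN : C ≤ N) (hκ : ∀ p ∈ C.primeFactors, κ p ≤ d)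
    (S : Finset (Fin d → ℤ)) (hS : ∀ v ∈ S, v ∈ box d N ∧ RamP d v C κ) :
    (S.card : ℝ) ≤ (3 * N) ^ d * ((d + 1 : ℝ) ^ d) ^ C.primeFactors.card / ∏ p ∈ C.primeFactors, (p : ℝ) ^ κ p := by
  have h1 := box_sieve N C hC (fun p => toF (SS d (κ p) p)) S (fun v hv => mem_box.mp (hS v hv).1) (by
    intro v hv p hp
    have : Fact p.Prime := ⟨Nat.prime_of_mem_primeFactors hp⟩
    exact (mem_toF (Set.toFinite _)).mpr ((hS v hv).2.2.2 p hp).2)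
  have hC0 : 0 < C := Nat.pos_of_ne_zero hC.ne_zero
  have hC0' : (0 : ℝ) < C := by exact_mod_cast hC0
  have h2 : ((2 * N / C + 1 : ℕ) : ℝ) ≤ 3 * N / C := by
    push_cast
    have h3 : ((2 * N / C : ℕ) : ℝ) ≤ 2 * N / C := by
      have := @Nat.cast_div_le ℝ _ _ _ (2 * N) C
      push_cast at this; exact this
    have h4 : (1 : ℝ) ≤ N / C := by rw [le_div_iff₀ hC0']; simpa using (by exact_mod_cast hCN : (C : ℝ) ≤ N)
    calc _ ≤ (2 * N / C : ℝ) + N / C := add_le_add h3 h4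
      _ = _ := by ring
  have hpos : ∀ p ∈ C.primeFactors, (0 : ℝ) < p := fun p hp => by
    exact_mod_cast (Nat.prime_of_mem_primeFactors hp).pos
  have h5 : ∀ p ∈ C.primeFactors, ((toF (SS d (κ p) p)).card : ℝ) ≤ (d + 1 : ℝ) ^ d * ((p : ℝ) ^ d / (p : ℝ) ^ κ p) := by
    intro p hp
    rw [card_toF]
    have := SS_count d (κ p) p (hκ p hp) (Nat.prime_of_mem_primeFactors hp)
    rw [div_eq_mul_inv, ← pow_sub₀ _ (hpos p hp).ne' (hκ p hp)]
    exact_mod_cast this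
  have h6 : (C : ℝ) = ∏ p ∈ C.primeFactors, (p : ℝ) := by
    conv_lhs => rw [← Nat.prod_primeFactors_of_squarefree hC]
    push_cast; rfl
  calc (S.card : ℝ) ≤ ((2 * N / C + 1 : ℕ) : ℝ) ^ d * ∏ p ∈ C.primeFactors, ((toF (SS d (κ p) p)).card : ℝ) := by
        rw [Fintype.card_fin] at h1; exact_mod_cast h1
    _ ≤ (3 * N / C) ^ d * ∏ p ∈ C.primeFactors, ((d + 1 : ℝ) ^ d * ((p : ℝ) ^ d / (p : ℝ) ^ κ p)) := by
        exact mul_le_mul (pow_le_pow_left₀ (Nat.cast_nonneg _) h2 _)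
          (Finset.prod_le_prod (fun _ _ => Nat.cast_nonneg _) h5)
          (Finset.prod_nonneg fun _ _ => Nat.cast_nonneg _) (by positivity)
    _ = _ := by
        rw [Finset.prod_mul_distrib, Finset.prod_div_distrib, Finset.prod_const, Finset.prod_pow, ← h6, div_pow]
        have : ∏ p ∈ C.primeFactors, (p : ℝ) ^ κ p ≠ 0 :=
          Finset.prod_ne_zero_iff.mpr fun p hp => pow_ne_zero _ (hpos p hp).ne'
        generalize ∏ p ∈ C.primeFactors, (p : ℝ) ^ κ p = Q at *
        generalize ((d + 1 : ℝ) ^ d) ^ C.primeFactors.card = Q' at *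
        field_simp
open Classical in
lemma c1_count (d : ℕ) : PB ((d : ℝ) - 1) (fun N => (((box d N).filter (C1P d N)).card : ℝ)) := by
  let A : ℕ := (d + 1) ^ d * (d + 1)
  have key := ((omega_sum A).mul (PB.rpow ((d : ℝ) - 1)) (fun N => by positivity)).cmul ((3 : ℝ) ^ d) (by positivity)
  rw [zero_add] at key
  refine key.mono fun N hN => ?_
  have hN0 : (0 : ℝ) < N := by exact_mod_cast (by omega : 0 < N)
  let W : ℕ → Finset (ℕ →₀ ℕ) := fun C => C.primeFactors.finsupp (fun _ => Finset.Icc 2 d)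
  let F : ℕ → (ℕ →₀ ℕ) → Finset (Fin d → ℤ) := fun C κ => (box d N).filter fun v =>
    RamP d v C κ ∧ N ^ 2 < ∏ p ∈ C.primeFactors, p ^ κ p
  have hsub : (box d N).filter (C1P d N) ⊆ (Finset.Icc 1 N).biUnion fun C => (W C).biUnion fun κ => F C κ := by
    intro v hv
    obtain ⟨hv, C, κ, h, hC, hn⟩ := Finset.mem_filter.mp hv
    simp only [Finset.mem_biUnion]
    exact ⟨C, Finset.mem_Icc.mpr ⟨Nat.pos_of_ne_zero h.1.ne_zero, hC⟩, κ, h.2.1,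
      Finset.mem_filter.mpr ⟨hv, h, hn⟩⟩
  have hF : ∀ C ∈ Finset.Icc 1 N, ∀ κ ∈ W C, ((F C κ).card : ℝ) ≤
      3 ^ d * (N : ℝ) ^ ((d : ℝ) - 1) * (((d + 1) ^ d : ℕ) : ℝ) ^ C.primeFactors.card / C := by
    intro C hC κ hκ
    rw [Finset.mem_Icc] at hC
    have hC0 : (0 : ℝ) < C := by exact_mod_cast hC.1
    rcases (F C κ).eq_empty_or_nonempty with he | ⟨v, hv⟩
    · rw [he]; simp only [Finset.card_empty, Nat.cast_zero]; positivity
    obtain ⟨-, ⟨hsq, -, -⟩, hn⟩ := Finset.mem_filter.mp hv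
    have hκ' := (Finset.mem_finsupp_iff.mp hκ).2
    simp only [Finset.mem_Icc] at hκ'
    refine (ram_count d N C κ hsq hC.2 (fun p hp => (hκ' p hp).2) (F C κ) (fun v hv => by
      obtain ⟨h1, h2, -⟩ := Finset.mem_filter.mp hv; exact ⟨h1, h2⟩)).trans ?_
    have h1 : C ^ 2 ≤ ∏ p ∈ C.primeFactors, p ^ κ p := by
      conv_lhs => rw [← Nat.prod_primeFactors_of_squarefree hsq]
      rw [← Finset.prod_pow]
      exact Finset.prod_le_prod' fun p hp =>
        Nat.pow_le_pow_right (Nat.prime_of_mem_primeFactors hp).pos (hκ' p hp).1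
    have h2 : N * C ≤ ∏ p ∈ C.primeFactors, p ^ κ p := by nlinarith
    have h3 : (N : ℝ) * C ≤ ∏ p ∈ C.primeFactors, (p : ℝ) ^ κ p := by exact_mod_cast h2
    have h4 : (N : ℝ) ^ ((d : ℝ) - 1) = (N : ℝ) ^ d / N := by
      rw [Real.rpow_sub hN0, Real.rpow_natCast, Real.rpow_one]
    rw [h4]
    calc _ ≤ (3 * N : ℝ) ^ d * ((d + 1 : ℝ) ^ d) ^ C.primeFactors.card / (N * C) := by gcongr
      _ = _ := by push_cast; rw [mul_pow]; field_simp
  have hW : ∀ C, ((W C).card : ℝ) ≤ (d + 1 : ℝ) ^ C.primeFactors.card := by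
    intro C
    have : (W C).card ≤ (d + 1) ^ C.primeFactors.card := by
      simp only [W]
      rw [Finset.card_finsupp, Finset.prod_const]
      refine Nat.pow_le_pow_left ?_ _
      rw [Nat.card_Icc]; omega
    exact_mod_cast this
  calc (((box d N).filter (C1P d N)).card : ℝ) ≤ ((((Finset.Icc 1 N).biUnion fun C => (W C).biUnion fun κ => F C κ).card : ℕ) : ℝ) := by
        exact_mod_cast Finset.card_le_card hsub
    _ ≤ ∑ C ∈ Finset.Icc 1 N, ∑ κ ∈ W C, ((F C κ).card : ℝ) := by
        exact_mod_cast Finset.card_biUnion_le.trans (Finset.sum_le_sum fun C _ => Finset.card_biUnion_le)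
    _ ≤ ∑ C ∈ Finset.Icc 1 N, (W C).card * (3 ^ d * (N : ℝ) ^ ((d : ℝ) - 1) * (((d + 1) ^ d : ℕ) : ℝ) ^ C.primeFactors.card / C) := by
        refine Finset.sum_le_sum fun C hC => (Finset.sum_le_sum (hF C hC)).trans ?_
        rw [Finset.sum_const, nsmul_eq_mul]
    _ ≤ ∑ C ∈ Finset.Icc 1 N, (d + 1 : ℝ) ^ C.primeFactors.card * (3 ^ d * (N : ℝ) ^ ((d : ℝ) - 1) * (((d + 1) ^ d : ℕ) : ℝ) ^ C.primeFactors.card / C) := by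
        gcongr with C hC
        exact hW C
    _ = _ := by
        rw [Finset.sum_mul, Finset.mul_sum]
        refine Finset.sum_congr rfl fun C _ => ?_
        simp only [A]
        push_cast
        rw [mul_pow]; ring
end GAC
namespace GAC
open Polynomial NumberField
section DD
variable {R S : Type*} [CommRing R] [CommRing S] (m : ℕ)
noncomputable def g0 (a : Fin m → R) : R[X] := poly (m + 1) (Fin.cons 0 a)
noncomputable def RR (a : Fin m → R) : R[X] :=
  resultant ((g0 m a).derivative.map C) ((g0 m a).map C + C X) m (m + 1)
noncomputable def DD (a : Fin m → R) : R := resultant (RR m a) (RR m a).derivative m (m - 1)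
lemma poly_cons (t : R) (a : Fin m → R) : poly (m + 1) (Fin.cons t a) = g0 m a + C t := by
  simp [g0, poly, Fin.sum_univ_succ]; ring
lemma g0_map (φ : R →+* S) (a : Fin m → R) : (g0 m a).map φ = g0 m (fun i => φ (a i)) := by
  rw [g0, poly_map, g0]
  congr 1
  ext i
  refine Fin.cases ?_ (fun i => ?_) i <;> simp
lemma DD_map (φ : R →+* S) (a : Fin m → R) : φ (DD m a) = DD m (fun i => φ (a i)) := by
  have h : (RR m a).map φ = RR m (fun i => φ (a i)) := by
    rw [RR, RR, ← coe_mapRingHom, ← resultant_map_map, Polynomial.map_map, ← g0_map]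
    congr 1
    · rw [derivative_map, Polynomial.map_map]
      congr 1
      ext x; simp
    · rw [Polynomial.map_add, Polynomial.map_map, Polynomial.map_map]
      congr 1
      · congr 1
        ext x; simp
      · simp
  rw [DD, ← resultant_map_map, h, ← derivative_map, h, DD]
end DD
section
variable {k : Type*} [Field k] [IsAlgClosed k] (m : ℕ) (hm : ((m + 1 : ℕ) : k) ≠ 0)
  (a : Fin m → k)
include hm
lemma g0_deriv_coeff : (g0 m a).derivative.coeff m = ((m + 1 : ℕ) : k) := by
  have h : (g0 m a).coeff (m + 1) = 1 := by
    have := poly_monic (m + 1) (Fin.cons 0 a : Fin (m + 1) → k)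
    rw [Monic, leadingCoeff, poly_natDegree] at this
    exact this
  rw [coeff_derivative, h]; push_cast; ring
lemma g0_deriv_natDegree : (g0 m a).derivative.natDegree = m := by
  refine le_antisymm ?_ (le_natDegree_of_ne_zero (by rw [g0_deriv_coeff m hm]; exact hm))
  refine (natDegree_derivative_le _).trans ?_
  rw [g0, poly_natDegree]; omega
lemma RR_eq : ∃ u : k, u ≠ 0 ∧ RR m a = C u * (((g0 m a).derivative.roots.map fun c => -(g0 m a).eval c).map
    fun r => X - C r).prod := by
  have hinj : Function.Injective (C : k →+* k[X]) := C_injective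
  have hsp : (g0 m a).derivative.Splits := IsAlgClosed.splits _
  have hd := g0_deriv_natDegree m hm a
  have h := resultant_eq_prod_eval ((g0 m a).derivative.map C) ((g0 m a).map C + C X) (m + 1)
    (natDegree_add_le_of_degree_le ((natDegree_map_le).trans (by rw [g0, poly_natDegree])) (by simp))
    (hsp.map C)
  rw [natDegree_map_eq_of_injective hinj, hd, leadingCoeff_map_of_injective hinj, hsp.roots_map_of_injective hinj] at h
  refine ⟨(g0 m a).derivative.leadingCoeff ^ (m + 1), pow_ne_zero _ ?_, ?_⟩
  · rw [leadingCoeff, hd, g0_deriv_coeff m hm]; exact hm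
  · rw [RR, h, Multiset.map_map, Multiset.map_map, C_pow]
    congr 3
    ext1 c
    simp [eval_map, eval₂_at_apply, add_comm]
lemma DD_eq_zero_iff : DD m a = 0 ↔ ¬ ((g0 m a).derivative.roots.map fun c => (g0 m a).eval c).Nodup := by
  classical
  obtain ⟨u, hu, h⟩ := RR_eq m hm a
  have hr : (RR m a).roots = (g0 m a).derivative.roots.map fun c => -(g0 m a).eval c := by
    rw [h, roots_C_mul _ hu, roots_multiset_prod_X_sub_C]
  have h0 : RR m a ≠ 0 := by
    rw [h]
    exact mul_ne_zero (C_ne_zero.mpr hu) (monic_multiset_prod_of_monic _ _ fun r _ => monic_X_sub_C r).ne_zero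
  have hsp : (RR m a).Splits := IsAlgClosed.splits _
  have hd : (RR m a).natDegree = m := by
    rw [← splits_iff_card_roots.mp hsp, hr, Multiset.card_map,
      splits_iff_card_roots.mp (IsAlgClosed.splits _), g0_deriv_natDegree m hm]
  have h1 := resultant_eq_prod_eval (RR m a) (RR m a).derivative (m - 1)
    ((natDegree_derivative_le _).trans (by rw [hd])) hsp
  rw [hd] at h1
  have h2 : (RR m a).roots.Nodup ↔ ((g0 m a).derivative.roots.map fun c => (g0 m a).eval c).Nodup := by
    rw [hr, ← Multiset.nodup_map_iff_of_injective (neg_injective (G := k)) (s := Multiset.map _ _), Multiset.map_map]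
    simp
  rw [DD, h1, ← h2, mul_eq_zero, or_iff_right (pow_ne_zero _ (leadingCoeff_ne_zero.mpr h0)),
    Multiset.prod_eq_zero_iff, Multiset.nodup_iff_count_le_one]
  simp only [Multiset.mem_map, mem_roots h0, not_forall, not_le, count_roots, one_lt_rootMultiplicity_iff_isRoot h0, IsRoot.def]
end
lemma deg_sub (k : Type*) [Field k] [IsAlgClosed k] (m : ℕ) (hm : ((m + 1 : ℕ) : k) ≠ 0) (t : k)
    (a : Fin m → k) (R : k[X]) (hR : R.Monic) (hRd : R.natDegree + 2 ≤ m + 1) (M : ℕ)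
    (h : poly (m + 1) (Fin.cons t a) ∣ R ^ M) :
    Multiset.replicate 2 (-t) ≤ ((g0 m a).derivative.roots.map fun c => (g0 m a).eval c) := by
  classical
  set f := poly (m + 1) (Fin.cons t a) with hf
  have hf0 : f ≠ 0 := (poly_monic _ _).ne_zero
  have hfd : f.derivative = (g0 m a).derivative := by rw [hf, poly_cons]; simp
  have hf' : f.derivative ≠ 0 := by
    intro h0
    have := g0_deriv_coeff m hm a
    rw [← hfd, h0, coeff_zero] at this
    exact hm this.symm
  have h1 : f.roots - f.roots.dedup ≤ f.derivative.roots := by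
    rw [Multiset.le_iff_count]
    intro c
    rw [Multiset.count_sub, Multiset.count_dedup, count_roots, count_roots]
    split_ifs with hc
    · rw [le_rootMultiplicity_iff hf']
      exact pow_sub_one_dvd_derivative_of_pow_dvd (pow_rootMultiplicity_dvd f c)
    · have : rootMultiplicity c f = 0 := by
        rw [← count_roots]; exact Multiset.count_eq_zero_of_notMem hc
      omega
  have h2 : 2 ≤ (f.roots - f.roots.dedup).card := by
    rw [Multiset.card_sub (Multiset.dedup_le _), splits_iff_card_roots.mp (IsAlgClosed.splits _), show f.natDegree = m + 1 from poly_natDegree _ _]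
    have : f.roots.dedup ≤ R.roots := by
      rw [Multiset.le_iff_subset (Multiset.nodup_dedup _)]
      intro c hc
      rw [Multiset.mem_dedup, mem_roots hf0] at hc
      rw [mem_roots hR.ne_zero]
      exact (IsRoot.def.mp (hc.dvd h)) |> fun h => by
        rw [eval_pow] at h; exact eq_zero_of_pow_eq_zero h
    have := (Multiset.card_le_card this).trans (card_roots' R)
    omega
  have h3 : (f.roots - f.roots.dedup).map (fun c => (g0 m a).eval c) =
      Multiset.replicate (f.roots - f.roots.dedup).card (-t) := by
    rw [Multiset.eq_replicate]
    refine ⟨by simp, fun b hb => ?_⟩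
    obtain ⟨c, hc, rfl⟩ := Multiset.mem_map.mp hb
    have hc' := Multiset.mem_of_le (Multiset.sub_le_self _ _) hc
    rw [mem_roots hf0, IsRoot.def, hf, poly_cons, eval_add, eval_C] at hc'
    linear_combination hc'
  calc Multiset.replicate 2 (-t) ≤ Multiset.replicate (f.roots - f.roots.dedup).card (-t) :=
        Multiset.replicate_mono _ h2
    _ = _ := h3.symm
    _ ≤ _ := by rw [← hfd]; exact Multiset.map_le_map h1
def PS (m p : ℕ) : Set (Fin m → ZMod p) := {a | ∃ t : ZMod p, Fin.cons t a ∈ SS (m + 1) 2 p}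
lemma SS_closure (m p : ℕ) [Fact p.Prime] (hp : m + 1 < p) (t : ZMod p) (a : Fin m → ZMod p)
    (h : (Fin.cons t a : Fin (m + 1) → ZMod p) ∈ SS (m + 1) 2 p) :
    let φ := algebraMap (ZMod p) (AlgebraicClosure (ZMod p))
    Multiset.replicate 2 (-φ t) ≤ ((g0 m fun i => φ (a i)).derivative.roots.map fun c =>
      (g0 m fun i => φ (a i)).eval c) := by
  intro φ
  obtain ⟨R, hR, hRd, M, hM⟩ := h
  have hM' := Polynomial.map_dvd φ hM
  rw [poly_map, Polynomial.map_pow] at hM'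
  refine deg_sub _ m ?_ (φ t) _ (R.map φ) (hR.map _) (by rw [hR.natDegree_map]; exact hRd) M ?_
  · intro h0
    have h1 := (CharP.cast_eq_zero_iff (AlgebraicClosure (ZMod p)) p _).mp h0
    exact absurd (Nat.le_of_dvd (by omega) h1) (by omega)
  · have he : (fun i => φ ((Fin.cons t a : Fin (m + 1) → ZMod p) i)) = Fin.cons (φ t) fun i => φ (a i) := by
      funext i
      refine Fin.cases ?_ (fun i => ?_) i <;> simp
    rw [he] at hM'
    exact hM'
lemma cast_ne (m p : ℕ) [Fact p.Prime] (hp : m + 1 < p) : ((m + 1 : ℕ) : AlgebraicClosure (ZMod p)) ≠ 0 := by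
  intro h0
  have h1 := (CharP.cast_eq_zero_iff (AlgebraicClosure (ZMod p)) p _).mp h0
  exact absurd (Nat.le_of_dvd (by omega) h1) (by omega)
lemma PS_dvd (m p : ℕ) (hpp : p.Prime) (hp : m + 1 < p) (a : Fin m → ℤ)
    (h : (fun i => (a i : ZMod p)) ∈ PS m p) : (p : ℤ) ∣ DD m a := by
  have : Fact p.Prime := ⟨hpp⟩
  obtain ⟨t, ht⟩ := h
  have h1 := SS_closure m p hp t _ ht
  rw [← ZMod.intCast_zmod_eq_zero_iff_dvd]
  have h2 := DD_map m (Int.castRingHom (ZMod p)) a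
  simp only [eq_intCast] at h2
  rw [h2]
  apply (algebraMap (ZMod p) (AlgebraicClosure (ZMod p))).injective
  rw [DD_map, map_zero, DD_eq_zero_iff m (cast_ne m p hp)]
  intro hn
  have := Multiset.nodup_of_le h1 hn
  simp [Multiset.replicate_succ] at this
lemma fibre_count (m p : ℕ) (hpp : p.Prime) (hp : m + 1 < p) (a : Fin m → ZMod p) :
    Set.ncard {t : ZMod p | (Fin.cons t a : Fin (m + 1) → ZMod p) ∈ SS (m + 1) 2 p} ≤ m := by
  classical
  have : Fact p.Prime := ⟨hpp⟩
  let φ := algebraMap (ZMod p) (AlgebraicClosure (ZMod p))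
  let W := ((g0 m fun i => φ (a i)).derivative.roots.map fun c => (g0 m fun i => φ (a i)).eval c)
  have hW : W.toFinset.card ≤ m := by
    refine (Multiset.toFinset_card_le _).trans ?_
    rw [Multiset.card_map]
    refine (card_roots' _).trans ?_
    rw [g0_deriv_natDegree m (cast_ne m p hp)]
  refine le_trans ?_ hW
  rw [← Set.ncard_coe_finset]
  refine Set.ncard_le_ncard_of_injOn (fun t => -φ t) ?_ ?_
  · intro t ht
    have := SS_closure m p hp t a ht
    simp only [Finset.mem_coe, Multiset.mem_toFinset]
    exact Multiset.mem_of_le this (by simp [φ])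
  · intro t _ s _ h
    exact φ.injective (neg_injective h)
lemma PS_count (m p : ℕ) (hm : 1 ≤ m) (hpp : p.Prime) : Set.ncard (PS m p) ≤ (m + 2) ^ (m + 1) * p ^ (m - 1) := by
  have : Fact p.Prime := ⟨hpp⟩
  refine le_trans ?_ (SS_count (m + 1) 2 p (by omega) hpp)
  have : PS m p ⊆ (fun v : Fin (m + 1) → ZMod p => Fin.tail v) '' SS (m + 1) 2 p := by
    rintro a ⟨t, ht⟩
    exact ⟨_, ht, by simp⟩
  exact (Set.ncard_le_ncard this (Set.toFinite _)).trans (Set.ncard_image_le (Set.toFinite _))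
noncomputable def DP (m : ℕ) : MvPolynomial (Fin m) ℤ := DD m MvPolynomial.X
lemma DP_eval (m : ℕ) (a : Fin m → ℤ) : MvPolynomial.eval a (DP m) = DD m a := by
  rw [DP, DD_map]; simp
lemma DP_ne_zero (m : ℕ) (hm : 1 ≤ m) : DP m ≠ 0 := by
  intro h0
  let a : Fin m → ℂ := fun i => if (i : ℕ) = 0 then -((m + 1 : ℕ) : ℂ) else 0
  have hm1 : ((m + 1 : ℕ) : ℂ) ≠ 0 := by exact_mod_cast Nat.succ_ne_zero m
  have h1 : DD m a = 0 := by
    have := DD_map m (MvPolynomial.eval₂Hom (Int.castRingHom ℂ) a) (MvPolynomial.X)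
    rw [← DP, h0, map_zero] at this
    rw [this]; simp
  rw [DD_eq_zero_iff m hm1] at h1
  apply h1
  have hg : g0 m a = X ^ (m + 1) - C ((m + 1 : ℕ) : ℂ) * X := by
    obtain ⟨n, rfl⟩ := Nat.exists_eq_add_of_le' hm
    simp [g0, poly, Fin.sum_univ_succ, a, sub_eq_add_neg]; ring
  have hg' : (g0 m a).derivative = C ((m + 1 : ℕ) : ℂ) * (X ^ m - 1) := by
    rw [hg]; simp; ring
  have hsep : ((X : ℂ[X]) ^ m - 1).Separable := X_pow_sub_one_separable_iff.mpr (by exact_mod_cast (by omega : m ≠ 0))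
  have hr : (g0 m a).derivative.roots = ((X : ℂ[X]) ^ m - 1).roots := by rw [hg', roots_C_mul _ hm1]
  refine Multiset.Nodup.map_on ?_ (by rw [hr]; exact nodup_roots hsep)
  intro x hx y hy hxy
  rw [hr, mem_roots hsep.ne_zero] at hx hy
  simp only [IsRoot.def, eval_sub, eval_pow, eval_X, eval_one] at hx hy
  rw [hg] at hxy
  simp only [eval_sub, eval_pow, eval_X, eval_mul, eval_C] at hxy
  have h2 : (m : ℂ) * (x - y) = 0 := by
    push_cast at hxy
    linear_combination -hxy + x * hx - y * hy
  have : (m : ℂ) ≠ 0 := by exact_mod_cast (by omega : m ≠ 0)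
  exact sub_eq_zero.mp ((mul_eq_zero.mp h2).resolve_left this)
end GAC
namespace GAC
open Polynomial NumberField
lemma mv_bound (m : ℕ) (P : MvPolynomial (Fin m) ℤ) :
    ∃ B : ℕ, ∀ N : ℕ, 2 ≤ N → ∀ a ∈ box m N, |MvPolynomial.eval a P| ≤ (N : ℤ) ^ (B + 1) := by
  induction P using MvPolynomial.induction_on with
  | C c =>
    refine ⟨c.natAbs, fun N hN a _ => ?_⟩
    rw [MvPolynomial.eval_C]
    have h1 : c.natAbs ≤ N ^ (c.natAbs + 1) :=
      (Nat.lt_pow_self (show 1 < N by omega)).le.trans (Nat.pow_le_pow_right (by omega) (by omega))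
    rw [Int.abs_eq_natAbs]
    exact_mod_cast h1
  | add p q hp hq =>
    obtain ⟨B, hB⟩ := hp
    obtain ⟨B', hB'⟩ := hq
    refine ⟨B + B' + 1, fun N hN a ha => ?_⟩
    have hN' : (2 : ℤ) ≤ N := by exact_mod_cast hN
    rw [map_add]
    refine (abs_add_le _ _).trans ?_
    have h1 : (N : ℤ) ^ (B + 1) ≤ N ^ (B + B' + 1) := pow_le_pow_right₀ (by omega) (by omega)
    have h2 : (N : ℤ) ^ (B' + 1) ≤ N ^ (B + B' + 1) := pow_le_pow_right₀ (by omega) (by omega)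
    have h3 : (0 : ℤ) < N ^ (B + B' + 1) := by positivity
    have := hB N hN a ha
    have := hB' N hN a ha
    rw [pow_succ _ (B + B' + 1)]
    nlinarith
  | mul_X p i hp =>
    obtain ⟨B, hB⟩ := hp
    refine ⟨B + 1, fun N hN a ha => ?_⟩
    rw [map_mul, MvPolynomial.eval_X, abs_mul, pow_succ _ (B + 1)]
    exact mul_le_mul (hB N hN a ha) (mem_box.mp ha i) (abs_nonneg _) (by positivity)
def C3P (d N : ℕ) (v : Fin d → ℤ) : Prop := ∃ C κ, RamP d v C κ ∧ N < C
open Classical in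
lemma zero_count (m N : ℕ) (hm : 1 ≤ m) :
    ((box m N).filter fun a => DD m a = 0).card * (2 * N + 1) ≤ (DP m).totalDegree * (2 * N + 1) ^ m := by
  have h := MvPolynomial.schwartz_zippel_totalDegree (DP_ne_zero m hm) (Finset.Icc (-(N : ℤ)) N)
  have hc : (Finset.Icc (-(N : ℤ)) N).card = 2 * N + 1 := by rw [Int.card_Icc]; omega
  simp only [DP_eval] at h
  rw [hc, div_le_div_iff₀ (by positivity) (by positivity)] at h
  have h' : ((box m N).filter fun a => DD m a = 0) =
      (Fintype.piFinset fun _ => Finset.Icc (-(N : ℤ)) N).filter fun a => DD m a = 0 := by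
    rw [box]
  rw [h']
  convert (by exact_mod_cast h : _ * (2 * N + 1) ≤ (DP m).totalDegree * (2 * N + 1) ^ m)
def PP (m : ℕ) (a : Fin m → ℤ) (e : ℕ) : Prop :=
  Squarefree e ∧ ∀ p ∈ e.primeFactors, m + 1 < p ∧ (fun i => (a i : ZMod p)) ∈ PS m p
lemma cons_cast (m p : ℕ) (t : ℤ) (a : Fin m → ℤ) :
    (fun i => (((Fin.cons t a : Fin (m + 1) → ℤ) i : ℤ) : ZMod p)) = Fin.cons (t : ZMod p) fun i => (a i : ZMod p) := by
  funext i
  refine Fin.cases ?_ (fun i => ?_) i <;> simp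
lemma SS_mono (d k k' p : ℕ) (h : k ≤ k') : SS d k' p ⊆ SS d k p := by
  rintro u ⟨R, hR, hd, hM⟩
  exact ⟨R, hR, by omega, hM⟩
lemma fib1 (m N C : ℕ) (a : Fin m → ℤ) (hC : Squarefree C) (hCN : N < C) (T : Finset ℤ)
    (hT : ∀ t ∈ T, |t| ≤ N ∧ ∀ p ∈ C.primeFactors, m + 1 < p ∧
      (Fin.cons (t : ZMod p) fun i => (a i : ZMod p)) ∈ SS (m + 1) 2 p) :
    T.card ≤ 2 * m ^ C.primeFactors.card := by
  classical
  rcases T.eq_empty_or_nonempty with rfl | ⟨t0, ht0⟩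
  · simp
  let Z : ∀ p : ℕ, Finset (Fin 1 → ZMod p) := fun p =>
    toF {u | (Fin.cons (u 0) fun i => (a i : ZMod p)) ∈ SS (m + 1) 2 p}
  let S : Finset (Fin 1 → ℤ) := T.image fun t _ => t
  have hS : S.card = T.card := Finset.card_image_of_injective _ fun x y h => congrFun h 0
  have h := box_sieve N C hC Z S (by
    intro v hv i
    obtain ⟨t, ht, rfl⟩ := Finset.mem_image.mp hv
    exact (hT t ht).1) (by
    intro v hv p hp
    obtain ⟨t, ht, rfl⟩ := Finset.mem_image.mp hv
    have : Fact p.Prime := ⟨Nat.prime_of_mem_primeFactors hp⟩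
    exact (mem_toF (Set.toFinite _)).mpr ((hT t ht).2 p hp).2)
  rw [hS, Fintype.card_fin, pow_one] at h
  refine h.trans (Nat.mul_le_mul ?_ ?_)
  · have : 2 * N / C ≤ 1 := by
      rw [← Nat.lt_succ_iff, Nat.div_lt_iff_lt_mul (by omega)]; simp only [Nat.succ_eq_add_one]; omega
    omega
  · refine Finset.prod_le_pow_card _ _ _ fun p hp => ?_
    have hpp := Nat.prime_of_mem_primeFactors hp
    have : Fact p.Prime := ⟨hpp⟩
    simp only [Z]
    rw [card_toF]
    refine le_trans ?_ (fibre_count m p hpp ((hT t0 ht0).2 p hp).1 fun i => (a i : ZMod p))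
    refine Set.ncard_le_ncard_of_injOn (fun u => u 0) (fun u hu => hu) ?_ (Set.toFinite _)
    intro u _ w _ h
    funext i
    rw [Subsingleton.elim i 0]; exact h
open Classical in
lemma fib2 (m B N : ℕ) (hm : 1 ≤ m) (hN : 2 ≤ N) (a : Fin m → ℤ) (h0 : DD m a ≠ 0)
    (hB : |DD m a| ≤ (N : ℤ) ^ (B + 1)) :
    ((Finset.Icc (-(N : ℤ)) N).filter fun t => C3P (m + 1) N (Fin.cons t a)).card ≤
      2 * (2 * m) ^ (B + 1) * ∑ e ∈ (Finset.Icc 1 N).filter (PP m a), ((2 * m) ^ (B + 1)) ^ e.primeFactors.card := by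
  set Pr := (DD m a).natAbs.primeFactors.filter fun p => m + 1 < p ∧ (fun i => (a i : ZMod p)) ∈ PS m p with hPr
  have hpr : ∀ p ∈ Pr, p.Prime := fun p hp => Nat.prime_of_mem_primeFactors (Finset.mem_filter.mp hp).1
  set Q := ∏ p ∈ Pr, p with hQ
  have hQp : Q.primeFactors = Pr := Nat.primeFactors_prod hpr
  have hsqf : ∀ s ⊆ Pr, Squarefree (∏ p ∈ s, p) := fun s hs =>
    Finset.squarefree_prod_of_pairwise_isCoprime (fun p hp q hq hpq =>
      Nat.coprime_iff_isRelPrime.mp ((Nat.coprime_primes (hpr p (hs hp)) (hpr q (hs hq))).mpr hpq))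
      fun p hp => (hpr p (hs hp)).prime.squarefree
  have hQN : Q ≤ N ^ (B + 1) := by
    have h1 : Q ∣ (DD m a).natAbs := Finset.prod_primes_dvd _ (fun p hp => (hpr p hp).prime) fun p hp =>
      Nat.dvd_of_mem_primeFactors (Finset.mem_filter.mp hp).1
    have h2 := Nat.le_of_dvd (Int.natAbs_pos.mpr h0) h1
    rw [Int.abs_eq_natAbs] at hB
    exact h2.trans (by exact_mod_cast hB)
  obtain ⟨e, heQ, heB, hec⟩ := landreau' (2 * m) B Q (by omega) (hsqf Pr subset_rfl)
  have he0 : e ≠ 0 := fun h => (hsqf Pr subset_rfl).ne_zero (by rw [h] at heQ; exact Nat.eq_zero_of_zero_dvd heQ)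
  have heN : e ≤ N := (Nat.pow_le_pow_iff_left (Nat.succ_ne_zero B)).mp (heB.trans hQN)
  have hPe : PP m a e := by
    refine ⟨(hsqf Pr subset_rfl).squarefree_of_dvd heQ, fun p hp => ?_⟩
    have := Nat.primeFactors_mono heQ (hsqf Pr subset_rfl).ne_zero hp
    rw [hQp] at this
    exact (Finset.mem_filter.mp this).2
  let U : Finset ℕ → Finset ℤ := fun s => (Finset.Icc (-(N : ℤ)) N).filter fun t => N < ∏ p ∈ s, p ∧ ∀ p ∈ s, m + 1 < p ∧
      (Fin.cons (t : ZMod p) fun i => (a i : ZMod p)) ∈ SS (m + 1) 2 p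
  have hsub : ((Finset.Icc (-(N : ℤ)) N).filter fun t => C3P (m + 1) N (Fin.cons t a)) ⊆
      Pr.powerset.biUnion U := by
    intro t ht
    obtain ⟨ht, C, κ, ⟨hC, hκ, hp⟩, hCN⟩ := Finset.mem_filter.mp ht
    have hκ' := (Finset.mem_finsupp_iff.mp hκ).2
    have hss : ∀ p ∈ C.primeFactors, (Fin.cons (t : ZMod p) fun i => (a i : ZMod p)) ∈ SS (m + 1) 2 p := by
      intro p hp'
      have := (hp p hp').2
      rw [cons_cast] at this
      exact SS_mono _ _ _ _ (Finset.mem_Icc.mp (hκ' p hp')).1 this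
    refine Finset.mem_biUnion.mpr ⟨C.primeFactors, Finset.mem_powerset.mpr fun p hp' => ?_,
      Finset.mem_filter.mpr ⟨ht, ?_, fun p hp' => ⟨(hp p hp').1, hss p hp'⟩⟩⟩
    · have hpp := Nat.prime_of_mem_primeFactors hp'
      have hPS : (fun i => (a i : ZMod p)) ∈ PS m p := ⟨_, hss p hp'⟩
      refine Finset.mem_filter.mpr ⟨?_, (hp p hp').1, hPS⟩
      rw [Nat.mem_primeFactors]
      exact ⟨hpp, Int.natCast_dvd.mp (PS_dvd m p hpp (hp p hp').1 a hPS), by simpa using h0⟩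
    · rw [Nat.prod_primeFactors_of_squarefree hC]; exact hCN
  have hU : ∀ s ∈ Pr.powerset, (U s).card ≤ 2 * m ^ Pr.card := by
    intro s hs
    rw [Finset.mem_powerset] at hs
    rcases (U s).eq_empty_or_nonempty with he | ⟨t0, ht0⟩
    · rw [he]; simp
    have hsp : (∏ p ∈ s, p).primeFactors = s := Nat.primeFactors_prod fun p hp => hpr p (hs hp)
    have := fib1 m N (∏ p ∈ s, p) a (hsqf s hs) (Finset.mem_filter.mp ht0).2.1 (U s) (by
      intro t ht
      obtain ⟨h1, -, h2⟩ := Finset.mem_filter.mp ht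
      rw [hsp]
      exact ⟨abs_le.mpr (Finset.mem_Icc.mp h1), h2⟩)
    rw [hsp] at this
    exact this.trans (Nat.mul_le_mul_left _ (Nat.pow_le_pow_right hm (Finset.card_le_card hs)))
  calc _ ≤ (Pr.powerset.biUnion U).card := Finset.card_le_card hsub
    _ ≤ Pr.powerset.card * (2 * m ^ Pr.card) := Finset.card_biUnion_le_card_mul _ _ _ hU
    _ = 2 * (2 * m) ^ Q.primeFactors.card := by rw [Finset.card_powerset, hQp, mul_pow]; ring
    _ ≤ 2 * ((2 * m) ^ (B + 1) * ((2 * m) ^ (B + 1)) ^ e.primeFactors.card) := Nat.mul_le_mul_left _ hec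
    _ ≤ _ := by
      rw [← mul_assoc]
      refine Nat.mul_le_mul_left _ ?_
      exact Finset.single_le_sum (f := fun e : ℕ => ((2 * m) ^ (B + 1)) ^ e.primeFactors.card)
        (fun _ _ => Nat.zero_le _) (Finset.mem_filter.mpr ⟨Finset.mem_Icc.mpr ⟨Nat.pos_of_ne_zero he0, heN⟩, hPe⟩)
open Classical in
lemma fib3 (m N e : ℕ) (hm : 1 ≤ m) (he1 : 1 ≤ e) (heN : e ≤ N) :
    (((box m N).filter fun a => PP m a e).card : ℝ) ≤ (3 * N) ^ m * ((m + 2 : ℝ) ^ (m + 1)) ^ e.primeFactors.card / e := by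
  have hC0' : (0 : ℝ) < e := by exact_mod_cast he1
  rcases ((box m N).filter fun a => PP m a e).eq_empty_or_nonempty with h0 | ⟨a0, ha0⟩
  · rw [h0]; simp only [Finset.card_empty, Nat.cast_zero]; positivity
  have hC := (Finset.mem_filter.mp ha0).2.1
  have h1 := box_sieve N e hC (fun p => toF (PS m p)) ((box m N).filter fun a => PP m a e)
    (fun v hv => mem_box.mp (Finset.mem_filter.mp hv).1) (by
    intro v hv p hp
    have : Fact p.Prime := ⟨Nat.prime_of_mem_primeFactors hp⟩
    exact (mem_toF (Set.toFinite _)).mpr ((Finset.mem_filter.mp hv).2.2 p hp).2)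
  have h2 : ((2 * N / e + 1 : ℕ) : ℝ) ≤ 3 * N / e := by
    push_cast
    have h3 : ((2 * N / e : ℕ) : ℝ) ≤ 2 * N / e := by
      have := @Nat.cast_div_le ℝ _ _ _ (2 * N) e
      push_cast at this; exact this
    have h4 : (1 : ℝ) ≤ N / e := by rw [le_div_iff₀ hC0']; simpa using (by exact_mod_cast heN : (e : ℝ) ≤ N)
    calc _ ≤ (2 * N / e : ℝ) + N / e := add_le_add h3 h4
      _ = _ := by ring
  have h5 : ∏ p ∈ e.primeFactors, (toF (PS m p)).card ≤ ((m + 2) ^ (m + 1)) ^ e.primeFactors.card * e ^ (m - 1) := by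
    calc _ ≤ ∏ p ∈ e.primeFactors, ((m + 2) ^ (m + 1) * p ^ (m - 1)) := by
          refine Finset.prod_le_prod' fun p hp => ?_
          rw [card_toF]
          exact PS_count m p hm (Nat.prime_of_mem_primeFactors hp)
      _ = _ := by
        rw [Finset.prod_mul_distrib, Finset.prod_const, Finset.prod_pow, Nat.prod_primeFactors_of_squarefree hC]
  rw [Fintype.card_fin] at h1
  calc _ ≤ ((2 * N / e + 1 : ℕ) : ℝ) ^ m * ((((m + 2) ^ (m + 1)) ^ e.primeFactors.card * e ^ (m - 1) : ℕ) : ℝ) := by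
        exact_mod_cast h1.trans (Nat.mul_le_mul_left _ h5)
    _ ≤ (3 * N / e) ^ m * ((((m + 2) ^ (m + 1)) ^ e.primeFactors.card * e ^ (m - 1) : ℕ) : ℝ) :=
        mul_le_mul_of_nonneg_right (pow_le_pow_left₀ (Nat.cast_nonneg _) h2 _) (Nat.cast_nonneg _)
    _ = _ := by
        push_cast
        rw [div_pow]
        generalize ((m + 2 : ℝ) ^ (m + 1)) ^ e.primeFactors.card = Q'
        obtain ⟨n, rfl⟩ := Nat.exists_eq_add_of_le' hm
        rw [Nat.add_sub_cancel, pow_succ (e : ℝ)]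
        field_simp
open Classical in
lemma c3_count (m : ℕ) (hm : 1 ≤ m) : PB m (fun N => (((box (m + 1) N).filter (C3P (m + 1) N)).card : ℝ)) := by
  obtain ⟨B, hB⟩ := mv_bound m (DP m)
  let c : ℕ := (2 * m) ^ (B + 1)
  let A : ℕ := c * (m + 2) ^ (m + 1)
  have k1 := (PB.npow m).cmul ((DP m).totalDegree * 3 ^ m : ℝ) (by positivity)
  have k2 := ((omega_sum A).mul (PB.npow m) (fun N => by positivity)).cmul ((2 * c * 3 ^ m : ℝ)) (by positivity)
  rw [zero_add] at k2
  refine (k1.add k2).mono fun N hN => ?_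
  let T : (Fin m → ℤ) → Finset ℤ := fun a => (Finset.Icc (-(N : ℤ)) N).filter fun t => C3P (m + 1) N (Fin.cons t a)
  have h1 : ((box (m + 1) N).filter (C3P (m + 1) N)).card ≤ ∑ a ∈ box m N, (T a).card := by
    rw [← Finset.card_sigma]
    refine Finset.card_le_card_of_injOn (fun v => ⟨Fin.tail v, v 0⟩) ?_ ?_
    · intro v hv
      obtain ⟨h1, h2⟩ := Finset.mem_filter.mp hv
      have h1 := mem_box.mp h1
      simp only [Finset.coe_sigma, Set.mem_sigma_iff, Finset.mem_coe]
      refine ⟨mem_box.mpr fun i => h1 _, Finset.mem_filter.mpr ⟨Finset.mem_Icc.mpr (abs_le.mp (h1 0)), ?_⟩⟩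
      rw [Fin.cons_self_tail]; exact h2
    · intro v _ w _ h
      simp only [Sigma.mk.injEq, heq_eq_eq] at h
      rw [← Fin.cons_self_tail v, ← Fin.cons_self_tail w, h.1, h.2]
  rw [← Finset.sum_filter_add_sum_filter_not _ (fun a => DD m a = 0)] at h1
  have h2 : ∑ a ∈ (box m N).filter (fun a => DD m a = 0), (T a).card ≤ (DP m).totalDegree * (2 * N + 1) ^ m := by
    refine (Finset.sum_le_card_nsmul _ _ (2 * N + 1) fun a _ => ?_).trans (by
      rw [smul_eq_mul]; exact zero_count m N hm)
    refine (Finset.card_filter_le _ _).trans ?_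
    rw [Int.card_Icc]; omega
  have h3 : ∑ a ∈ (box m N).filter (fun a => ¬ DD m a = 0), (T a).card ≤
      2 * c * ∑ e ∈ Finset.Icc 1 N, ((box m N).filter fun a => PP m a e).card * c ^ e.primeFactors.card := by
    calc _ ≤ ∑ a ∈ (box m N).filter (fun a => ¬ DD m a = 0), 2 * c * ∑ e ∈ (Finset.Icc 1 N).filter (PP m a), c ^ e.primeFactors.card := by
          refine Finset.sum_le_sum fun a ha => ?_
          obtain ⟨ha, h0⟩ := Finset.mem_filter.mp ha
          have := hB N hN a ha
          rw [DP_eval] at this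
          exact fib2 m B N hm hN a h0 this
      _ ≤ ∑ a ∈ box m N, 2 * c * ∑ e ∈ (Finset.Icc 1 N).filter (PP m a), c ^ e.primeFactors.card :=
          Finset.sum_le_sum_of_subset (Finset.filter_subset _ _)
      _ = _ := by
          rw [← Finset.mul_sum]
          simp only [Finset.sum_filter]
          rw [Finset.sum_comm]
          simp only [← Finset.sum_filter, Finset.sum_const, smul_eq_mul]
  have h2' : ((DP m).totalDegree * (2 * N + 1) ^ m : ℝ) ≤ (DP m).totalDegree * 3 ^ m * (N : ℝ) ^ m := by
    have : (1 : ℝ) ≤ N := by exact_mod_cast (by omega : 1 ≤ N)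
    rw [mul_assoc, ← mul_pow]
    gcongr
    linarith
  have h3' : (2 * c * ∑ e ∈ Finset.Icc 1 N, (((box m N).filter fun a => PP m a e).card : ℝ) * c ^ e.primeFactors.card : ℝ) ≤
      2 * c * 3 ^ m * ((∑ n ∈ Finset.Icc 1 N, (A : ℝ) ^ n.primeFactors.card / n) * (N : ℝ) ^ m) := by
    rw [mul_assoc (2 * c : ℝ)]
    refine mul_le_mul_of_nonneg_left ?_ (by positivity)
    rw [Finset.sum_mul, Finset.mul_sum]
    refine Finset.sum_le_sum fun e he => ?_
    rw [Finset.mem_Icc] at he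
    refine (mul_le_mul_of_nonneg_right (fib3 m N e hm he.1 he.2) (by positivity)).trans (le_of_eq ?_)
    simp only [A]
    push_cast
    rw [mul_pow, mul_pow]; ring
  calc _ ≤ ((DP m).totalDegree * (2 * N + 1) ^ m : ℝ) + (2 * c * ∑ e ∈ Finset.Icc 1 N, (((box m N).filter fun a => PP m a e).card : ℝ) * c ^ e.primeFactors.card : ℝ) := by
        exact_mod_cast h1.trans (add_le_add h2 h3)
    _ ≤ _ := add_le_add h2' h3'
end GAC
namespace GAC
open Polynomial NumberField NumberField.InfinitePlace NumberField.mixedEmbedding Module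
open scoped NNReal ENNReal
variable {K : Type*} [Field K] [NumberField K]
lemma mink_le : minkowskiBound K 1 ≤ (2 ^ finrank ℚ K * NNReal.sqrt ‖discr K‖₊ : ℝ≥0) := by
  rw [minkowskiBound, volume_fundamentalDomain_fractionalIdealLatticeBasis,
    volume_fundamentalDomain_latticeBasis, mixedEmbedding.finrank]
  simp only [Units.val_one, FractionalIdeal.absNorm_one, Rat.cast_one, ENNReal.ofReal_one, one_mul]
  push_cast
  rw [mul_comm]
  gcongr
  exact mul_le_of_le_one_left zero_le (pow_le_one₀ zero_le (by simp))
open Classical in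
lemma prod_adj (w₀ : InfinitePlace K) (c B : ℝ≥0) (k : ℕ) (hk : c ^ w₀.mult * B ^ (finrank ℚ K - w₀.mult) = B ^ k) :
    ∏ w : InfinitePlace K, (if w = w₀ then c else B) ^ w.mult = B ^ k := by
  rw [← hk, ← Finset.mul_prod_erase _ _ (Finset.mem_univ w₀)]
  congr 1
  · simp
  · rw [Finset.prod_congr rfl (g := fun w => B ^ w.mult) (fun w hw => by rw [if_neg (Finset.ne_of_mem_erase hw)]),
      Finset.prod_pow_eq_pow_sum]
    congr 1
    rw [← sum_mult_eq, ← Finset.add_sum_erase _ _ (Finset.mem_univ w₀)]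
    omega
lemma minkowski_elt (B : ℝ≥0) (hB : 1 ≤ B) (h : 2 ^ finrank ℚ K * NNReal.sqrt ‖discr K‖₊ < B ^ (finrank ℚ K - 1)) :
    ∃ b : K, IsIntegral ℤ b ∧ (∀ n : ℤ, b ≠ n) ∧ ∀ w : InfinitePlace K, w b ≤ 2 * B := by
  classical
  obtain ⟨w₀⟩ : Nonempty (InfinitePlace K) := inferInstance
  have hfin : finrank ℚ K = ∑ w : InfinitePlace K, w.mult := (sum_mult_eq).symm
  rcases isReal_or_isComplex w₀ with hw | hw
  · have hm : w₀.mult = 1 := by simp [mult, hw]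
    have hv : minkowskiBound K ↑1 < MeasureTheory.volume (convexBodyLT K (fun w ↦ if w = w₀ then 1 else B)) := by
      rw [convexBodyLT_volume, prod_adj w₀ 1 B (finrank ℚ K - 1) (by rw [hm]; simp)]
      refine mink_le.trans_lt ((ENNReal.coe_lt_coe.2 h).trans_le ?_)
      rw [← ENNReal.coe_mul, ENNReal.coe_le_coe]
      exact le_mul_of_one_le_left (by positivity) (one_le_convexBodyLTFactor K)
    obtain ⟨a, h0, ha⟩ := exists_ne_zero_mem_ringOfIntegers_lt K hv
    refine ⟨a, a.isIntegral_coe, fun n hn => ?_, fun w => (ha w).le.trans ?_⟩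
    · have h1 := ha w₀
      have hn0 : n ≠ 0 := fun hh => h0 (by apply RingOfIntegers.ext; simpa [hh] using hn)
      rw [hn] at h1
      have h2 : w₀ ((n : ℤ) : K) = |(n : ℝ)| := by
        rw [← norm_embedding_eq]; simp
      rw [h2] at h1
      simp only [if_true, NNReal.coe_one] at h1
      have : (1:ℝ) ≤ |(n:ℝ)| := by exact_mod_cast Int.one_le_abs hn0
      linarith
    · have : (1:ℝ) ≤ B := hB
      split_ifs
      · push_cast; linarith
      · linarith
  · have hm : w₀.mult = 2 := by simp [mult, not_isReal_iff_isComplex.mpr hw]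
    have h2 : 2 ≤ finrank ℚ K := by
      rw [hfin, ← hm]; exact Finset.single_le_sum (f := fun w : InfinitePlace K => w.mult) (fun _ _ => Nat.zero_le _) (Finset.mem_univ w₀)
    have hv : minkowskiBound K ↑1 < MeasureTheory.volume (convexBodyLT' K (fun w ↦ if w = w₀ then NNReal.sqrt B else B) ⟨w₀, hw⟩) := by
      rw [convexBodyLT'_volume, prod_adj w₀ (NNReal.sqrt B) B (finrank ℚ K - 1) (by
        rw [hm, NNReal.sq_sqrt, ← pow_succ']; congr 1; omega)]
      refine mink_le.trans_lt ((ENNReal.coe_lt_coe.2 h).trans_le ?_)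
      rw [← ENNReal.coe_mul, ENNReal.coe_le_coe]
      exact le_mul_of_one_le_left (by positivity) (one_le_convexBodyLT'Factor K)
    obtain ⟨a, h0, ha, hre, him⟩ := exists_ne_zero_mem_ringOfIntegers_lt' K ⟨w₀, hw⟩ hv
    simp only [if_true, ← NNReal.coe_pow, NNReal.sq_sqrt] at him
    refine ⟨a, a.isIntegral_coe, fun n hn => ?_, fun w => ?_⟩
    · have hn0 : n ≠ 0 := fun hh => h0 (by apply RingOfIntegers.ext; simpa [hh] using hn)
      rw [hn] at hre
      simp only [map_intCast, Complex.intCast_re] at hre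
      have : (1:ℝ) ≤ |(n:ℝ)| := by exact_mod_cast Int.one_le_abs hn0
      linarith
    · have h1 : (1:ℝ) ≤ B := hB
      by_cases hww : w = w₀
      · rw [hww, ← norm_embedding_eq]
        refine (Complex.norm_le_abs_re_add_abs_im _).trans ?_
        linarith
      · have := ha w hww
        rw [if_neg hww] at this
        linarith
end GAC
namespace GAC
open Polynomial NumberField NumberField.InfinitePlace Module
open scoped NNReal
lemma rat_int {K : Type*} [Field K] [NumberField K] (b : K) (hb : IsIntegral ℤ b) (q : ℚ) (h : b = algebraMap ℚ K q) :
    ∃ n : ℤ, b = n := by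
  rw [h, isIntegral_algebraMap_iff (algebraMap ℚ K).injective] at hb
  obtain ⟨n, rfl⟩ := IsIntegrallyClosed.isIntegral_iff.1 hb
  exact ⟨n, by rw [h]; simp⟩
lemma gens {d : ℕ} {v : Fin d → ℤ} {K : Type} [Field K] [NumberField K] {a : K} (h : SqP d v K a)
    (hi : ¬ ImpP d v) (b : K) (hb : IsIntegral ℤ b) (hn : ∀ n : ℤ, b ≠ n) : (minpoly ℤ b).natDegree = d := by
  obtain ⟨h1, h2, h3, -⟩ := h
  rw [natDegree_minpolyZ b hb, ← IntermediateField.adjoin.finrank hb.tower_top]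
  set L := IntermediateField.adjoin ℚ {b}
  have hm := finrank_mul_finrank ℚ L K
  have hL : 2 ≤ finrank ℚ L := by
    by_contra hc
    have hp : 0 < finrank ℚ L := finrank_pos
    have : finrank ℚ L = 1 := by omega
    rw [IntermediateField.finrank_adjoin_simple_eq_one_iff, IntermediateField.mem_bot] at this
    obtain ⟨q, hq⟩ := this
    obtain ⟨n, hn'⟩ := rat_int b hb q hq.symm
    exact hn n hn'
  have hK : ¬ 2 ≤ finrank L K := fun hc => hi ⟨K, L, inferInstance, inferInstance, inferInstance, inferInstance,
    inferInstance, a, h1, h2, h3, hL, hc⟩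
  have hp : 0 < finrank L K := finrank_pos
  have : finrank L K = 1 := by omega
  rw [this, h3, mul_one] at hm
  exact hm
lemma trace_zero {K : Type*} [Field K] [NumberField K] (b : K) (hb : IsIntegral ℤ b) (hn : ∀ n : ℤ, b ≠ n)
    (A : ℝ) (hA : ∀ w : InfinitePlace K, w b ≤ A) :
    ∃ b' : K, IsIntegral ℤ b' ∧ (∀ n : ℤ, b' ≠ n) ∧ (∀ w : InfinitePlace K, w b' ≤ 2 * finrank ℚ K * A) ∧
      (minpoly ℤ b').nextCoeff = 0 := by
  obtain ⟨t, ht⟩ := IsIntegrallyClosed.isIntegral_iff.1 (Algebra.isIntegral_trace (L := ℚ) hb)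
  set d := finrank ℚ K with hd
  have hd0 : (d : K) ≠ 0 := by
    have : 0 < d := finrank_pos
    exact_mod_cast this.ne'
  have hi : IsIntegral ℤ ((d : K) * b - t) := by
    have := ((isIntegral_algebraMap (R := ℤ) (x := (d : ℤ))).mul hb).sub (isIntegral_algebraMap (R := ℤ) (x := t))
    simpa using this
  refine ⟨d * b - t, hi, fun n h => ?_, fun w => ?_, ?_⟩
  · obtain ⟨m, hm⟩ := rat_int b hb (((n + t : ℤ) : ℚ) / d) (by
      rw [map_div₀, map_intCast, map_natCast, eq_div_iff hd0]; push_cast; rw [← h]; ring)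
    exact hn m hm
  · have h1 := trace_eq_sum_embeddings ℂ (K := ℚ) (x := b)
    rw [← ht] at h1
    have h2 : |(t : ℝ)| ≤ d * A := by
      have : ‖((t : ℤ) : ℂ)‖ ≤ ∑ σ : K →ₐ[ℚ] ℂ, A := by
        have h3 : ((t : ℤ) : ℂ) = ∑ σ : K →ₐ[ℚ] ℂ, σ b := by rw [← h1]; simp
        rw [h3]
        exact norm_sum_le_of_le _ fun σ _ => hA (InfinitePlace.mk σ.toRingHom)
      rw [Finset.sum_const, Finset.card_univ, AlgHom.card, Complex.norm_intCast, nsmul_eq_mul] at this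
      exact this
    have h3 : w ((d : K) * b - t) ≤ w ((d : K) * b) + w ((t : K)) := by
      rw [← norm_embedding_eq, ← norm_embedding_eq, ← norm_embedding_eq, map_sub]
      exact norm_sub_le _ _
    have h4 : w (t : K) = |(t : ℝ)| := by rw [← norm_embedding_eq]; simp
    have h5 : w ((d : K) * b) = d * w b := by rw [map_mul]; congr 1; rw [← norm_embedding_eq]; simp
    rw [h4, h5] at h3
    nlinarith [hA w, mul_le_mul_of_nonneg_left (hA w) (Nat.cast_nonneg (α := ℝ) d)]
  · have h1 := trace_eq_finrank_mul_minpoly_nextCoeff ℚ ((d : K) * b - t)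
    have h2 : Algebra.trace ℚ K ((d : K) * b - t) = 0 := by
      have e : (d : K) * b - t = (d : ℚ) • b - algebraMap ℚ K t := by
        rw [Algebra.smul_def]; simp
      rw [e, map_sub, map_smul, ← ht, Algebra.trace_algebraMap]
      simp [d]
    rw [h2, ← minpolyZ_map _ hi, nextCoeff_map (Int.castRingHom ℚ).injective_int] at h1
    have h3 : (finrank (IntermediateField.adjoin ℚ {(d : K) * b - t}) K : ℚ) ≠ 0 := by
      exact_mod_cast (finrank_pos (R := IntermediateField.adjoin ℚ {(d : K) * b - t}) (M := K)).ne'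
    have h4 := (mul_eq_zero.1 h1.symm).resolve_left h3
    simpa using h4
def C0 (d : ℕ) : ℕ := (d + 1) ^ (d * d * (d + 1))
def c2 (d : ℕ) : ℕ := 4 * d * (2 ^ d * C0 d + 1)
lemma exists_tz {K : Type*} [Field K] [NumberField K] (N : ℕ) (hN : 1 ≤ N) (hd : 2 ≤ finrank ℚ K)
    (hD : (discr K).natAbs ≤ C0 (finrank ℚ K) * N ^ 2) :
    ∃ b : K, IsIntegral ℤ b ∧ (∀ n : ℤ, b ≠ n) ∧ (minpoly ℤ b).nextCoeff = 0 ∧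
      ∀ w : InfinitePlace K, w b ≤ c2 (finrank ℚ K) * (N : ℝ) ^ (1 / ((finrank ℚ K : ℝ) - 1)) := by
  set d := finrank ℚ K with hdd
  set R : ℝ≥0 := (N : ℝ≥0) ^ (1 / ((d : ℝ) - 1)) with hR
  have hd1 : (0:ℝ) < (d : ℝ) - 1 := by have : (2:ℝ) ≤ d := by exact_mod_cast hd
                                       linarith
  have hR1 : 1 ≤ R := NNReal.one_le_rpow (by exact_mod_cast hN) (by positivity)
  have hRp : R ^ (d - 1) = N := by
    rw [hR, ← NNReal.rpow_natCast, ← NNReal.rpow_mul]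
    have : ((d - 1 : ℕ) : ℝ) = (d : ℝ) - 1 := by rw [Nat.cast_sub (by omega)]; simp
    rw [this, one_div_mul_cancel hd1.ne', NNReal.rpow_one]
  set E : ℝ≥0 := 2 ^ d * C0 d + 1 with hE
  have hE1 : 1 ≤ E := by rw [hE]; exact le_add_self
  have h1 : 2 ^ d * NNReal.sqrt ‖discr K‖₊ < (E * R) ^ (d - 1) := by
    rw [mul_pow, hRp]
    have hs : NNReal.sqrt ‖discr K‖₊ ≤ C0 d * N := by
      rw [NNReal.sqrt_le_iff_le_sq]
      have : (‖discr K‖₊ : ℝ≥0) = ((discr K).natAbs : ℝ≥0) := by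
        rw [← NNReal.coe_inj]; simp [Int.norm_eq_abs]
      rw [this]
      calc (((discr K).natAbs : ℕ) : ℝ≥0) ≤ ((C0 d * N ^ 2 : ℕ) : ℝ≥0) := by exact_mod_cast hD
        _ ≤ ((C0 d ^ 2 * N ^ 2 : ℕ) : ℝ≥0) := by
          have : C0 d ≤ C0 d ^ 2 := Nat.le_self_pow (by norm_num) _
          exact_mod_cast Nat.mul_le_mul_right _ this
        _ = _ := by push_cast; ring
    have hNp : (0 : ℝ≥0) < N := by exact_mod_cast hN
    calc 2 ^ d * NNReal.sqrt ‖discr K‖₊ ≤ 2 ^ d * (C0 d * N) := by gcongr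
      _ = (2 ^ d * C0 d) * N := by ring
      _ < E * N := by
        gcongr; rw [hE]; exact lt_add_one _
      _ ≤ _ := by gcongr; exact le_self_pow₀ hE1 (by omega)
  obtain ⟨b, hb, hbn, hw⟩ := minkowski_elt (E * R) (one_le_mul hE1 hR1) h1
  obtain ⟨b', h2, h3, h4, h5⟩ := trace_zero b hb hbn _ hw
  refine ⟨b', h2, h3, h5, fun w => (h4 w).trans (le_of_eq ?_)⟩
  rw [hE, hR, c2]
  push_cast
  ring
end GAC
namespace GAC
open Polynomial NumberField Module
def Gen (d : ℕ) (u : Fin d → ℤ) (X : ℝ) (v : Fin d → ℤ) : Prop :=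
  ∃ (K : Type) (_ : Field K) (_ : NumberField K) (a b : K), SqP d v K a ∧ IsIntegral ℤ b ∧
    minpoly ℤ b = poly d u ∧ ∀ b' : K, IsIntegral ℤ b' → ht b' ≤ X → ∃ n : ℤ, b' = n
lemma Gen.count (d N : ℕ) (hN : 1 ≤ N) (u : Fin d → ℤ) (X F : ℝ) (hF0 : 0 ≤ F)
    (hF : ∀ (K : Type) [Field K] [NumberField K] (T : Finset K), finrank ℚ K = d →
      (∀ b' : K, IsIntegral ℤ b' → ht b' ≤ X → ∃ n : ℤ, b' = n) →
      (∀ t ∈ T, IsIntegral ℤ t) → (∀ t ∈ T, ht t ≤ (d + 1 : ℕ) * N) → (T.card : ℝ) ≤ F)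
    (S : Finset (Fin d → ℤ)) (hS : ∀ v ∈ S, v ∈ box d N ∧ Gen d u X v) : (S.card : ℝ) ≤ F := by
  classical
  rcases S.eq_empty_or_nonempty with rfl | ⟨v0, hv0⟩
  · simpa using hF0
  obtain ⟨-, K, _, _, a0, b, ⟨h1, h2, h3, h4⟩, h5, h6, h7⟩ := hS v0 hv0
  have key : ∀ v ∈ S, ∃ a : K, IsIntegral ℤ a ∧ minpoly ℤ a = poly d v := by
    intro v hv
    obtain ⟨-, K', _, _, a', b', ⟨h1', h2', h3', h4'⟩, h5', h6', h7'⟩ := hS v hv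
    obtain ⟨e, -⟩ := gen_equiv b' b h5' h5 (by rw [h6', poly_natDegree, h3']) (by rw [h6, poly_natDegree, h3])
      (h6'.trans h6.symm)
    have hi : IsIntegral ℤ (e a') := h1'.map (e.toRingEquiv : K' →+* K).toIntAlgHom
    refine ⟨e a', hi, ?_⟩
    rw [← h2']
    apply Polynomial.map_injective (Int.castRingHom ℚ) (Int.castRingHom ℚ).injective_int
    rw [minpolyZ_map _ hi, minpolyZ_map _ h1', minpoly.algEquiv_eq]
  choose! α ha hm using key
  have hinj : Set.InjOn α S := fun v hv w hw h => poly_inj d (by rw [← hm v hv, ← hm w hw, h])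
  rw [← Finset.card_image_of_injOn hinj]
  refine hF K _ h3 h7 ?_ ?_
  · intro t ht
    obtain ⟨v, hv, rfl⟩ := Finset.mem_image.1 ht
    exact ha v hv
  · intro t ht
    obtain ⟨v, hv, rfl⟩ := Finset.mem_image.1 ht
    rw [← MM_minpoly _ (ha v hv) (by rw [hm v hv, poly_natDegree, h3]), hm v hv]
    have := MM_poly_le hN (hS v hv).1
    push_cast
    exact this
lemma Gen.total (d N : ℕ) (hN : 1 ≤ N) (U : Finset (Fin d → ℤ)) (X F : ℝ) (hF0 : 0 ≤ F)
    (hF : ∀ (K : Type) [Field K] [NumberField K] (T : Finset K), finrank ℚ K = d →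
      (∀ b' : K, IsIntegral ℤ b' → ht b' ≤ X → ∃ n : ℤ, b' = n) →
      (∀ t ∈ T, IsIntegral ℤ t) → (∀ t ∈ T, ht t ≤ (d + 1 : ℕ) * N) → (T.card : ℝ) ≤ F)
    (S : Finset (Fin d → ℤ)) (hS : ∀ v ∈ S, v ∈ box d N ∧ ∃ u ∈ U, Gen d u X v) :
    (S.card : ℝ) ≤ U.card * F := by
  classical
  have : S ⊆ U.biUnion fun u => S.filter fun v => Gen d u X v := by
    intro v hv
    obtain ⟨-, u, hu, h⟩ := hS v hv
    simp only [Finset.mem_biUnion, Finset.mem_filter]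
    exact ⟨u, hu, hv, h⟩
  calc (S.card : ℝ) ≤ ∑ u ∈ U, ((S.filter fun v => Gen d u X v).card : ℝ) := by
        exact_mod_cast (Finset.card_le_card this).trans Finset.card_biUnion_le
    _ ≤ ∑ u ∈ U, F := Finset.sum_le_sum fun u _ => Gen.count d N hN u X F hF0 hF _ fun v hv => by
        rw [Finset.mem_filter] at hv
        exact ⟨(hS v hv.1).1, hv.2⟩
    _ = _ := by simp
lemma PB.natlogpow (c d : ℕ) : PB 1 (fun N : ℕ => (16 ^ d * ((c + 1 : ℕ) * N) *
    ((Nat.log 2 ⌊((c + 1 : ℕ) * N : ℝ)⌋₊ : ℝ) + 1) ^ d : ℝ)) := by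
  have q1 : PB 1 (fun N : ℕ => (16 ^ d * ((c + 1 : ℕ) * N) : ℝ)) :=
    ((PB.npow 1).cmul (16 ^ d * (c + 1 : ℕ)) (by positivity)).mono (fun N hN => by
      rw [pow_one]; exact le_of_eq (by ring)) |>.mono_exp (by simp)
  have := q1.mul ((PB.natlog (c + 1 : ℕ) (by exact_mod_cast Nat.succ_le_succ (Nat.zero_le c))).pow (fun N => by positivity) d) (fun N => by positivity)
  simpa using this
lemma gen_pb0 (d : ℕ) (e : ℝ) (U : ℕ → Finset (Fin d → ℤ)) (hU : PB e (fun N => ((U N).card : ℝ)))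
    (S : ℕ → Finset (Fin d → ℤ)) (hS : ∀ N, 2 ≤ N → ∀ v ∈ S N, v ∈ box d N ∧ ∃ u ∈ U N, Gen d u 0 v) :
    PB (e + 1) (fun N => ((S N).card : ℝ)) :=
  (hU.mul (PB.natlogpow d d) (fun N => by positivity)).mono fun N hN =>
    Gen.total d N (by omega) (U N) 0 _ (by positivity) (fun K _ _ T h1 _ h3 h4 => by
      have := ht_count ((d + 1 : ℕ) * N) (by positivity) T h3 h4
      rwa [h1] at this) _ (hS N hN)
lemma gen_pb1 (d : ℕ) (e t : ℝ) (ht0 : 0 ≤ t) (ht1 : t ≤ 1) (U : ℕ → Finset (Fin d → ℤ)) (hU : PB e (fun N => ((U N).card : ℝ)))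
    (S : ℕ → Finset (Fin d → ℤ)) (hS : ∀ N, 2 ≤ N → ∀ v ∈ S N, v ∈ box d N ∧ ∃ u ∈ U N, Gen d u ((N : ℝ) ^ t) v) :
    PB (e + (1 + t * (1 / d - 1))) (fun N => ((S N).card : ℝ)) := by
  refine (hU.mul (((PB.natlogpow d d).mul (PB.rpow (t * (1 / d - 1))) (fun N => by positivity)).cmul 3 (by norm_num))
    (fun N => by positivity)).mono fun N hN => ?_
  have hN1 : (1:ℝ) ≤ N := by exact_mod_cast (by omega : 1 ≤ N)
  refine Gen.total d N (by omega) (U N) ((N : ℝ) ^ t) _ (by positivity) (fun K _ _ T h1 h2 h3 h4 => ?_) _ (hS N hN)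
  have := ht_count2 ((N : ℝ) ^ t) ((d + 1 : ℕ) * N) (Real.one_le_rpow hN1 ht0) (by
    calc (N : ℝ) ^ t ≤ N := by simpa using Real.rpow_le_rpow_of_exponent_le hN1 ht1
      _ ≤ (2 ^ finrank ℚ K * (d + 1 : ℕ)) * N := le_mul_of_one_le_left (by positivity)
        (one_le_mul_of_one_le_of_one_le (one_le_pow₀ (by norm_num)) (by push_cast; linarith [(Nat.cast_nonneg d : (0:ℝ) ≤ d)]))
      _ = _ := by ring) h2 T h3 h4
  rw [h1, ← Real.rpow_mul (by positivity)] at this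
  refine this.trans (le_of_eq (by ring))
end GAC
namespace GAC
open Polynomial NumberField Module
lemma PB.prod {ι : Type*} (s : Finset ι) (e : ι → ℝ) (g : ι → ℕ → ℝ) (h : ∀ i ∈ s, PB (e i) (g i)) (h0 : ∀ i N, 0 ≤ g i N) :
    PB (∑ i ∈ s, e i) (fun N => ∏ i ∈ s, g i N) := by
  classical
  induction s using Finset.induction_on with
  | empty => simpa using PB.const 1 (by norm_num)
  | insert a s ha ih =>
    simp only [Finset.prod_insert ha, Finset.sum_insert ha]
    exact (h a (Finset.mem_insert_self _ _)).mul (ih fun i hi => h i (Finset.mem_insert_of_mem hi))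
      fun N => Finset.prod_nonneg fun i _ => h0 i N
def c3 (d : ℕ) : ℕ := c2 d ^ d * 2 ^ d
noncomputable def TB (d : ℕ) (i : ℕ) (N : ℕ) : ℕ := ⌊(c3 d : ℝ) * (N : ℝ) ^ (((d : ℝ) - i) / ((d : ℝ) - 1))⌋₊
lemma floor_pb (c e : ℝ) (hc : 0 ≤ c) (he : 0 ≤ e) : PB e (fun N => (2 * (⌊c * (N : ℝ) ^ e⌋₊ : ℝ) + 1)) :=
  ((PB.rpow e).cmul (2 * c + 1) (by positivity)).mono fun N hN => by
    have hN1 : (1:ℝ) ≤ (N : ℝ) ^ e := Real.one_le_rpow (by exact_mod_cast (by omega : 1 ≤ N)) he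
    have := Nat.floor_le (a := c * (N : ℝ) ^ e) (by positivity)
    nlinarith
noncomputable def TZ (d N : ℕ) : Finset (Fin d → ℤ) :=
  Fintype.piFinset fun i => if (i : ℕ) + 1 = d then {0} else Finset.Icc (-(TB d i N : ℤ)) (TB d i N)
lemma TZ_card (m : ℕ) (hm : 1 ≤ m) : PB (((m : ℝ) + 3) / 2) (fun N => ((TZ (m + 1) N).card : ℝ)) := by
  have hm0 : (0:ℝ) < m := by exact_mod_cast hm
  have := PB.prod (Finset.range m) (fun i => ((m : ℝ) + 1 - i) / m) (fun i N => 2 * (TB (m + 1) i N : ℝ) + 1)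
    (fun i hi => by
      have hi' : (i : ℝ) ≤ m := by exact_mod_cast (Finset.mem_range.1 hi).le
      have := floor_pb (c3 (m + 1)) (((m : ℝ) + 1 - i) / m) (by positivity) (by
        apply div_nonneg <;> linarith)
      simpa [TB] using this) (fun i N => by positivity)
  have hs : ∑ i ∈ Finset.range m, ((m : ℝ) + 1 - i) / m = ((m : ℝ) + 3) / 2 := by
    have hg : (∑ i ∈ Finset.range m, (i : ℝ)) = m * (m - 1) / 2 := by
      clear this hm hm0
      induction m with
      | zero => simp
      | succ k ih => rw [Finset.sum_range_succ, ih]; push_cast; ring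
    rw [← Finset.sum_div, Finset.sum_sub_distrib, hg]
    simp
    field_simp
    ring
  rw [hs] at this
  refine this.mono fun N _ => le_of_eq ?_
  rw [TZ, Fintype.card_piFinset, Fin.prod_univ_castSucc, Finset.prod_range]
  simp only [Fin.val_last, if_true, Finset.card_singleton, mul_one, Fin.val_castSucc]
  push_cast
  refine Finset.prod_congr rfl fun i _ => ?_
  rw [if_neg (by have := i.2; omega), Int.card_Icc]
  have : ((TB (m + 1) i N : ℤ) + 1 - -(TB (m + 1) i N : ℤ)).toNat = 2 * TB (m + 1) i N + 1 := by omega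
  rw [this]; push_cast; ring
lemma exists_vec {K : Type*} [Field K] [NumberField K] (d : ℕ) (b : K) (hb : IsIntegral ℤ b) (h : (minpoly ℤ b).natDegree = d) :
    minpoly ℤ b = poly d (fun i => (minpoly ℤ b).coeff i) :=
  (poly_coeff' d _ (minpoly.monic hb) h).symm
lemma tz_mem {K : Type} [Field K] [NumberField K] {d N : ℕ} (hd : 2 ≤ d) (hN : 1 ≤ N) {v : Fin d → ℤ} {a : K}
    (h : SqP d v K a) (hi : ¬ ImpP d v) (hD : (discr K).natAbs ≤ C0 d * N ^ 2) :
    ∃ u ∈ TZ d N, ∃ b : K, IsIntegral ℤ b ∧ minpoly ℤ b = poly d u := by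
  have hf := h.2.2.1
  obtain ⟨b, hb, hbn, hnc, hw⟩ := exists_tz (K := K) N hN (by omega) (by rwa [hf])
  rw [hf] at hw
  have hdeg := gens h hi b hb hbn
  refine ⟨_, ?_, b, hb, exists_vec d b hb hdeg⟩
  rw [TZ, Fintype.mem_piFinset]
  intro i
  split_ifs with hl
  · rw [Finset.mem_singleton]
    rw [nextCoeff_of_natDegree_pos (by omega), hdeg] at hnc
    rw [← hnc]; congr 1; omega
  · have h1 := coeff_le_of_house b hb _ hw i
    rw [hdeg] at h1
    rw [Finset.mem_Icc, ← abs_le]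
    have h2 : |((minpoly ℤ b).coeff i : ℝ)| ≤ (c3 d : ℝ) * (N : ℝ) ^ (((d : ℝ) - i) / ((d : ℝ) - 1)) := by
      refine h1.trans ?_
      have e1 : ((N : ℝ) ^ (1 / ((d : ℝ) - 1))) ^ (d - (i : ℕ)) = (N : ℝ) ^ (((d : ℝ) - i) / ((d : ℝ) - 1)) := by
        rw [← Real.rpow_natCast, ← Real.rpow_mul (by positivity), Nat.cast_sub i.2.le]
        congr 1; ring
      rw [mul_pow, e1, c3]
      push_cast
      have hc : (1:ℝ) ≤ c2 d := by
        have : 0 < c2 d := by unfold c2; positivity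
        exact_mod_cast this
      have : (c2 d : ℝ) ^ (d - (i : ℕ)) ≤ (c2 d : ℝ) ^ d := pow_le_pow_right₀ hc (by omega)
      have h3 : 0 ≤ (N : ℝ) ^ (((d : ℝ) - i) / ((d : ℝ) - 1)) * 2 ^ d := by positivity
      nlinarith
    have h3 : (((minpoly ℤ b).coeff i).natAbs : ℝ) ≤ (c3 d : ℝ) * (N : ℝ) ^ (((d : ℝ) - i) / ((d : ℝ) - 1)) := by
      rw [Nat.cast_natAbs]; push_cast; exact h2
    have h4 := Nat.le_floor h3
    rw [Int.abs_eq_natAbs]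
    exact Int.ofNat_le.2 h4
def C2P (d N : ℕ) (v : Fin d → ℤ) : Prop := ¬ ImpP d v ∧
  ∃ (K : Type) (_ : Field K) (_ : NumberField K) (a : K), SqP d v K a ∧ (discr K).natAbs ≤ C0 d * N ^ 2
lemma zero_triv {K : Type*} [Field K] [NumberField K] (b' : K) (_ : IsIntegral ℤ b') (h : ht b' ≤ 0) : ∃ n : ℤ, b' = n :=
  absurd (one_le_ht b') (by linarith)
open Classical in
lemma c2_big (d : ℕ) (hd : 6 ≤ d) : PB ((d : ℝ) - 1) (fun N => (((box d N).filter (C2P d N)).card : ℝ)) := by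
  obtain ⟨m, rfl⟩ : ∃ m, d = m + 1 := ⟨d - 1, by omega⟩
  refine (gen_pb0 (m + 1) _ (TZ (m + 1)) (TZ_card m (by omega)) _ fun N hN v hv => ?_).mono_exp ?_
  · rw [Finset.mem_filter] at hv
    obtain ⟨h1, h2, K, _, _, a, h3, h4⟩ := hv
    obtain ⟨u, hu, b, hb, hbu⟩ := tz_mem (by omega) (by omega) h3 h2 h4
    exact ⟨h1, u, hu, K, inferInstance, inferInstance, a, b, h3, hb, hbu, zero_triv⟩
  · have : (5:ℝ) ≤ m := by exact_mod_cast (by omega : 5 ≤ m)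
    push_cast; linarith
lemma box_pb (d c : ℕ) (t : ℝ) (ht : 0 ≤ t) : PB (d * t) (fun N => ((box d ⌊(c : ℝ) * (N : ℝ) ^ t⌋₊).card : ℝ)) := by
  refine ((floor_pb c t (by positivity) ht).pow (fun N => by positivity) d).mono_exp (le_of_eq (by ring)) |>.mono fun N _ => ?_
  rw [card_box]; push_cast; exact le_rfl
lemma small_mem {K : Type} [Field K] [NumberField K] {d : ℕ} {v : Fin d → ℤ} {a : K}
    (h : SqP d v K a) (hi : ¬ ImpP d v) (X : ℝ) (b : K) (hb : IsIntegral ℤ b) (hX : ht b ≤ X) (hn : ∀ n : ℤ, b ≠ n) :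
    ∃ u ∈ box d ⌊((2 ^ d : ℕ) : ℝ) * X⌋₊, minpoly ℤ b = poly d u := by
  have hdeg := gens h hi b hb hn
  refine ⟨_, ?_, exists_vec d b hb hdeg⟩
  rw [mem_box]
  intro i
  have h1 := coeff_le_MM (minpoly ℤ b) i
  rw [MM_minpoly b hb (by rw [hdeg, h.2.2.1]), hdeg] at h1
  have h3 : (((minpoly ℤ b).coeff i).natAbs : ℝ) ≤ ((2 ^ d : ℕ) : ℝ) * X := by
    rw [Nat.cast_natAbs]; push_cast
    exact h1.trans (by gcongr)
  have h4 := Nat.le_floor h3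
  rw [Int.abs_eq_natAbs]
  exact_mod_cast h4
open Classical in
lemma c2_five : PB ((5 : ℝ) - 1) (fun N => (((box 5 N).filter (C2P 5 N)).card : ℝ)) := by
  let S1 : ℕ → Finset (Fin 5 → ℤ) := fun N => (box 5 N).filter fun v =>
    ∃ u ∈ box 5 ⌊((2 ^ 5 : ℕ) : ℝ) * (N : ℝ) ^ (3 / 5 : ℝ)⌋₊, Gen 5 u 0 v
  let S2 : ℕ → Finset (Fin 5 → ℤ) := fun N => (box 5 N).filter fun v =>
    ∃ u ∈ box 5 ⌊((2 ^ 5 : ℕ) : ℝ) * (N : ℝ) ^ (13 / 20 : ℝ)⌋₊, Gen 5 u ((N : ℝ) ^ (3 / 5 : ℝ)) v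
  let S3 : ℕ → Finset (Fin 5 → ℤ) := fun N => (box 5 N).filter fun v =>
    ∃ u ∈ TZ 5 N, Gen 5 u ((N : ℝ) ^ (13 / 20 : ℝ)) v
  have p1 : PB ((5:ℝ) - 1) (fun N => ((S1 N).card : ℝ)) :=
    (gen_pb0 5 _ _ (box_pb 5 (2 ^ 5) (3 / 5) (by norm_num)) S1 fun N hN v hv => by
      simpa only [S1, Finset.mem_filter] using hv).mono_exp (by norm_num)
  have p2 : PB ((5:ℝ) - 1) (fun N => ((S2 N).card : ℝ)) :=
    (gen_pb1 5 _ (3 / 5) (by norm_num) (by norm_num) _ (box_pb 5 (2 ^ 5) (13 / 20) (by norm_num)) S2 fun N hN v hv => by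
      simpa only [S2, Finset.mem_filter] using hv).mono_exp (by norm_num)
  have p3 : PB ((5:ℝ) - 1) (fun N => ((S3 N).card : ℝ)) :=
    (gen_pb1 5 _ (13 / 20) (by norm_num) (by norm_num) _ (TZ_card 4 (by norm_num)) S3 fun N hN v hv => by
      simpa only [S3, Finset.mem_filter] using hv).mono_exp (by norm_num)
  refine ((p1.add p2).add p3).mono fun N hN => ?_
  have hsub : (box 5 N).filter (C2P 5 N) ⊆ S1 N ∪ S2 N ∪ S3 N := by
    intro v hv
    rw [Finset.mem_filter] at hv
    obtain ⟨h1, h2, K, _, _, a, h3, h4⟩ := hv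
    simp only [Finset.mem_union, S1, S2, S3, Finset.mem_filter, h1, true_and]
    by_cases q1 : ∀ b' : K, IsIntegral ℤ b' → ht b' ≤ (N : ℝ) ^ (3 / 5 : ℝ) → ∃ n : ℤ, b' = n
    · by_cases q2 : ∀ b' : K, IsIntegral ℤ b' → ht b' ≤ (N : ℝ) ^ (13 / 20 : ℝ) → ∃ n : ℤ, b' = n
      · obtain ⟨u, hu, b, hb, hbu⟩ := tz_mem (by omega) (by omega) h3 h2 h4
        exact Or.inr ⟨u, hu, K, inferInstance, inferInstance, a, b, h3, hb, hbu, q2⟩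
      · push Not at q2
        obtain ⟨b, hb, hX, hn⟩ := q2
        obtain ⟨u, hu, hbu⟩ := small_mem h3 h2 _ b hb hX hn
        exact Or.inl (Or.inr ⟨u, hu, K, inferInstance, inferInstance, a, b, h3, hb, hbu, q1⟩)
    · push Not at q1
      obtain ⟨b, hb, hX, hn⟩ := q1
      obtain ⟨u, hu, hbu⟩ := small_mem h3 h2 _ b hb hX hn
      exact Or.inl (Or.inl ⟨u, hu, K, inferInstance, inferInstance, a, b, h3, hb, hbu, zero_triv⟩)
  have := (Finset.card_le_card hsub).trans ((Finset.card_union_le _ _).trans (Nat.add_le_add_right (Finset.card_union_le _ _) _))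
  exact_mod_cast this
end GAC
namespace GAC
lemma cop_dvd {x y g D : ℤ} (h : IsCoprime x y) (h1 : g ∣ x * D) (h2 : g ∣ y * D) : g ∣ D := by
  obtain ⟨a, b, hab⟩ := h
  have : D = a * (x * D) + b * (y * D) := by linear_combination (-D) * hab
  rw [this]
  exact dvd_add (h1.mul_left _) (h2.mul_left _)
lemma det_small {m g h x1 y1 x2 y2 x3 y3 : ℤ} (hm : 0 < m) (hgh : g * h = m)
    (e1 : x1 ^ 2 + 27 * y1 ^ 2 = m) (e2 : x2 ^ 2 + 27 * y2 ^ 2 = m) (e3 : x3 ^ 2 + 27 * y3 ^ 2 = m)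
    (c1 : IsCoprime x1 y1) (c2 : IsCoprime x2 y2)
    (g2 : g ∣ x1 * y2 - x2 * y1) (h2 : h ∣ x1 * y2 + x2 * y1)
    (g3 : g ∣ x1 * y3 - x3 * y1) (h3 : h ∣ x1 * y3 + x3 * y1) :
    ∃ k : ℤ, -2 ≤ k ∧ k ≤ 2 ∧ (x2 * y3 - x3 * y2) * (g.gcd h : ℤ) = k * m := by
  set D := x2 * y3 - x3 * y2 with hD
  set e : ℤ := (g.gcd h : ℤ) with he
  have gD : g ∣ D := cop_dvd c1
    (by have : x1 * D = (x1 * y3 - x3 * y1) * x2 - (x1 * y2 - x2 * y1) * x3 := by rw [hD]; ring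
        rw [this]; exact dvd_sub (g3.mul_right _) (g2.mul_right _))
    (by have : y1 * D = (x1 * y3 - x3 * y1) * y2 - (x1 * y2 - x2 * y1) * y3 := by rw [hD]; ring
        rw [this]; exact dvd_sub (g3.mul_right _) (g2.mul_right _))
  have hhD : h ∣ D := cop_dvd c1
    (by have : x1 * D = (x1 * y3 + x3 * y1) * x2 - (x1 * y2 + x2 * y1) * x3 := by rw [hD]; ring
        rw [this]; exact dvd_sub (h3.mul_right _) (h2.mul_right _))
    (by have : y1 * D = (x1 * y2 + x2 * y1) * y3 - (x1 * y3 + x3 * y1) * y2 := by rw [hD]; ring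
        rw [this]; exact dvd_sub (h2.mul_right _) (h3.mul_right _))
  obtain ⟨k, hk⟩ : m ∣ D * e := by
    rw [he, Int.gcd_eq_gcd_ab, mul_add, ← hgh]
    refine dvd_add ?_ ?_
    · rw [← mul_assoc, mul_comm D g]; exact (mul_dvd_mul_left g hhD).mul_right _
    · rw [← mul_assoc]; exact (mul_dvd_mul_right gD h).mul_right _
  have heg : e ∣ g := Int.gcd_dvd_left ..
  have heh : e ∣ h := Int.gcd_dvd_right ..
  have hem : e ^ 2 ∣ m := by rw [← hgh, sq]; exact mul_dvd_mul heg heh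
  have he2 : e ^ 2 ∣ 108 := by
    have a1 : e ∣ 2 * (x1 * y2) := by
      have : 2 * (x1 * y2) = (x1 * y2 - x2 * y1) + (x1 * y2 + x2 * y1) := by ring
      rw [this]; exact dvd_add (heg.trans g2) (heh.trans h2)
    have a2 : e ^ 2 ∣ 4 * x1 ^ 2 * y2 ^ 2 := by
      have := pow_dvd_pow_of_dvd a1 2
      rwa [show (2 * (x1 * y2)) ^ 2 = 4 * x1 ^ 2 * y2 ^ 2 by ring] at this
    have a3 : e ^ 2 ∣ 108 * (y1 ^ 2 * y2 ^ 2) := by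
      have : 108 * (y1 ^ 2 * y2 ^ 2) = m * (4 * y2 ^ 2) - 4 * x1 ^ 2 * y2 ^ 2 := by rw [← e1]; ring
      rw [this]; exact dvd_sub (hem.mul_right _) a2
    have cy : ∀ x y : ℤ, x ^ 2 + 27 * y ^ 2 = m → IsCoprime x y → IsCoprime (e ^ 2) (y ^ 2) := by
      intro x y hxy hc
      have : IsCoprime m (y ^ 2) := by
        rw [← hxy, mul_comm]; exact IsCoprime.add_mul_left_left (hc.pow) _
      exact this.of_isCoprime_of_dvd_left hem
    exact (IsCoprime.mul_right (cy _ _ e1 c1) (cy _ _ e2 c2)).dvd_of_dvd_mul_right a3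
  have he108 : e ^ 2 ≤ 108 := Int.le_of_dvd (by norm_num) he2
  have hid : (x2 * x3 + 27 * y2 * y3) ^ 2 + 27 * D ^ 2 = m ^ 2 := by
    have : m ^ 2 = (x2 ^ 2 + 27 * y2 ^ 2) * (x3 ^ 2 + 27 * y3 ^ 2) := by rw [e2, e3]; ring
    rw [this, hD]; ring
  have hDm : 27 * D ^ 2 ≤ m ^ 2 := by nlinarith [sq_nonneg (x2 * x3 + 27 * y2 * y3)]
  have hkk : 27 * k ^ 2 ≤ 108 := by
    have : 27 * k ^ 2 * m ^ 2 ≤ 108 * m ^ 2 := by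
      calc 27 * k ^ 2 * m ^ 2 = 27 * (m * k) ^ 2 := by ring
        _ = (27 * D ^ 2) * e ^ 2 := by rw [← hk]; ring
        _ ≤ m ^ 2 * 108 := mul_le_mul hDm he108 (sq_nonneg _) (sq_nonneg _)
        _ = _ := by ring
    exact le_of_mul_le_mul_right this (by positivity)
  exact ⟨k, by nlinarith, by nlinarith, by rw [hk]; ring⟩
lemma prim_count (m : ℕ) (hm : 0 < m) (S : Finset (ℤ × ℤ)) (hS : ∀ p ∈ S, p.1 ^ 2 + 27 * p.2 ^ 2 = (m : ℤ))
    (hc : ∀ p ∈ S, IsCoprime p.1 p.2) : S.card ≤ 15 * tau m := by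
  classical
  rcases S.eq_empty_or_nonempty with rfl | ⟨p1, hp1⟩
  · simp
  have hm' : (0:ℤ) < m := by exact_mod_cast hm
  let f : ℤ × ℤ → ℕ := fun p => Int.gcd (p1.1 * p.2 - p.1 * p1.2) m
  refine Finset.card_le_mul_card_image_of_maps_to (f := f) (t := m.divisors) (fun p _ => ?_) 15 fun g hg => ?_
  · rw [Nat.mem_divisors]
    exact ⟨by have := Int.gcd_dvd_right (p1.1 * p.2 - p.1 * p1.2) m; exact_mod_cast this, hm.ne'⟩
  · obtain ⟨h, hgh⟩ := (Nat.mem_divisors.1 hg).1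
    have hg0 : g ≠ 0 := by rintro rfl; simp at hgh; omega
    have hghz : (g : ℤ) * h = m := by exact_mod_cast hgh.symm
    have data : ∀ p ∈ S, f p = g → (g : ℤ) ∣ p1.1 * p.2 - p.1 * p1.2 ∧ (h : ℤ) ∣ p1.1 * p.2 + p.1 * p1.2 := by
      intro p hp hf
      have h1 : (g : ℤ) ∣ p1.1 * p.2 - p.1 * p1.2 := by rw [← hf]; exact Int.gcd_dvd_left ..
      refine ⟨h1, ?_⟩
      have hprod : (m : ℤ) ∣ (p1.1 * p.2 - p.1 * p1.2) * (p1.1 * p.2 + p.1 * p1.2) := by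
        have : (p1.1 * p.2 - p.1 * p1.2) * (p1.1 * p.2 + p.1 * p1.2) =
          m * (p.2 ^ 2 - p1.2 ^ 2) := by
          linear_combination p.2 ^ 2 * hS p1 hp1 - p1.2 ^ 2 * hS p hp
        rw [this]; exact dvd_mul_right _ _
      obtain ⟨A, hA⟩ := h1
      have hcop : IsCoprime A h := by
        rw [Int.isCoprime_iff_gcd_eq_one]
        have e : f p = Int.gcd (g * A) (g * h) := by simp only [f]; rw [hA, hghz]
        rw [Int.gcd_mul_left, hf] at e
        simp only [Int.natAbs_natCast] at e
        have : g * 1 = g * Int.gcd A h := by omega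
        exact (Nat.eq_of_mul_eq_mul_left (by omega) this).symm
      rw [hA, ← hghz, mul_assoc] at hprod
      have := Int.dvd_of_mul_dvd_mul_left (by exact_mod_cast hg0) hprod
      exact hcop.symm.dvd_of_dvd_mul_left this
    set F := S.filter (fun p => f p = g) with hF
    rcases F.eq_empty_or_nonempty with h0 | ⟨p2, hp2⟩
    · rw [h0]; simp
    rw [hF, Finset.mem_filter] at hp2
    obtain ⟨d2, d2'⟩ := data p2 hp2.1 hp2.2
    have key : ∀ p ∈ F, ∃ k : ℤ, k ∈ Finset.Icc (-2) 2 ∧ (p2.1 * p.2 - p.1 * p2.2) * ((g : ℤ).gcd h : ℤ) = k * m := by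
      intro p hp
      rw [hF, Finset.mem_filter] at hp
      obtain ⟨d3, d3'⟩ := data p hp.1 hp.2
      obtain ⟨k, k1, k2, k3⟩ := det_small hm' hghz (hS p1 hp1) (hS p2 hp2.1) (hS p hp.1) (hc p1 hp1) (hc p2 hp2.1)
        d2 d2' d3 d3'
      exact ⟨k, Finset.mem_Icc.2 ⟨k1, k2⟩, k3⟩
    choose! κ hκ hκ' using key
    have : (Finset.Icc (-2 : ℤ) 2 ×ˢ Finset.Icc (-1 : ℤ) 1).card = 15 := by decide
    rw [← this]
    refine Finset.card_le_card_of_injOn (fun p => (κ p, (p2.1 * p.1 + 27 * p2.2 * p.2).sign)) (fun p hp => ?_) ?_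
    · simp only [Finset.coe_product, Set.mem_prod, Finset.mem_coe]
      refine ⟨hκ p hp, ?_⟩
      rcases lt_trichotomy (p2.1 * p.1 + 27 * p2.2 * p.2) 0 with h | h | h
      · rw [Int.sign_eq_neg_one_of_neg h]; decide
      · rw [h]; decide
      · rw [Int.sign_eq_one_of_pos h]; decide
    · intro p hp q hq hpq
      simp only [Prod.mk.injEq] at hpq
      have e0 : ((g : ℤ).gcd h : ℤ) ≠ 0 := by
        simp [hg0]
      have eD : p2.1 * p.2 - p.1 * p2.2 = p2.1 * q.2 - q.1 * p2.2 := by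
        apply mul_right_cancel₀ e0
        rw [hκ' p hp, hκ' q hq, hpq.1]
      have hpS := hS p (Finset.mem_filter.1 hp).1
      have hqS := hS q (Finset.mem_filter.1 hq).1
      have h2S := hS p2 hp2.1
      have eE : p2.1 * p.1 + 27 * p2.2 * p.2 = p2.1 * q.1 + 27 * p2.2 * q.2 := by
        have hsq : (p2.1 * p.1 + 27 * p2.2 * p.2) ^ 2 = (p2.1 * q.1 + 27 * p2.2 * q.2) ^ 2 := by
          have i1 : ∀ p : ℤ × ℤ, (p2.1 * p.1 + 27 * p2.2 * p.2) ^ 2 = (p2.1 ^ 2 + 27 * p2.2 ^ 2) * (p.1 ^ 2 + 27 * p.2 ^ 2)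
            - 27 * (p2.1 * p.2 - p.1 * p2.2) ^ 2 := fun p => by ring
          rw [i1, i1 q, hpS, hqS, eD]
        have habs := (sq_eq_sq_iff_abs_eq_abs _ _).1 hsq
        rw [← Int.sign_mul_abs (p2.1 * p.1 + 27 * p2.2 * p.2), hpq.2, habs, Int.sign_mul_abs]
      have m0 : (m : ℤ) ≠ 0 := hm'.ne'
      ext
      · apply mul_left_cancel₀ m0
        linear_combination (q.1 - p.1) * h2S + p2.1 * eE - 27 * p2.2 * eD
      · apply mul_left_cancel₀ m0
        linear_combination (q.2 - p.2) * h2S + p2.2 * eE + p2.1 * eD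
lemma rep_count (n : ℕ) (hn : 0 < n) (S : Finset (ℤ × ℤ)) (hS : ∀ p ∈ S, p.1 ^ 2 + 27 * p.2 ^ 2 = (n : ℤ)) :
    S.card ≤ 15 * tau n * tau n := by
  classical
  have hz : ∀ p ∈ S, Int.gcd p.1 p.2 ≠ 0 := by
    intro p hp h0
    rw [Int.gcd_eq_zero_iff] at h0
    have := hS p hp
    rw [h0.1, h0.2] at this
    simp at this; omega
  refine Finset.card_le_mul_card_image_of_maps_to (f := fun p : ℤ × ℤ => Int.gcd p.1 p.2) (t := n.divisors) (fun p hp => ?_) _ fun g hg => ?_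
  · rw [Nat.mem_divisors]
    refine ⟨?_, hn.ne'⟩
    have h1 : (Int.gcd p.1 p.2 : ℤ) ∣ n := by
      rw [← hS p hp, sq, sq]
      exact dvd_add ((Int.gcd_dvd_left ..).mul_right _) (((Int.gcd_dvd_right ..).mul_right _).mul_left _)
    exact_mod_cast h1
  · rcases (S.filter fun p => Int.gcd p.1 p.2 = g).eq_empty_or_nonempty with h0 | ⟨p0, hp0⟩
    · rw [h0]; simp
    have hred : ∀ p ∈ S.filter (fun p => Int.gcd p.1 p.2 = g), ∃ q : ℤ × ℤ, p = (g * q.1, g * q.2) ∧ IsCoprime q.1 q.2 ∧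
        (g : ℤ) ^ 2 * (q.1 ^ 2 + 27 * q.2 ^ 2) = n ∧ (g : ℤ) ≠ 0 := by
      intro p hp
      rw [Finset.mem_filter] at hp
      obtain ⟨hp, hpg⟩ := hp
      obtain ⟨a, ha⟩ := Int.gcd_dvd_left p.1 p.2
      obtain ⟨b, hb⟩ := Int.gcd_dvd_right p.1 p.2
      rw [hpg] at ha hb
      have g0 : g ≠ 0 := hpg ▸ hz p hp
      refine ⟨(a, b), Prod.ext ha hb, ?_, ?_, by exact_mod_cast g0⟩
      · rw [Int.isCoprime_iff_gcd_eq_one]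
        have e : g = Int.gcd (g * a) (g * b) := by rw [← ha, ← hb, hpg]
        rw [Int.gcd_mul_left] at e
        simp only [Int.natAbs_natCast] at e
        have : g * 1 = g * Int.gcd a b := by omega
        exact (Nat.eq_of_mul_eq_mul_left (by omega) this).symm
      · rw [← hS p hp, ha, hb]; ring
    choose! q hq1 hq2 hq3 hq4 using hred
    set n' : ℕ := ((q p0).1 ^ 2 + 27 * (q p0).2 ^ 2).toNat with hn'
    have hn'z : (n' : ℤ) = (q p0).1 ^ 2 + 27 * (q p0).2 ^ 2 := Int.toNat_of_nonneg (by positivity)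
    have hgn : (g : ℤ) ^ 2 * n' = n := by rw [hn'z]; exact hq3 p0 hp0
    have hgn' : g ^ 2 * n' = n := by exact_mod_cast hgn
    have hn0 : 0 < n' := by
      rcases Nat.eq_zero_or_pos n' with h | h
      · rw [h] at hgn'; omega
      · exact h
    have hinj : Set.InjOn q (S.filter fun p => Int.gcd p.1 p.2 = g) := fun a ha b hb hab => by
      rw [hq1 a ha, hq1 b hb, hab]
    rw [← Finset.card_image_of_injOn hinj]
    refine (prim_count n' hn0 _ ?_ ?_).trans (Nat.mul_le_mul_left _ ?_)
    · intro r hr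
      obtain ⟨p, hp, rfl⟩ := Finset.mem_image.1 hr
      have := hq3 p hp
      rw [← hgn] at this
      exact mul_left_cancel₀ (pow_ne_zero 2 (hq4 p hp)) this
    · intro r hr
      obtain ⟨p, hp, rfl⟩ := Finset.mem_image.1 hr
      exact hq2 p hp
    · exact Finset.card_le_card (Nat.divisors_subset_of_dvd hn.ne' ⟨g ^ 2, by rw [← hgn']; ring⟩)
end GAC
namespace GAC
open Polynomial NumberField Module
lemma disc_data {K : Type*} [Field K] [NumberField K] (b : K) (hb : IsIntegral ℤ b) (n : ℕ) (hn : (minpoly ℤ b).natDegree = n)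
    (hf : finrank ℚ K = n) (hs : IsSquare (discr K)) : ∃ (z : Fin n → ℂ) (y : ℤ), y ≠ 0 ∧
      (minpoly ℤ b).map (Int.castRingHom ℂ) = ∏ i, (X - C (z i)) ∧
      (y : ℂ) ^ 2 = ∏ i, ∏ j ∈ Finset.Ioi i, (z j - z i) ^ 2 := by
  obtain ⟨pb, rfl⟩ := exists_pb b hb (hn.trans hf.symm)
  obtain ⟨q, hq⟩ := discr_pb_sq pb hs
  have hdim : pb.dim = n := by rw [← pb.finrank, hf]
  have hint : IsIntegral ℤ (Algebra.discr ℚ pb.basis) :=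
    Algebra.discr_isIntegral ℚ fun i => by rw [pb.basis_eq_pow]; exact hb.pow _
  rw [hq] at hint
  obtain ⟨y, hy⟩ := IsIntegrallyClosed.isIntegral_iff.1 (IsIntegral.of_pow (by norm_num : 0 < 2) hint)
  have h0 := Algebra.discr_not_zero_of_basis ℚ pb.basis
  have hP := minpoly_eq_prod pb.gen hb (hn.trans hf.symm)
  subst hdim
  have e : Fin pb.dim ≃ (K →ₐ[ℚ] ℂ) := Fintype.equivOfCardEq (by rw [AlgHom.card, pb.finrank, Fintype.card_fin])
  refine ⟨fun i => e i pb.gen, y, ?_, ?_, ?_⟩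
  · rintro rfl
    rw [hq, ← hy] at h0
    simp at h0
  · rw [hP]
    refine (Fintype.prod_equiv (e.trans (RingHom.equivRatAlgHom K ℂ).symm) _ _ fun i => ?_).symm
    simp [RingHom.equivRatAlgHom]
  · rw [← Algebra.discr_powerBasis_eq_prod ℚ ℂ pb e, hq, ← hy]
    simp
lemma map_coeff_eq {n : ℕ} {u : Fin n → ℤ} {P : ℂ[X]} (h : (poly n u).map (Int.castRingHom ℂ) = P) (i : Fin n) :
    (u i : ℂ) = P.coeff i := by
  rw [← h, coeff_map, poly_coeff]; simp
lemma rel2 {u : Fin 2 → ℤ} {z : Fin 2 → ℂ} {y : ℤ} (h : (poly 2 u).map (Int.castRingHom ℂ) = ∏ i, (X - C (z i)))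
    (hy : (y : ℂ) ^ 2 = ∏ i, ∏ j ∈ Finset.Ioi i, (z j - z i) ^ 2) : y ^ 2 = u 1 ^ 2 - 4 * u 0 := by
  have e : ∏ i, (X - C (z i)) = X ^ 2 + C (-(z 0 + z 1)) * X + C (z 0 * z 1) := by
    simp [Fin.prod_univ_two]; ring
  rw [e] at h
  have h0 := map_coeff_eq h 0
  have h1 := map_coeff_eq h 1
  simp [coeff_X, coeff_C] at h0 h1
  have i0 : Finset.Ioi (0 : Fin 2) = {1} := by decide
  have i1 : Finset.Ioi (1 : Fin 2) = ∅ := by decide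
  rw [Fin.prod_univ_two, i0, i1] at hy
  simp at hy
  have : ((y ^ 2 : ℤ) : ℂ) = ((u 1 ^ 2 - 4 * u 0 : ℤ) : ℂ) := by
    push_cast; rw [hy, h0, h1]; ring
  exact_mod_cast this
lemma coef3 (a b c : ℂ) (P : ℂ[X]) (h : P = X ^ 3 + C a * X ^ 2 + C b * X + C c) :
    P.coeff 0 = c ∧ P.coeff 1 = b ∧ P.coeff 2 = a := by
  subst h; simp [coeff_X, coeff_C]
lemma coef4 (a b c e : ℂ) (P : ℂ[X]) (h : P = X ^ 4 + C a * X ^ 3 + C b * X ^ 2 + C c * X + C e) :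
    P.coeff 0 = e ∧ P.coeff 1 = c ∧ P.coeff 2 = b ∧ P.coeff 3 = a := by
  subst h; simp [coeff_X, coeff_C]
lemma rel3 {u : Fin 3 → ℤ} {z : Fin 3 → ℂ} {y : ℤ} (h : (poly 3 u).map (Int.castRingHom ℂ) = ∏ i, (X - C (z i)))
    (hy : (y : ℂ) ^ 2 = ∏ i, ∏ j ∈ Finset.Ioi i, (z j - z i) ^ 2) (h2 : u 2 = 0) :
    (27 * u 0) ^ 2 + 27 * y ^ 2 = 4 * (-3 * u 1) ^ 3 := by
  have e : ∏ i, (X - C (z i)) = X ^ 3 + C (-(z 0 + z 1 + z 2)) * X ^ 2 + C (z 0 * z 1 + z 0 * z 2 + z 1 * z 2) * X +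
      C (-(z 0 * z 1 * z 2)) := by
    simp [Fin.prod_univ_three]; ring
  obtain ⟨k0, k1, k2⟩ := coef3 _ _ _ _ e
  have h0 := map_coeff_eq h 0
  have h1 := map_coeff_eq h 1
  have h2' := map_coeff_eq h 2
  rw [h2] at h2'
  rw [Fin.val_zero, k0] at h0
  rw [Fin.val_one, k1] at h1
  rw [Fin.val_two, k2, Int.cast_zero] at h2'
  have i0 : Finset.Ioi (0 : Fin 3) = {1, 2} := by decide
  have i1 : Finset.Ioi (1 : Fin 3) = {2} := by decide
  have i2 : Finset.Ioi (2 : Fin 3) = ∅ := by decide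
  rw [Fin.prod_univ_three, i0, i1, i2, Finset.prod_pair (by decide)] at hy
  simp at hy
  have h3 : z 2 = - z 0 - z 1 := by linear_combination h2'
  have : (((27 * u 0) ^ 2 + 27 * y ^ 2 : ℤ) : ℂ) = ((4 * (-3 * u 1) ^ 3 : ℤ) : ℂ) := by
    push_cast; rw [hy, h0, h1, h3]; ring
  exact_mod_cast this
lemma rel4 {u : Fin 4 → ℤ} {z : Fin 4 → ℂ} {y : ℤ} (h : (poly 4 u).map (Int.castRingHom ℂ) = ∏ i, (X - C (z i)))
    (hy : (y : ℂ) ^ 2 = ∏ i, ∏ j ∈ Finset.Ioi i, (z j - z i) ^ 2) (h2 : u 3 = 0) :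
    (2 * u 2 ^ 3 - 72 * u 2 * u 0 + 27 * u 1 ^ 2) ^ 2 + 27 * y ^ 2 = 4 * (u 2 ^ 2 + 12 * u 0) ^ 3 := by
  have e : ∏ i, (X - C (z i)) = X ^ 4 + C (-(z 0 + z 1 + z 2 + z 3)) * X ^ 3 +
      C (z 0 * z 1 + z 0 * z 2 + z 1 * z 2 + z 3 * (z 0 + z 1 + z 2)) * X ^ 2 +
      C (-(z 0 * z 1 * z 2) - z 3 * (z 0 * z 1 + z 0 * z 2 + z 1 * z 2)) * X + C (z 0 * z 1 * z 2 * z 3) := by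
    simp [Fin.prod_univ_four]; ring
  obtain ⟨k0, k1, k2, k3⟩ := coef4 _ _ _ _ _ e
  have h0 := map_coeff_eq h 0
  have h1 := map_coeff_eq h 1
  have h2' := map_coeff_eq h 2
  have h3' := map_coeff_eq h 3
  rw [h2] at h3'
  rw [Fin.val_zero, k0] at h0
  rw [Fin.val_one, k1] at h1
  rw [Fin.val_two, k2] at h2'
  rw [show ((3 : Fin 4) : ℕ) = 3 from rfl, k3, Int.cast_zero] at h3'
  have i0 : Finset.Ioi (0 : Fin 4) = {1, 2, 3} := by decide
  have i1 : Finset.Ioi (1 : Fin 4) = {2, 3} := by decide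
  have i2 : Finset.Ioi (2 : Fin 4) = {3} := by decide
  have i3 : Finset.Ioi (3 : Fin 4) = ∅ := by decide
  rw [Fin.prod_univ_four, i0, i1, i2, i3, Finset.prod_pair (by decide), Finset.prod_insert (by decide),
    Finset.prod_pair (by decide)] at hy
  simp at hy
  have h3 : z 3 = - z 0 - z 1 - z 2 := by linear_combination h3'
  have : (((2 * u 2 ^ 3 - 72 * u 2 * u 0 + 27 * u 1 ^ 2) ^ 2 + 27 * y ^ 2 : ℤ) : ℂ) =
      ((4 * (u 2 ^ 2 + 12 * u 0) ^ 3 : ℤ) : ℂ) := by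
    push_cast; rw [hy, h0, h1, h2', h3]; ring
  exact_mod_cast this
end GAC
namespace GAC
open Polynomial NumberField Module
lemma sq_pairs (M : ℕ) (S : Finset (ℤ × ℤ)) (h : ∀ p ∈ S, ∃ y : ℤ, y ≠ 0 ∧ p.2 ^ 2 + 27 * y ^ 2 = 4 * p.1 ^ 3)
    (hM : ∀ p ∈ S, p.1 ≤ M) : (S.card : ℝ) ≤ 135 * (M * (1 + Real.log M) ^ 64) := by
  classical
  have hpos : ∀ p ∈ S, 0 < p.1 := fun p hp => by
    obtain ⟨y, hy, e⟩ := h p hp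
    have h1 : 0 < y ^ 2 := by positivity
    have h2 : 0 < p.1 ^ 3 := by nlinarith [sq_nonneg p.2]
    by_contra hc
    have : p.1 ^ 3 ≤ 0 := Odd.pow_nonpos (by decide) (not_lt.1 hc)
    omega
  choose! y hy0 hy using h
  have hmap : ∀ p ∈ S, p.1.toNat ∈ Finset.Icc 1 M := fun p hp => by
    have := hpos p hp; have := hM p hp
    rw [Finset.mem_Icc]; omega
  have hfib : ∀ n ∈ Finset.Icc 1 M, (S.filter fun p => p.1.toNat = n).card ≤ 135 * tau n ^ 6 := by
    intro n hn
    have hn1 := (Finset.mem_Icc.1 hn).1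
    set F := S.filter fun p => p.1.toNat = n
    have hF : ∀ p ∈ F, p ∈ S ∧ p.1 = n := fun p hp => by
      obtain ⟨h1, h2⟩ := Finset.mem_filter.1 hp
      have := hpos p h1
      exact ⟨h1, by omega⟩
    have hinj : Set.InjOn (fun p : ℤ × ℤ => (p.2, y p)) F := fun a ha b hb hab => by
      simp only [Prod.mk.injEq] at hab
      exact Prod.ext ((hF a ha).2.trans (hF b hb).2.symm) hab.1
    rw [← Finset.card_image_of_injOn hinj]
    refine (rep_count (4 * n ^ 3) (by positivity) _ ?_).trans ?_
    · intro q hq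
      obtain ⟨p, hp, rfl⟩ := Finset.mem_image.1 hq
      have := hy p (hF p hp).1
      rw [(hF p hp).2] at this
      push_cast; exact this
    · have t4 : tau 4 = 3 := by decide
      have : tau (4 * n ^ 3) ≤ 3 * tau n ^ 3 :=
        (tau_mul_le _ _).trans (by rw [t4]; exact Nat.mul_le_mul_left _ (tau_pow_le _ _))
      calc 15 * tau (4 * n ^ 3) * tau (4 * n ^ 3) ≤ 15 * (3 * tau n ^ 3) * (3 * tau n ^ 3) := by gcongr
        _ = _ := by ring
  have h2 : S.card ≤ ∑ n ∈ Finset.Icc 1 M, 135 * tau n ^ 6 := by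
    rw [Finset.card_eq_sum_card_fiberwise hmap]
    exact Finset.sum_le_sum hfib
  have h3 := tau_sum' 6 M
  calc (S.card : ℝ) ≤ ((∑ n ∈ Finset.Icc 1 M, 135 * tau n ^ 6 : ℕ) : ℝ) := by exact_mod_cast h2
    _ = 135 * ∑ n ∈ Finset.Icc 1 M, (tau n : ℝ) ^ 6 := by push_cast; rw [Finset.mul_sum]
    _ ≤ _ := by
      have : ∑ n ∈ Finset.Icc 1 M, (tau n : ℝ) ^ 6 ≤ M * (1 + Real.log M) ^ 64 := by
        exact h3
      linarith
lemma pairs_pb (c e : ℝ) (hc : 1 ≤ c) (he : 0 ≤ e) : PB e (fun N =>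
    135 * ((⌊c * (N : ℝ) ^ e⌋₊ : ℝ) * (1 + Real.log (⌊c * (N : ℝ) ^ e⌋₊ : ℝ)) ^ 64)) := by
  have h1 := floor_pb c e (by linarith) he
  have hl : PB 0 (fun N => (1 + Real.log (⌊c * (N : ℝ) ^ e⌋₊ : ℝ))) :=
    (PB.log1.cmul (1 + Real.log c + e) (by have := Real.log_nonneg hc; positivity)).mono fun N hN => by
      have hN1 : (1:ℝ) ≤ (N : ℝ) := by exact_mod_cast (by omega : 1 ≤ N)
      have hN2 : (1:ℝ) ≤ (N : ℝ) ^ e := Real.one_le_rpow hN1 he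
      have h3 : 1 ≤ c * (N : ℝ) ^ e := one_le_mul_of_one_le_of_one_le hc hN2
      have h4 : 1 ≤ ⌊c * (N : ℝ) ^ e⌋₊ := Nat.le_floor (by exact_mod_cast h3)
      have h5 := Real.log_le_log (by exact_mod_cast h4) (Nat.floor_le (a := c * (N : ℝ) ^ e) (by positivity))
      rw [Real.log_mul (by positivity) (by positivity), Real.log_rpow (by positivity)] at h5
      have := log_nn N
      have := Real.log_nonneg hc
      have := mul_nonneg (Real.log_nonneg hc) (log_nn N)
      nlinarith
  have hn : ∀ N : ℕ, 0 ≤ 1 + Real.log (⌊c * (N : ℝ) ^ e⌋₊ : ℝ) := fun N => by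
    have := log_nn ⌊c * (N : ℝ) ^ e⌋₊; linarith
  have h2 := (h1.mul (hl.pow hn 64) fun N => pow_nonneg (hn N) _).cmul 135 (by norm_num)
  refine (h2.mono_exp (le_of_eq (by simp))).mono fun N _ => ?_
  have := pow_nonneg (hn N) 64
  have := mul_nonneg (Nat.cast_nonneg (α := ℝ) ⌊c * (N : ℝ) ^ e⌋₊) this
  nlinarith
lemma c3_pos (d : ℕ) (hd : 0 < d) : (1:ℝ) ≤ c3 d := by
  have h : 0 < c2 d := by unfold c2; positivity
  have : 0 < c3 d := Nat.mul_pos (Nat.pow_pos h) (by positivity)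
  exact_mod_cast this
lemma TZ_le {d N : ℕ} {u : Fin d → ℤ} (hu : u ∈ TZ d N) (i : Fin d) (hi : (i : ℕ) + 1 ≠ d) : |u i| ≤ TB d i N := by
  rw [TZ, Fintype.mem_piFinset] at hu
  have := hu i
  rw [if_neg hi, Finset.mem_Icc, ← abs_le] at this
  exact this
lemma TZ_zero {d N : ℕ} {u : Fin d → ℤ} (hu : u ∈ TZ d N) (i : Fin d) (hi : (i : ℕ) + 1 = d) : u i = 0 := by
  rw [TZ, Fintype.mem_piFinset] at hu
  have := hu i
  rwa [if_pos hi, Finset.mem_singleton] at this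
lemma TZ_le' {d N : ℕ} {u : Fin d → ℤ} (hu : u ∈ TZ d N) (i : Fin d) (hi : (i : ℕ) + 1 ≠ d) :
    |(u i : ℝ)| ≤ c3 d * (N : ℝ) ^ (((d : ℝ) - i) / ((d : ℝ) - 1)) := by
  have h := TZ_le hu i hi
  have h1 : |(u i : ℝ)| ≤ (TB d i N : ℝ) := by exact_mod_cast h
  exact h1.trans (Nat.floor_le (by positivity))
open Classical in
lemma c2_red (d : ℕ) (hd : 2 ≤ d) (R : (Fin d → ℤ) → Prop) (e : ℝ)
    (hR : ∀ u (z : Fin d → ℂ) (y : ℤ), y ≠ 0 → (∀ i : Fin d, (i : ℕ) + 1 = d → u i = 0) →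
      (poly d u).map (Int.castRingHom ℂ) = ∏ i, (X - C (z i)) →
      (y : ℂ) ^ 2 = ∏ i, ∏ j ∈ Finset.Ioi i, (z j - z i) ^ 2 → R u)
    (hU : PB e (fun N => (((TZ d N).filter R).card : ℝ))) :
    PB (e + 1) (fun N => (((box d N).filter (C2P d N)).card : ℝ)) := by
  refine gen_pb0 d _ _ hU _ fun N hN v hv => ?_
  rw [Finset.mem_filter] at hv
  obtain ⟨h1, h2, K, _, _, a, h3, h4⟩ := hv
  obtain ⟨u, hu, b, hb, hbu⟩ := tz_mem (by omega) (by omega) h3 h2 h4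
  refine ⟨h1, u, ?_, K, inferInstance, inferInstance, a, b, h3, hb, hbu, zero_triv⟩
  obtain ⟨z, y, hy0, hz, hy⟩ := disc_data b hb d (by rw [hbu, poly_natDegree]) h3.2.2.1 h3.2.2.2
  rw [hbu] at hz
  exact Finset.mem_filter.2 ⟨hu, hR u z y hy0 (fun i hi => TZ_zero hu i hi) hz hy⟩
open Classical in
lemma c2_three : PB ((3 : ℝ) - 1) (fun N => (((box 3 N).filter (C2P 3 N)).card : ℝ)) := by
  refine (c2_red 3 (by norm_num) (fun u => ∃ y : ℤ, y ≠ 0 ∧ (27 * u 0) ^ 2 + 27 * y ^ 2 = 4 * (-3 * u 1) ^ 3) 1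
    (fun u z y hy0 h0 hz hy => ⟨y, hy0, rel3 hz hy (h0 2 rfl)⟩) ?_).mono_exp (by norm_num)
  refine (pairs_pb (3 * c3 3) 1 (by have := c3_pos 3 (by norm_num); linarith) (by norm_num)).mono fun N hN => ?_
  have hinj : Set.InjOn (fun u : Fin 3 → ℤ => (-3 * u 1, 27 * u 0)) ((TZ 3 N).filter fun u =>
      ∃ y : ℤ, y ≠ 0 ∧ (27 * u 0) ^ 2 + 27 * y ^ 2 = 4 * (-3 * u 1) ^ 3) := fun a ha b hb hab => by
    have ha := TZ_zero (Finset.mem_filter.1 ha).1 2 rfl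
    have hb := TZ_zero (Finset.mem_filter.1 hb).1 2 rfl
    simp only [Prod.mk.injEq] at hab
    funext i; fin_cases i
    · show a 0 = b 0; omega
    · show a 1 = b 1; omega
    · show a 2 = b 2; omega
  rw [← Finset.card_image_of_injOn hinj]
  refine sq_pairs _ _ ?_ ?_
  · intro p hp
    obtain ⟨u, hu, rfl⟩ := Finset.mem_image.1 hp
    exact (Finset.mem_filter.1 hu).2
  · intro p hp
    obtain ⟨u, hu, rfl⟩ := Finset.mem_image.1 hp
    have := TZ_le' (Finset.mem_filter.1 hu).1 1 (by decide)
    norm_num at this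
    have h1 : ((3 * (u 1).natAbs : ℕ) : ℝ) ≤ 3 * c3 3 * (N : ℝ) ^ (1:ℝ) := by
      rw [Nat.cast_mul, Nat.cast_natAbs, Real.rpow_one]; push_cast; linarith
    have h2 := Nat.le_floor h1
    show -3 * u 1 ≤ _
    omega
open Classical in
lemma c2_four : PB ((4 : ℝ) - 1) (fun N => (((box 4 N).filter (C2P 4 N)).card : ℝ)) := by
  refine (c2_red 4 (by norm_num) (fun u => ∃ y : ℤ, y ≠ 0 ∧
      (2 * u 2 ^ 3 - 72 * u 2 * u 0 + 27 * u 1 ^ 2) ^ 2 + 27 * y ^ 2 = 4 * (u 2 ^ 2 + 12 * u 0) ^ 3) (2 / 3 + 4 / 3)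
    (fun u z y hy0 h0 hz hy => ⟨y, hy0, rel4 hz hy (h0 3 rfl)⟩) ?_).mono_exp (by norm_num)
  have hc := c3_pos 4 (by norm_num)
  refine (((floor_pb (c3 4) (2 / 3) (by linarith) (by norm_num)).cmul 2 (by norm_num)).mul
    (pairs_pb (c3 4 ^ 2 + 12 * c3 4) (4 / 3) (by nlinarith) (by norm_num)) fun N => by
      have := log_nn ⌊((c3 4 : ℝ) ^ 2 + 12 * c3 4) * (N : ℝ) ^ (4 / 3 : ℝ)⌋₊
      positivity).mono fun N hN => ?_
  set M := ⌊((c3 4 : ℝ) ^ 2 + 12 * c3 4) * (N : ℝ) ^ (4 / 3 : ℝ)⌋₊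
  set T := ⌊(c3 4 : ℝ) * (N : ℝ) ^ (2 / 3 : ℝ)⌋₊ with hT
  have hTB : TB 4 2 N = T := by rw [TB, hT]; norm_num
  set W := (TZ 4 N).filter fun u => ∃ y : ℤ, y ≠ 0 ∧
      (2 * u 2 ^ 3 - 72 * u 2 * u 0 + 27 * u 1 ^ 2) ^ 2 + 27 * y ^ 2 = 4 * (u 2 ^ 2 + 12 * u 0) ^ 3
  have hmap : ∀ u ∈ W, (u 2, decide (0 ≤ u 1)) ∈ Finset.Icc (-(T:ℤ)) T ×ˢ (Finset.univ : Finset Bool) := fun u hu => by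
    have := TZ_le (Finset.mem_filter.1 hu).1 2 (by decide)
    simp only [Fin.val_two] at this
    rw [hTB, abs_le] at this
    simp [this, le_or_gt]
  have hfib : ∀ q ∈ Finset.Icc (-(T:ℤ)) T ×ˢ (Finset.univ : Finset Bool),
      ((W.filter fun u => (u 2, decide (0 ≤ u 1)) = q).card : ℝ) ≤ 135 * (M * (1 + Real.log M) ^ 64) := fun q _ => by
    have hinj : Set.InjOn (fun u : Fin 4 → ℤ => (u 2 ^ 2 + 12 * u 0, 2 * u 2 ^ 3 - 72 * u 2 * u 0 + 27 * u 1 ^ 2))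
        (W.filter fun u => (u 2, decide (0 ≤ u 1)) = q) := fun a ha b hb hab => by
      obtain ⟨ha1, ha2⟩ := Finset.mem_filter.1 ha
      obtain ⟨hb1, hb2⟩ := Finset.mem_filter.1 hb
      have ha := TZ_zero (Finset.mem_filter.1 ha1).1 3 rfl
      have hb := TZ_zero (Finset.mem_filter.1 hb1).1 3 rfl
      simp only [Prod.mk.injEq] at hab
      have h2 := ha2.trans hb2.symm
      simp only [Prod.mk.injEq, decide_eq_decide] at h2
      obtain ⟨h2, hs⟩ := h2
      obtain ⟨e1, e2⟩ := hab
      rw [h2] at e1 e2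
      have h0 : a 0 = b 0 := by omega
      rw [h0] at e2
      have h1 : a 1 ^ 2 = b 1 ^ 2 := by omega
      have h1' : a 1 = b 1 := by
        rcases sq_eq_sq_iff_eq_or_eq_neg.1 h1 with h | h <;> omega
      funext i; fin_cases i
      · exact h0
      · exact h1'
      · exact h2
      · exact ha.trans hb.symm
    rw [← Finset.card_image_of_injOn hinj]
    refine sq_pairs _ _ ?_ ?_
    · intro p hp
      obtain ⟨u, hu, rfl⟩ := Finset.mem_image.1 hp
      exact (Finset.mem_filter.1 (Finset.mem_filter.1 hu).1).2
    · intro p hp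
      obtain ⟨u, hu, rfl⟩ := Finset.mem_image.1 hp
      have hu := (Finset.mem_filter.1 (Finset.mem_filter.1 hu).1).1
      have k2 := TZ_le' hu 2 (by decide)
      have k0 := TZ_le' hu 0 (by decide)
      norm_num at k2 k0
      have k3 : (u 2 : ℝ) ^ 2 ≤ (c3 4) ^ 2 * (N : ℝ) ^ (4 / 3 : ℝ) := by
        rw [← sq_abs]
        calc _ ≤ ((c3 4 : ℝ) * (N : ℝ) ^ (2 / 3 : ℝ)) ^ 2 := by gcongr
          _ = _ := by rw [mul_pow, ← Real.rpow_natCast, ← Real.rpow_natCast, ← Real.rpow_mul (by positivity)]; norm_num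
      show u 2 ^ 2 + 12 * u 0 ≤ _
      have h1 : (((u 2 ^ 2 + 12 * u 0).toNat : ℕ) : ℝ) ≤ ((c3 4 : ℝ) ^ 2 + 12 * c3 4) * (N : ℝ) ^ (4 / 3 : ℝ) := by
        have hz : (((u 2 ^ 2 + 12 * u 0).toNat : ℕ) : ℤ) ≤ u 2 ^ 2 + 12 * |u 0| := by
          have := le_abs_self (u 0); have := sq_nonneg (u 2); have := abs_nonneg (u 0); omega
        have hz' : (((u 2 ^ 2 + 12 * u 0).toNat : ℕ) : ℝ) ≤ (u 2 : ℝ) ^ 2 + 12 * |(u 0 : ℝ)| := by exact_mod_cast hz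
        linarith
      have h2 := Nat.le_floor h1
      exact (Int.self_le_toNat _).trans (Int.ofNat_le.2 h2)
  have h1 : (W.card : ℝ) ≤ ∑ q ∈ Finset.Icc (-(T:ℤ)) T ×ˢ (Finset.univ : Finset Bool), 135 * (M * (1 + Real.log M) ^ 64) := by
    rw [Finset.card_eq_sum_card_fiberwise hmap]
    push_cast
    exact Finset.sum_le_sum hfib
  rw [Finset.sum_const, nsmul_eq_mul, Finset.card_product, Int.card_Icc] at h1
  have : ((T : ℤ) + 1 - -(T : ℤ)).toNat = 2 * T + 1 := by omega
  rw [this] at h1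
  simp only [Finset.card_univ, Fintype.card_bool] at h1
  refine h1.trans (le_of_eq ?_)
  push_cast; ring
lemma no_two {K : Type} [Field K] [NumberField K] {v : Fin 2 → ℤ} {a : K} (h : SqP 2 v K a) : False := by
  obtain ⟨h1, h2, h3, h4⟩ := h
  have hdeg : (minpoly ℤ a).natDegree = 2 := by rw [h2, poly_natDegree]
  obtain ⟨z, y, hy0, hz, hy⟩ := disc_data a h1 2 hdeg h3 h4
  rw [h2] at hz
  have hr := rel2 hz hy
  have hroot : a ^ 2 + (v 0 + v 1 * a) = 0 := by
    have := minpoly.aeval ℤ a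
    rw [h2, poly] at this
    simpa [Fin.sum_univ_two] using this
  have hr' : (y : K) ^ 2 = (v 1 : K) ^ 2 - 4 * v 0 := by exact_mod_cast congrArg (Int.cast (R := K)) hr
  have hsq : (2 * a + v 1) ^ 2 = (y : K) ^ 2 := by rw [hr']; linear_combination 4 * hroot
  have key : ∀ t : ℤ, 2 * a + v 1 = (t : K) → False := fun t ht => by
    have ha : a = algebraMap ℚ K ((t - v 1) / 2) := by
      have : (algebraMap ℚ K ((t - v 1) / 2)) = ((t : K) - v 1) / 2 := by simp
      rw [this, ← ht]; field_simp; ring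
    obtain ⟨n, hn⟩ := rat_int a h1 _ ha
    have : minpoly ℤ a = X - C n := by
      rw [hn]; exact minpoly.eq_X_sub_C_of_algebraMap_inj n (algebraMap ℤ K).injective_int
    rw [this, natDegree_X_sub_C] at hdeg
    omega
  rcases sq_eq_sq_iff_eq_or_eq_neg.1 hsq with h | h
  · exact key _ h
  · exact key (-y) (by rw [h]; push_cast; rfl)
open Classical in
lemma c2_count (d : ℕ) (hd : 2 ≤ d) : PB ((d : ℝ) - 1) (fun N => (((box d N).filter (C2P d N)).card : ℝ)) := by
  by_cases h6 : 6 ≤ d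
  · exact c2_big d h6
  have : d = 2 ∨ d = 3 ∨ d = 4 ∨ d = 5 := by omega
  rcases this with rfl | rfl | rfl | rfl
  · refine ⟨0, le_rfl, 0, fun N _ => ?_⟩
    beta_reduce
    rw [Finset.filter_false_of_mem fun v _ h => ?_]
    · simp
    · obtain ⟨_, K, _, _, a, h, _⟩ := h
      exact no_two h
  · exact_mod_cast c2_three
  · exact_mod_cast c2_four
  · exact_mod_cast c2_five
end GAC
namespace GAC
open Polynomial NumberField Module
open Classical in
lemma total_count (d : ℕ) (hd : 2 ≤ d) (P : (Fin d → ℤ) → Prop)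
    (hP : ∀ v, P v → ¬ RedP d v → ∃ (K : Type) (_ : Field K) (_ : NumberField K) (a : K), SqP d v K a) :
    PB ((d : ℝ) - 1) (fun N => (((box d N).filter P).card : ℝ)) := by
  have h3 : PB ((d : ℝ) - 1) (fun N => (((box d N).filter (C3P d N)).card : ℝ)) := by
    obtain ⟨m, rfl⟩ : ∃ m, d = m + 1 := ⟨d - 1, by omega⟩
    exact (c3_count m (by omega)).mono_exp (by push_cast; linarith)
  refine (((((red_count d).add (imp_count d)).add (c1_count d)).add (c2_count d hd)).add h3).mono fun N hN => ?_
  have hsub : (box d N).filter P ⊆ (((((box d N).filter (RedP d)) ∪ ((box d N).filter (ImpP d))) ∪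
      ((box d N).filter (C1P d N))) ∪ ((box d N).filter (C2P d N))) ∪ ((box d N).filter (C3P d N)) := by
    intro v hv
    obtain ⟨hb, hv⟩ := Finset.mem_filter.1 hv
    simp only [Finset.mem_union, Finset.mem_filter, hb, true_and]
    by_contra hc
    push Not at hc
    obtain ⟨⟨⟨⟨n1, n2⟩, n3⟩, n4⟩, n5⟩ := hc
    obtain ⟨K, _, _, a, h⟩ := hP v hv n1
    obtain ⟨C, κ, hR, hD⟩ := extract d hd v K a h
    have hC : C ≤ N := by
      by_contra hC
      exact n5 ⟨C, κ, hR, not_le.1 hC⟩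
    have hκ : ∏ p ∈ C.primeFactors, p ^ κ p ≤ N ^ 2 := by
      by_contra hκ
      exact n3 ⟨C, κ, hR, hC, not_le.1 hκ⟩
    exact n4 ⟨n2, K, inferInstance, inferInstance, a, h, hD.trans (Nat.mul_le_mul_left _ hκ)⟩
  have h1 := Finset.card_le_card hsub
  have u1 := Finset.card_union_le (box d N |>.filter (RedP d)) (box d N |>.filter (ImpP d))
  have u2 := Finset.card_union_le ((box d N).filter (RedP d) ∪ (box d N).filter (ImpP d)) ((box d N).filter (C1P d N))
  have u3 := Finset.card_union_le ((box d N).filter (RedP d) ∪ (box d N).filter (ImpP d) ∪ (box d N).filter (C1P d N))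
    ((box d N).filter (C2P d N))
  have u4 := Finset.card_union_le ((box d N).filter (RedP d) ∪ (box d N).filter (ImpP d) ∪ (box d N).filter (C1P d N) ∪
    (box d N).filter (C2P d N)) ((box d N).filter (C3P d N))
  norm_cast
  omega
open Classical in
lemma final_bound (d : ℕ) (hd : 2 ≤ d) (Q : ℤ[X] → Prop)
    (hQ : ∀ v : Fin d → ℤ, Q (poly d v) → ¬ RedP d v →
      ∃ (K : Type) (_ : Field K) (_ : NumberField K) (a : K), SqP d v K a) :
    ∃ C : ℝ, 0 < C ∧ ∃ Ω : ℕ, 0 < Ω ∧ ∀ N : ℕ, 2 ≤ N →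
      (Set.ncard {p : ℤ[X] | p.Monic ∧ p.natDegree = d ∧ (∀ i < d, |p.coeff i| ≤ (N : ℤ)) ∧ Q p} : ℝ) ≤
        C * (N : ℝ) ^ (d - 1) * Real.log N ^ Ω := by
  obtain ⟨C, hC, k, hk⟩ := total_count d hd (fun v => Q (poly d v)) hQ
  refine ⟨(C + 1) * 3 ^ (k + 1), by positivity, k + 1, by omega, fun N hN => ?_⟩
  have h1 : (Set.ncard {p : ℤ[X] | p.Monic ∧ p.natDegree = d ∧ (∀ i < d, |p.coeff i| ≤ (N : ℤ)) ∧ Q p}) ≤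
      ((box d N).filter fun v => Q (poly d v)).card := by
    have hs : {p : ℤ[X] | p.Monic ∧ p.natDegree = d ∧ (∀ i < d, |p.coeff i| ≤ (N : ℤ)) ∧ Q p} ⊆
        (((box d N).filter fun v => Q (poly d v)).image (poly d) : Finset ℤ[X]) := by
      rintro p ⟨p1, p2, p3, p4⟩
      have e := poly_coeff' d p p1 p2
      rw [Finset.mem_coe, Finset.mem_image]
      refine ⟨_, Finset.mem_filter.2 ⟨(mem_box ..).2 fun i => p3 i i.2, ?_⟩, e⟩
      rw [e]; exact p4
    refine (Set.ncard_le_ncard hs (Finset.finite_toSet _)).trans ?_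
    rw [Set.ncard_coe_finset]
    exact Finset.card_image_le
  have h2 : ((Set.ncard {p : ℤ[X] | p.Monic ∧ p.natDegree = d ∧ (∀ i < d, |p.coeff i| ≤ (N : ℤ)) ∧ Q p} : ℕ) : ℝ) ≤
      (((box d N).filter fun v => Q (poly d v)).card : ℝ) := by exact_mod_cast h1
  refine (h2.trans (hk N hN)).trans ?_
  have e : (N : ℝ) ^ ((d : ℝ) - 1) = (N : ℝ) ^ (d - 1) := by
    rw [← Real.rpow_natCast, Nat.cast_sub (by omega)]; simp
  have hl2 : Real.log 2 ≤ Real.log N := Real.log_le_log (by norm_num) (by exact_mod_cast hN)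
  have := Real.log_two_gt_d9
  have hl : 1 + Real.log N ≤ 3 * Real.log N := by linarith
  rw [e]
  calc C * (N : ℝ) ^ (d - 1) * (1 + Real.log N) ^ k ≤ (C + 1) * (N : ℝ) ^ (d - 1) * (1 + Real.log N) ^ (k + 1) := by
        gcongr
        · linarith
        · linarith
        · omega
    _ ≤ (C + 1) * (N : ℝ) ^ (d - 1) * (3 * Real.log N) ^ (k + 1) := by
        gcongr
    _ = _ := by rw [mul_pow]; ring
end GAC

open Polynomial Polynomial.Gal

attribute [local instance] Polynomial.Gal.splits_ℚ_ℂ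

open scoped Classical

/-- For `d ≥ 2`, the number of monic integer polynomials of degree `d` with coefficients
bounded by `N` whose Galois group lies in the alternating group (every element acts on the
complex roots by an even permutation) is `O(N ^ (d-1) * (log N) ^ Ω)`. -/
theorem galois_group_alternating_count (d : ℕ) (hd : 2 ≤ d) :
    ∃ C : ℝ, 0 < C ∧ ∃ Ω : ℕ, 0 < Ω ∧
      ∀ N : ℕ, 2 ≤ N →
        (Set.ncard {p : Polynomial ℤ |
            p.Monic ∧ p.natDegree = d ∧
            (∀ i < d, |p.coeff i| ≤ (N : ℤ)) ∧
            ∀ g : (p.map (Int.castRingHom ℚ)).Gal,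
              Equiv.Perm.sign (galActionHom (p.map (Int.castRingHom ℚ)) ℂ g) = 1} : ℝ) ≤
          C * (N : ℝ) ^ (d - 1) * Real.log N ^ Ω :=
  GAC.final_bound d hd (fun p => ∀ g : (p.map (Int.castRingHom ℚ)).Gal,
    Equiv.Perm.sign (galActionHom (p.map (Int.castRingHom ℚ)) ℂ g) = 1)
    fun v hv hr => GAC.sq_reduction d (by omega) v hr hv
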